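/- Let K be an algebraically closed field. Let φ: V' → V be a morphism of quasi-projective K-varieties whose image is dense in V, and let G be a finite group acting on V' by K-automorphisms such that φ is G-invariant. Then there exist projective K-varieties V̄ and V̄', a surjective morphism φ̄: V̄' → V̄, and locally closed immersions i: V ↪ V̄ and i': V' ↪ V̄' such that: (1) V̄' is pure of dimension dim V' and V̄ is pure of dimension dim V; (2) if V is integral and normal, V̄ can moreover be taken integral and normal with i(V) open and dense in V̄; (3) φ̄ ∘ i' = i ∘ φ, i.e. φ̄ extends φ; (4) there is a dense Zariski open subset of V̄ over which every fibre of φ̄ is pure; (5) the G-action on V' extends to a G-action on V̄' by automorphisms for which φ̄ is G-invariant. -/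

import Mathlib

open AlgebraicGeometry CategoryTheory CategoryTheory.Limits TopologicalSpace

noncomputable section

namespace HLpaper

attribute [local instance] MvPolynomial.gradedAlgebra

/-- The spectrum of a commutative ring as a scheme. -/
abbrev SpecOf (K : Type) [CommRing K] : Scheme := Spec (CommRingCat.of K)

/-- Projective `n`-space over `K`, as `Proj` of the polynomial ring in `n+1` variables. -/
abbrev ProjSpace (K : Type) [CommRing K] (n : ℕ) : Scheme :=
  Proj (MvPolynomial.homogeneousSubmodule (Fin (n + 1)) K)

/-- The structure morphism of projective space over `K`. -/
def ProjSpace.structMap (K : Type) [CommRing K] (n : ℕ) :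
    ProjSpace K n ⟶ SpecOf K :=
  Proj.toSpecZero _ ≫ Spec.map (CommRingCat.ofHom
    (algebraMap K ↥(MvPolynomial.homogeneousSubmodule (Fin (n + 1)) K 0)))

/-- A `K`-variety: a reduced scheme, separated and of finite type over `Spec K`. -/
structure Variety (K : Type) [Field K] where
  X : Scheme
  structMap : X ⟶ SpecOf K
  reduced : IsReduced X
  separated : IsSeparated structMap
  locallyOfFiniteType : LocallyOfFiniteType structMap
  quasiCompact : QuasiCompact structMap

variable {K : Type} [Field K]

/-- The dimension of a variety, as the Krull dimension of its underlying space. -/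
def Variety.dim (V : Variety K) : WithBot ℕ∞ := topologicalKrullDim V.X

/-- A topological space is pure of dimension `d` if all its irreducible components
have dimension `d`. -/
def IsPureOfDim (α : Type*) [TopologicalSpace α] (d : WithBot ℕ∞) : Prop :=
  ∀ T ∈ irreducibleComponents α, topologicalKrullDim T = d

/-- A topological space is pure if all its irreducible components have the same dimension. -/
def IsPure (α : Type*) [TopologicalSpace α] : Prop := ∃ d, IsPureOfDim α d

/-- The (topological) fibre of a morphism of schemes over a point of the target. -/
def fiber {X Y : Scheme} (f : X ⟶ Y) (y : Y) : Set X := f.base ⁻¹' {y}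

/-- A variety is quasi-projective if it admits a locally closed immersion
into some projective space over `K`. -/
def Variety.IsQuasiProjective (V : Variety K) : Prop :=
  ∃ (n : ℕ) (i : V.X ⟶ ProjSpace K n),
    IsImmersion i ∧ i ≫ ProjSpace.structMap K n = V.structMap

/-- A variety is projective if it admits a closed immersion
into some projective space over `K`. -/
def Variety.IsProjective (V : Variety K) : Prop :=
  ∃ (n : ℕ) (i : V.X ⟶ ProjSpace K n),
    IsClosedImmersion i ∧ i ≫ ProjSpace.structMap K n = V.structMap

/-- An action of a group `G` on a variety `V` by `K`-automorphisms. -/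
structure ActionOn (G : Type) [Group G] (V : Variety K) where
  ρ : G →* Aut V.X
  over' : ∀ g : G, (ρ g).hom ≫ V.structMap = V.structMap

/-- A morphism is invariant under a group action on its source. -/
def ActionOn.Invariant {G : Type} [Group G] {V : Variety K} (σ : ActionOn G V)
    {Y : Scheme} (φ : V.X ⟶ Y) : Prop :=
  ∀ g : G, (σ.ρ g).hom ≫ φ = φ

/-- A scheme is normal if all of its stalks are integrally closed domains. -/
def IsNormalScheme (X : Scheme) : Prop :=
  ∀ x : X, IsDomain (X.presheaf.stalk x) ∧ IsIntegrallyClosed (X.presheaf.stalk x)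

set_option linter.all false

section
open Ideal

theorem dim_integral (R S : Type) [CommRing R] [CommRing S] [Algebra R S] [Algebra.IsIntegral R S]
    (hinj : Function.Injective (algebraMap R S)) : ringKrullDim S = ringKrullDim R := by
  apply le_antisymm
  · refine Order.krullDim_le_of_strictMono (fun p => PrimeSpectrum.comap (algebraMap R S) p) ?_
    intro p q h
    exact Ideal.IsIntegral.comap_lt_comap (R := R) h
  · refine iSup_le fun l => ?_
    obtain ⟨Q, -, hQ, hQ'⟩ := exists_ideal_over_prime_of_isIntegral (S := S) l.head.asIdeal ⊥
      (by rw [← RingHom.ker_eq_comap_bot, (RingHom.injective_iff_ker_eq_bot _).1 hinj]; exact bot_le)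
    haveI : Q.LiesOver l.head.asIdeal := ⟨hQ'.symm⟩
    obtain ⟨L, hL, -⟩ := exists_ltSeries_of_hasGoingUp (S := S) l Q
    rw [← hL]
    exact Order.LTSeries.length_le_krullDim L

section
variable (K : Type) [Field K]

theorem dim_trdeg_aux (A : Type) [CommRing A] [IsDomain A] [Algebra K A] (n : ℕ)
    (g : MvPolynomial (Fin n) K →ₐ[K] A) (hg : Function.Injective g) (hi : g.IsIntegral) :
    ringKrullDim A = n ∧ Algebra.trdeg K A = n := by
  letI := g.toRingHom.toAlgebra
  haveI : IsScalarTower K (MvPolynomial (Fin n) K) A := IsScalarTower.of_algebraMap_eq fun x => by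
    simp [RingHom.algebraMap_toAlgebra]
  haveI : Algebra.IsIntegral (MvPolynomial (Fin n) K) A := ⟨hi⟩
  constructor
  · rw [dim_integral _ A hg, MvPolynomial.ringKrullDim_of_isNoetherianRing]
    simp
  · haveI : FaithfulSMul (MvPolynomial (Fin n) K) A := (faithfulSMul_iff_algebraMap_injective _ _).2 hg
    rw [← _root_.trdeg_add_eq K (MvPolynomial (Fin n) K) (A := A), _root_.trdeg_eq_zero (R := MvPolynomial (Fin n) K) (A := A)]
    simp

theorem dim_trdeg (A : Type) [CommRing A] [IsDomain A] [Algebra K A] [Algebra.FiniteType K A] :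
    ∃ n : ℕ, ringKrullDim A = n ∧ Algebra.trdeg K A = n := by
  obtain ⟨n, g, hg, hi⟩ := exists_integral_inj_algHom_of_fg K A
  exact ⟨n, dim_trdeg_aux K A n g hg hi⟩

theorem dim_le_of_inj (A B : Type) [CommRing A] [IsDomain A] [Algebra K A] [Algebra.FiniteType K A]
    [CommRing B] [IsDomain B] [Algebra K B] [Algebra.FiniteType K B] (f : A →ₐ[K] B)
    (hf : Function.Injective f) : ringKrullDim A ≤ ringKrullDim B := by
  obtain ⟨n, h1, h2⟩ := dim_trdeg K A
  obtain ⟨m, h3, h4⟩ := dim_trdeg K B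
  have := _root_.trdeg_le_of_injective f hf
  rw [h2, h4] at this
  rw [h1, h3]
  exact_mod_cast this

theorem dim_eq_of_algebraic (A B : Type) [CommRing A] [IsDomain A] [Algebra K A]
    [Algebra.FiniteType K A]
    [CommRing B] [IsDomain B] [Algebra K B] [Algebra.FiniteType K B] [Algebra A B]
    [IsScalarTower K A B] [Algebra.IsAlgebraic A B]
    (hf : Function.Injective (algebraMap A B)) : ringKrullDim A = ringKrullDim B := by
  obtain ⟨n, h1, h2⟩ := dim_trdeg K A
  obtain ⟨m, h3, h4⟩ := dim_trdeg K B
  haveI : FaithfulSMul A B := (faithfulSMul_iff_algebraMap_injective _ _).2 hf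
  have := _root_.trdeg_add_eq K A (A := B)
  rw [h2, h4, _root_.trdeg_eq_zero (R := A) (A := B)] at this
  rw [h1, h3]
  simp at this
  exact_mod_cast this

theorem mv_height_max (n : ℕ) (m : Ideal (MvPolynomial (Fin n) K)) [m.IsMaximal] : m.height = n := by
  induction n with
  | zero =>
    have : m = ⊥ := by
      haveI := MulEquiv.isField (Field.toIsField K) (MvPolynomial.isEmptyRingEquiv K (Fin 0)).toMulEquiv
      letI := this.toField
      exact (Ideal.eq_bot_or_top m).resolve_right (Ideal.IsMaximal.ne_top ‹_›)
    subst this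
    simp
  | succ n ih =>
    let e := MvPolynomial.finSuccEquiv K n
    let P := m.map e.toRingEquiv
    haveI : P.IsMaximal := Ideal.map_isMaximal_of_equiv e.toRingEquiv
    have : P.height = m.height := RingEquiv.height_map e.toRingEquiv m
    rw [← this]
    let p := P.under (MvPolynomial (Fin n) K)
    haveI : P.LiesOver p := ⟨rfl⟩
    haveI : p.IsMaximal := by
      have : (P.comap (algebraMap (MvPolynomial (Fin n) K) _)).IsMaximal := by
        exact Polynomial.isMaximal_comap_C_of_isJacobsonRing P
      exact this
    rw [Polynomial.height_eq_height_add_one p P, ih]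
    simp

theorem dim_quot_height_one (A : Type) [CommRing A] [IsDomain A] [Algebra K A]
    [Algebra.FiniteType K A] (p : Ideal A) [p.IsPrime] (hp : p.height = 1) :
    ringKrullDim (A ⧸ p) + 1 = ringKrullDim A := by
  obtain ⟨n, g, hg, hi⟩ := exists_finite_inj_algHom_of_fg K A
  letI := g.toRingHom.toAlgebra
  have halg : algebraMap (MvPolynomial (Fin n) K) A = g.toRingHom := rfl
  haveI : Module.Finite (MvPolynomial (Fin n) K) A := hi
  haveI : FaithfulSMul (MvPolynomial (Fin n) K) A := (faithfulSMul_iff_algebraMap_injective _ _).2 hg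
  haveI : IsNoetherianRing A := Algebra.FiniteType.isNoetherianRing K A
  have hdimA : ringKrullDim A = n := (dim_trdeg_aux K A n g hg (RingHom.IsIntegral.of_finite hi)).1
  let p0 := p.under (MvPolynomial (Fin n) K)
  haveI : p.LiesOver p0 := ⟨rfl⟩
  have hpbot : p ≠ ⊥ := p.ne_bot_of_height_eq_one hp
  have hp0bot : p0 ≠ ⊥ := Ideal.IsIntegral.comap_ne_bot _ hpbot
  have h1 : p0.height = 1 := by
    have := Ideal.height_eq_height_add_of_liesOver_of_hasGoingDown p0 p
    rw [hp] at this
    apply le_antisymm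
    · rw [this]; exact le_self_add
    · rw [ENat.one_le_iff_ne_zero]
      intro h
      rw [Ideal.height_eq_zero_iff] at h
      apply hp0bot
      simpa [IsDomain.minimalPrimes_eq_singleton_bot] using h
  obtain ⟨⟨f, hf⟩⟩ := UniqueFactorizationMonoid.isPrincipal_of_height_eq_one h1
  have hf' : p0 = Ideal.span {f} := hf
  have hfne : f ≠ 0 := by
    rintro rfl
    apply hp0bot; rw [hf']; simp
  have hdim : ringKrullDim (A ⧸ p) = ringKrullDim (MvPolynomial (Fin n) K ⧸ p0) := by
    apply dim_integral
    exact FaithfulSMul.algebraMap_injective _ _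
  have hmv : ringKrullDim (MvPolynomial (Fin n) K) = n := by
    rw [MvPolynomial.ringKrullDim_of_isNoetherianRing]; simp
  rw [hdim, hdimA]
  apply le_antisymm
  · rw [← hmv, hf']
    exact ringKrullDim_quotient_succ_le_of_nonZeroDivisor (mem_nonZeroDivisors_of_ne_zero hfne)
  · obtain ⟨m, hm, hle⟩ := Ideal.exists_le_maximal p0 (Ideal.IsPrime.ne_top inferInstance)
    have h2 := mv_height_max K n m
    have h3 : f ∈ m := hle (by rw [hf']; exact Ideal.mem_span_singleton_self f)
    have h4 := Ideal.height_le_ringKrullDim_quotient_add_one h3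
    rw [h2] at h4
    rw [hf']
    exact_mod_cast h4
end

end

section
open Ideal
open scoped TensorProduct

theorem generic_noether (R B : Type) [CommRing R] [IsDomain R] [CommRing B] [IsDomain B] [Algebra R B]
    [Algebra.FiniteType R B] (hinj : Function.Injective (algebraMap R B)) :
    ∃ (r : ℕ) (t : Fin r → B), AlgebraicIndependent R t ∧ ∃ a : R, a ≠ 0 ∧
      ∀ b : B, ∃ N : ℕ, (MvPolynomial.aeval (R := R) t).toRingHom.IsIntegralElem (a ^ N • b) := by
  classical
  let F := FractionRing R
  let M := Algebra.algebraMapSubmonoid B (nonZeroDivisors R)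
  obtain ⟨L, _, _, _⟩ : ∃ (L : Type) (_ : CommRing L) (_ : Algebra B L), IsLocalization M L :=
    ⟨Localization M, inferInstance, inferInstance, inferInstance⟩
  letI : Algebra R L := ((algebraMap B L).comp (algebraMap R B)).toAlgebra
  haveI : IsScalarTower R B L := IsScalarTower.of_algebraMap_eq' rfl
  have hM : M ≤ nonZeroDivisors B := by
    rintro _ ⟨s, hs, rfl⟩
    exact mem_nonZeroDivisors_of_ne_zero (by
      rw [Ne, map_eq_zero_iff _ hinj]; exact nonZeroDivisors.ne_zero hs)
  letI : Algebra F L := localizationAlgebra (nonZeroDivisors R) B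
  haveI : IsScalarTower R F L := IsScalarTower.of_algebraMap_eq' (by
      rw [localizationAlgebraMap_def, IsLocalization.map_comp]; rfl)
  haveI : IsDomain L := IsLocalization.isDomain_of_le_nonZeroDivisors L hM
  have hBL : Function.Injective (algebraMap B L) := IsLocalization.injective L hM
  haveI : Algebra.FiniteType F L := by
    have h : (algebraMap R B).FiniteType := by rw [RingHom.finiteType_algebraMap]; infer_instance
    haveI : IsLocalization (Submonoid.map (algebraMap R B) (nonZeroDivisors R)) L := ‹_›
    have := RingHom.finiteType_localizationPreserves (algebraMap R B) (nonZeroDivisors R) F L h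
    rw [← RingHom.finiteType_algebraMap]
    exact this
  obtain ⟨r, g, hg, hi⟩ := exists_integral_inj_algHom_of_fg F L
  -- clear denominators
  obtain ⟨⟨_, s, hs, rfl⟩, hsm⟩ := IsLocalization.exist_integer_multiples_of_finset M
    (Finset.univ.image fun i : Fin r => g (MvPolynomial.X i))
  have hs0 : s ≠ 0 := nonZeroDivisors.ne_zero hs
  have : ∀ i : Fin r, ∃ b : B, algebraMap B L b = s • g (MvPolynomial.X i) := by
    intro i
    obtain ⟨b, hb⟩ := hsm (g (MvPolynomial.X i)) (by simp)
    refine ⟨b, hb.trans ?_⟩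
    rw [Algebra.smul_def, Algebra.smul_def, ← IsScalarTower.algebraMap_apply]
  choose t ht using this
  have hsF : algebraMap R F s ≠ 0 := by
    rw [Ne, map_eq_zero_iff _ (IsFractionRing.injective R F)]; exact hs0
  let h : MvPolynomial (Fin r) F →ₐ[F] L := MvPolynomial.aeval (fun i => algebraMap B L (t i))
  let e : MvPolynomial (Fin r) F →ₐ[F] MvPolynomial (Fin r) F :=
    MvPolynomial.aeval (fun i => MvPolynomial.C (algebraMap R F s) * MvPolynomial.X i)
  let e' : MvPolynomial (Fin r) F →ₐ[F] MvPolynomial (Fin r) F :=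
    MvPolynomial.aeval (fun i => MvPolynomial.C (algebraMap R F s)⁻¹ * MvPolynomial.X i)
  have hee : e.comp e' = AlgHom.id _ _ := by
    ext i : 1
    simp only [e, e', AlgHom.comp_apply, MvPolynomial.aeval_X, map_mul, MvPolynomial.algHom_C,
      MvPolynomial.algebraMap_eq, AlgHom.id_apply]
    rw [← mul_assoc, ← map_mul, inv_mul_cancel₀ hsF, map_one, one_mul]
  have hee' : e'.comp e = AlgHom.id _ _ := by
    ext i : 1
    simp only [e, e', AlgHom.comp_apply, MvPolynomial.aeval_X, map_mul, MvPolynomial.algHom_C,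
      MvPolynomial.algebraMap_eq, AlgHom.id_apply]
    rw [← mul_assoc, ← map_mul, mul_inv_cancel₀ hsF, map_one, one_mul]
  have hge : h = g.comp e := by
    ext i : 1
    simp only [h, e, AlgHom.comp_apply, MvPolynomial.aeval_X, map_mul, MvPolynomial.algHom_C]
    rw [ht, Algebra.smul_def, ← IsScalarTower.algebraMap_apply]
  have heinj : Function.Injective e := by
    intro x y hxy
    have := congrArg e' hxy
    rw [← AlgHom.comp_apply, ← AlgHom.comp_apply, hee'] at this
    simpa using this
  have hesurj : Function.Surjective e := fun x => ⟨e' x, by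
    rw [← AlgHom.comp_apply, hee]; rfl⟩
  have hhinj : Function.Injective h := by
    rw [hge]; exact hg.comp heinj
  have hhint : h.toRingHom.IsIntegral := by
    rw [hge]
    exact RingHom.IsIntegral.trans e.toRingHom g.toRingHom (RingHom.isIntegral_of_surjective _ hesurj) hi
  -- compat
  have hcomp : ∀ P : MvPolynomial (Fin r) R, algebraMap B L (MvPolynomial.aeval t P) =
      h (MvPolynomial.map (algebraMap R F) P) := by
    intro P
    simp only [h, MvPolynomial.aeval_map_algebraMap]
    exact (MvPolynomial.aeval_algebraMap_apply L t P).symm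
  refine ⟨r, t, ?_, ?_⟩
  · rw [AlgebraicIndependent]
    intro P Q hPQ
    have := congrArg (algebraMap B L) hPQ
    rw [hcomp, hcomp] at this
    exact MvPolynomial.map_injective _ (IsFractionRing.injective R F) (hhinj this)
  · letI := MvPolynomial.algebraMvPolynomial (R := R) (S := F) (σ := Fin r)
    letI : Algebra (MvPolynomial (Fin r) F) L := h.toRingHom.toAlgebra
    letI a1 : Algebra (MvPolynomial (Fin r) R) B := (MvPolynomial.aeval (R := R) t).toRingHom.toAlgebra
    letI : Algebra (MvPolynomial (Fin r) R) L := ((algebraMap B L).comp (MvPolynomial.aeval (R := R) t).toRingHom).toAlgebra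
    haveI : IsScalarTower (MvPolynomial (Fin r) R) B L := IsScalarTower.of_algebraMap_eq' rfl
    haveI : IsScalarTower (MvPolynomial (Fin r) R) (MvPolynomial (Fin r) F) L :=
      IsScalarTower.of_algebraMap_eq fun P => hcomp P
    have key : ∀ b : B, ∃ a : R, a ≠ 0 ∧ IsIntegral (MvPolynomial (Fin r) R) (a • b) := by
      intro b
      obtain ⟨⟨_, m, hm, rfl⟩, hmi⟩ := IsIntegral.exists_multiple_integral_of_isLocalization
        (R := MvPolynomial (Fin r) R) (Rₘ := MvPolynomial (Fin r) F)
        ((nonZeroDivisors R).map (MvPolynomial.C (σ := Fin r))) (algebraMap B L b) (hhint _)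
      refine ⟨m, nonZeroDivisors.ne_zero hm, ?_⟩
      rw [← isIntegral_algebraMap_iff (B := L) hBL]
      convert hmi using 1
      rw [Submonoid.smul_def, Algebra.smul_def, Algebra.smul_def, map_mul]
      congr 1
      rw [IsScalarTower.algebraMap_apply (MvPolynomial (Fin r) R) B L]
      congr 1
      exact ((MvPolynomial.aeval (R := R) t).commutes m).symm
    obtain ⟨S, hS⟩ := (inferInstance : Algebra.FiniteType R B).out
    choose c hc hci using key
    have hRM : IsScalarTower R (MvPolynomial (Fin r) R) B := IsScalarTower.of_algebraMap_eq fun x =>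
      ((MvPolynomial.aeval (R := R) t).commutes x).symm
    refine ⟨∏ b ∈ S, c b, Finset.prod_ne_zero_iff.2 fun b _ => hc b, ?_⟩
    set a := ∏ b ∈ S, c b with ha
    have hsm : ∀ (x : R) (b : B), IsIntegral (MvPolynomial (Fin r) R) b →
        IsIntegral (MvPolynomial (Fin r) R) (x • b) := by
      intro x b hb
      rw [← algebraMap_smul (MvPolynomial (Fin r) R) x b]
      exact hb.smul _
    intro b
    have hb : b ∈ Algebra.adjoin R (S : Set B) := by rw [hS]; trivial
    suffices ∃ N, IsIntegral (MvPolynomial (Fin r) R) (a ^ N • b) from this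
    induction hb using Algebra.adjoin_induction with
    | mem x hx =>
      refine ⟨1, ?_⟩
      rw [pow_one, ha, ← Finset.mul_prod_erase S c hx, mul_comm, mul_smul]
      exact hsm _ _ (hci x)
    | algebraMap x =>
      refine ⟨0, ?_⟩
      rw [pow_zero, one_smul, IsScalarTower.algebraMap_apply R (MvPolynomial (Fin r) R) B]
      exact isIntegral_algebraMap
    | add x y _ _ hx hy =>
      obtain ⟨N, hN⟩ := hx
      obtain ⟨N', hN'⟩ := hy
      refine ⟨N + N', ?_⟩
      rw [smul_add]
      refine IsIntegral.add ?_ ?_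
      · rw [pow_add, mul_comm, mul_smul]; exact hsm _ _ hN
      · rw [pow_add, mul_smul]; exact hsm _ _ hN'
    | mul x y _ _ hx hy =>
      obtain ⟨N, hN⟩ := hx
      obtain ⟨N', hN'⟩ := hy
      refine ⟨N + N', ?_⟩
      rw [pow_add, ← smul_mul_smul_comm]
      exact hN.mul hN'

/-- Lifting a prime along `C ⊆ B` with `C[1/a] = B[1/a]`. -/
theorem lift_prime_aux (B : Type) [CommRing B] (C : Subring B) (a : B) (haC : a ∈ C)
    (hC : ∀ b : B, ∃ N : ℕ, a ^ N * b ∈ C) (q : Ideal B) [q.IsPrime] (haq : a ∉ q)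
    (P : Ideal C) [P.IsPrime] (hP : P ≤ q.comap C.subtype) :
    ∃ q' : Ideal B, q'.IsPrime ∧ q' ≤ q ∧ q'.comap C.subtype = P := by
  have haP : ∀ N, (⟨a, haC⟩ : C) ^ N ∉ P := fun N h =>
    haq (by have := hP (Ideal.IsPrime.mem_of_pow_mem ‹_› N h); exact this)
  let q' : Ideal B :=
    { carrier := {b | ∃ N : ℕ, ∃ c ∈ P, (c : B) = a ^ N * b}
      zero_mem' := ⟨0, 0, P.zero_mem, by simp⟩
      add_mem' := by
        rintro x y ⟨N, c, hc, h⟩ ⟨N', c', hc', h'⟩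
        refine ⟨N + N', (⟨a, haC⟩ : C) ^ N' * c + (⟨a, haC⟩ : C) ^ N * c', P.add_mem
          (P.mul_mem_left _ hc) (P.mul_mem_left _ hc'), ?_⟩
        push_cast
        rw [h, h']; ring
      smul_mem' := by
        rintro x y ⟨N, c, hc, h⟩
        obtain ⟨M, hM⟩ := hC x
        refine ⟨M + N, ⟨_, hM⟩ * c, P.mul_mem_left _ hc, ?_⟩
        push_cast
        rw [h, smul_eq_mul]; ring }
  have hmem : ∀ c : C, (c : B) ∈ q' ↔ c ∈ P := by
    intro c
    constructor
    · rintro ⟨N, c', hc', h⟩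
      have : c' = (⟨a, haC⟩ : C) ^ N * c := by
        apply Subtype.ext
        push_cast
        exact h
      rw [this] at hc'
      exact (Ideal.IsPrime.mem_or_mem ‹_› hc').resolve_left (haP N)
    · intro h
      exact ⟨0, c, h, by simp⟩
  refine ⟨q', ⟨?_, ?_⟩, ?_, ?_⟩
  · intro h
    have : ((1 : C) : B) ∈ q' := by rw [h]; trivial
    rw [hmem] at this
    exact (Ideal.ne_top_iff_one P).1 (Ideal.IsPrime.ne_top ‹_›) this
  · rintro x y ⟨N, c, hc, h⟩
    obtain ⟨M, hM⟩ := hC x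
    obtain ⟨M', hM'⟩ := hC y
    have : (⟨_, hM⟩ * ⟨_, hM'⟩ : C) ∈ P := by
      have h2 : (⟨a, haC⟩ : C) ^ N * (⟨_, hM⟩ * ⟨_, hM'⟩ : C) = (⟨a, haC⟩ : C) ^ (M + M') * c := by
        apply Subtype.ext
        push_cast
        rw [h]; ring
      refine (Ideal.IsPrime.mem_or_mem ‹P.IsPrime› (x := (⟨a, haC⟩ : C) ^ N) ?_).resolve_left (haP N)
      rw [h2]
      exact P.mul_mem_left _ hc
    rcases Ideal.IsPrime.mem_or_mem ‹P.IsPrime› this with h | h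
    · exact Or.inl ⟨M, _, h, rfl⟩
    · exact Or.inr ⟨M', _, h, rfl⟩
  · rintro x ⟨N, c, hc, h⟩
    have : a ^ N * x ∈ q := by rw [← h]; exact hP hc
    exact (Ideal.IsPrime.mem_or_mem ‹q.IsPrime› this).resolve_left
      fun h => haq (Ideal.IsPrime.mem_of_pow_mem ‹_› N h)
  · ext c; exact hmem c

theorem generic_fibre (K A B : Type) [Field K] [CommRing A] [IsDomain A] [CommRing B] [IsDomain B]
    [Algebra K A] [Algebra K B] [Algebra A B] [IsScalarTower K A B] [Algebra.FiniteType K A]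
    [Algebra.FiniteType K B] (hinj : Function.Injective (algebraMap A B)) :
    ∃ (r : ℕ) (a : A), a ≠ 0 ∧ ringKrullDim B = ringKrullDim A + r ∧
      ∀ (p : Ideal A) [p.IsPrime], a ∉ p → ∀ Q ∈ minimalPrimes (p.Fiber B),
        ringKrullDim (p.Fiber B ⧸ Q) = r := by
  classical
  obtain ⟨n, g, hg, hgi⟩ := exists_integral_inj_algHom_of_fg K A
  let A0 := MvPolynomial (Fin n) K
  letI : Algebra A0 A := g.toRingHom.toAlgebra
  letI : Algebra A0 B := ((algebraMap A B).comp (algebraMap A0 A)).toAlgebra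
  haveI : IsScalarTower A0 A B := IsScalarTower.of_algebraMap_eq' rfl
  haveI : IsScalarTower K A0 A := IsScalarTower.of_algebraMap_eq fun x => (g.commutes x).symm
  haveI : IsScalarTower K A0 B := IsScalarTower.of_algebraMap_eq fun x => by
    rw [IsScalarTower.algebraMap_apply A0 A B, ← IsScalarTower.algebraMap_apply K A0 A, ← IsScalarTower.algebraMap_apply]
  haveI : Algebra.IsIntegral A0 A := ⟨hgi⟩
  have hinj0 : Function.Injective (algebraMap A0 B) := hinj.comp hg
  haveI : FaithfulSMul A0 B := (faithfulSMul_iff_algebraMap_injective _ _).2 hinj0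
  haveI : Algebra.FiniteType A0 B := Algebra.FiniteType.of_restrictScalars_finiteType K A0 B
  obtain ⟨r, t, hti, a0, ha0, hIntg⟩ := generic_noether A0 B hinj0
  let R := MvPolynomial (Fin r) A0
  letI : Algebra R B := (MvPolynomial.aeval (R := A0) t).toRingHom.toAlgebra
  haveI : IsScalarTower A0 R B := IsScalarTower.of_algebraMap_eq fun x =>
    ((MvPolynomial.aeval (R := A0) t).commutes x).symm
  haveI : IsScalarTower K R B := IsScalarTower.of_algebraMap_eq fun x => by
    rw [IsScalarTower.algebraMap_apply K A0 R, ← IsScalarTower.algebraMap_apply A0 R B, ← IsScalarTower.algebraMap_apply]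
  have hRB : Function.Injective (algebraMap R B) := hti
  haveI : FaithfulSMul R B := (faithfulSMul_iff_algebraMap_injective _ _).2 hRB
  let C := integralClosure R B
  let ab : B := algebraMap A0 B a0
  have hab : ab ≠ 0 := by rw [Ne, map_eq_zero_iff _ hinj0]; exact ha0
  have haC : ab ∈ C := by
    have : ab = algebraMap R B (algebraMap A0 R a0) := IsScalarTower.algebraMap_apply A0 R B a0
    rw [this]; exact C.algebraMap_mem _
  have hC : ∀ b : B, ∃ N : ℕ, ab ^ N * b ∈ C := by
    intro b
    obtain ⟨N, hN⟩ := hIntg b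
    refine ⟨N, ?_⟩
    rw [Algebra.smul_def, map_pow] at hN
    exact hN
  have hdim : ringKrullDim B = ringKrullDim A + r := by
    obtain ⟨m, h1, h2⟩ := dim_trdeg K B
    rw [h1, (dim_trdeg_aux K A n g hg hgi).1]
    haveI : Algebra.IsAlgebraic R B := by
      constructor
      intro b
      obtain ⟨N, hN⟩ := hC b
      have h3 : IsAlgebraic R (ab ^ N * b) := IsIntegral.isAlgebraic hN
      have h4 : IsAlgebraic R (algebraMap R B (algebraMap A0 R a0 ^ N)) := isAlgebraic_algebraMap _
      have h5 : algebraMap R B (algebraMap A0 R a0 ^ N) = ab ^ N := by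
        rw [map_pow, ← IsScalarTower.algebraMap_apply A0 R B]
      rw [h5] at h4
      exact IsAlgebraic.of_mul (mem_nonZeroDivisors_of_ne_zero (pow_ne_zero _ hab)) h4 h3
    have h3 := trdeg_add_eq K R (A := B)
    have h4 := trdeg_add_eq K A0 (A := R)
    rw [_root_.trdeg_eq_zero (R := R) (A := B), h2, ← h4] at h3
    simp [R, A0] at h3
    norm_cast at h3
    rw [← h3]; push_cast; rfl
  refine ⟨r, algebraMap A0 A a0, ?_, hdim, ?_⟩
  · exact (map_ne_zero_iff _ hg).2 ha0
  intro p hp hap Q hQ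
  haveI : Q.IsPrime := hQ.1.1
  let jB : B →ₐ[A] p.Fiber B := Algebra.TensorProduct.includeRight
  let q : Ideal B := Q.comap jB.toRingHom
  have hqA : q.comap (algebraMap A B) = p := by
    rw [Ideal.comap_comap, AlgHom.toRingHom_eq_coe, AlgHom.comp_algebraMap]
    exact (Ideal.over_def Q p).symm
  have haq : ab ∉ q := by
    intro h
    apply hap
    rw [← hqA]
    exact h
  let p0 : Ideal A0 := p.comap (algebraMap A0 A)
  let P0 : Ideal R := p0.map (MvPolynomial.C)
  haveI : p0.IsPrime := inferInstance
  haveI : P0.IsPrime := by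
    have h := MvPolynomial.ker_map (σ := Fin r) (Ideal.Quotient.mk p0)
    rw [Ideal.mk_ker] at h
    change (p0.map MvPolynomial.C).IsPrime
    rw [← h]
    exact RingHom.ker_isPrime _
  haveI : q.IsPrime := inferInstance
  have hqA0 : q.comap (algebraMap A0 B) = p0 := by
    rw [IsScalarTower.algebraMap_eq A0 A B, ← Ideal.comap_comap, hqA]
  have hP0q : P0 ≤ q.comap (algebraMap R B) := by
    rw [Ideal.map_le_iff_le_comap, Ideal.comap_comap]
    change p0 ≤ q.comap ((algebraMap R B).comp (algebraMap A0 R))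
    rw [← IsScalarTower.algebraMap_eq, hqA0]
  let qC : Ideal C := q.comap (algebraMap C B)
  haveI : qC.IsPrime := inferInstance
  haveI : qC.LiesOver (qC.under R) := ⟨rfl⟩
  haveI : FaithfulSMul R C := (faithfulSMul_iff_algebraMap_injective _ _).2 (by
    have : Function.Injective ((algebraMap C B) ∘ (algebraMap R C)) := hRB
    exact this.of_comp)
  haveI : Algebra.IsIntegral R C := inferInstance
  haveI : IsIntegrallyClosed R := inferInstance
  obtain ⟨q'C, hle, hpr, hlo⟩ := Ideal.exists_ideal_le_liesOver_of_le (S := C) (p := P0) (q := qC.under R) qC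
    hP0q
  obtain ⟨q', hq'p, hq'q, hq'C⟩ := lift_prime_aux B C.toSubring ab haC hC q haq q'C hle
  have hq'R : q'.comap (algebraMap R B) = P0 := by
    rw [hlo.over, ← hq'C]; rfl
  have hq'A0 : q'.comap (algebraMap A0 B) = p0 := by
    rw [IsScalarTower.algebraMap_eq A0 R B, ← Ideal.comap_comap, hq'R]
    ext x
    change MvPolynomial.C x ∈ P0 ↔ _
    rw [MvPolynomial.mem_map_C_iff]
    constructor
    · intro h
      simpa using h 0
    · intro h m
      rw [MvPolynomial.coeff_C]
      split_ifs
      · exact h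
      · exact p0.zero_mem
  have hq'A : q'.comap (algebraMap A B) = p := by
    have hle : q'.comap (algebraMap A B) ≤ p := by
      rw [← hqA]; exact Ideal.comap_mono hq'q
    by_contra hne
    have := Ideal.IsIntegral.comap_lt_comap (R := A0) (lt_of_le_of_ne hle hne)
    rw [Ideal.comap_comap, ← IsScalarTower.algebraMap_eq, hq'A0] at this
    exact lt_irrefl _ this
  have hqq' : q = q' := by
    let e := PrimeSpectrum.preimageOrderIsoFiber A B ⟨p, hp⟩
    let x : PrimeSpectrum.comap (algebraMap A B) ⁻¹' {⟨p, hp⟩} := ⟨⟨q, inferInstance⟩, PrimeSpectrum.ext hqA⟩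
    let x' : PrimeSpectrum.comap (algebraMap A B) ⁻¹' {⟨p, hp⟩} := ⟨⟨q', inferInstance⟩, PrimeSpectrum.ext hq'A⟩
    have hx : e.symm ⟨Q, inferInstance⟩ = x := rfl
    have hx' : x' ≤ x := hq'q
    rw [← hx, OrderIso.le_symm_apply] at hx'
    have h1 : Q = (e x').asIdeal := le_antisymm (hQ.2 ⟨(e x').2, bot_le⟩ hx') hx'
    have h2 : e x' = ⟨Q, inferInstance⟩ := PrimeSpectrum.ext h1.symm
    have h3 : x' = x := by rw [← hx, ← h2, OrderIso.symm_apply_apply]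
    exact congrArg (fun y => y.1.asIdeal) h3.symm
  -- the quotient
  let κ := p.ResidueField
  obtain ⟨D, iCR, iDom, iAlg, mkQ, hsurj, hker, hDdim⟩ : ∃ (D : Type) (_ : CommRing D) (_ : IsDomain D)
      (_ : Algebra κ D) (f : p.Fiber B →ₐ[κ] D), Function.Surjective f ∧ RingHom.ker f = Q ∧
      ringKrullDim (p.Fiber B ⧸ Q) = ringKrullDim D :=
    ⟨p.Fiber B ⧸ Q, inferInstance, inferInstance, inferInstance, Ideal.Quotient.mkₐ κ Q,
      Ideal.Quotient.mkₐ_surjective κ Q, Ideal.Quotient.mkₐ_ker κ Q, rfl⟩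
  rw [hDdim]
  haveI : p.LiesOver p0 := ⟨rfl⟩
  letI : Algebra (A0 ⧸ p0) κ := ((algebraMap (A ⧸ p) κ).comp (algebraMap (A0 ⧸ p0) (A ⧸ p))).toAlgebra
  haveI : IsScalarTower (A0 ⧸ p0) (A ⧸ p) κ := IsScalarTower.of_algebraMap_eq' rfl
  letI : Algebra (A0 ⧸ p0) D := RingHom.toAlgebra (R := A0 ⧸ p0) (S := D) ((algebraMap κ D).comp (algebraMap (A0 ⧸ p0) κ))
  haveI : IsScalarTower (A0 ⧸ p0) κ D := IsScalarTower.of_algebraMap_eq' rfl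
  haveI : Algebra.IsAlgebraic (A0 ⧸ p0) κ := by
    haveI : Algebra.IsAlgebraic (A ⧸ p) κ := IsLocalization.isAlgebraic (R := A ⧸ p) (S := κ) (nonZeroDivisors (A ⧸ p))
    exact Algebra.IsAlgebraic.trans (A0 ⧸ p0) (A ⧸ p) κ
  let π : B →+* D := mkQ.toRingHom.comp jB.toRingHom
  have hπker : RingHom.ker π = q := by
    rw [← RingHom.comap_ker]
    exact congrArg _ hker
  have hπA : ∀ x : A, π (algebraMap A B x) = algebraMap κ D (algebraMap A κ x) := by
    intro x
    change mkQ (jB (algebraMap A B x)) = _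
    rw [jB.commutes]
    exact mkQ.commutes _
  have hπA0 : ∀ x : A0, π (algebraMap A0 B x) = algebraMap (A0 ⧸ p0) D (Ideal.Quotient.mk p0 x) := by
    intro x
    rw [IsScalarTower.algebraMap_apply A0 A B, hπA]
    rfl
  have hind : AlgebraicIndependent (A0 ⧸ p0) (fun i => π (t i)) := by
    rw [algebraicIndependent_iff]
    intro P hP
    obtain ⟨P, rfl⟩ := MvPolynomial.map_surjective (Ideal.Quotient.mk p0) Ideal.Quotient.mk_surjective P
    have h1 : MvPolynomial.aeval (fun i => π (t i)) (MvPolynomial.map (Ideal.Quotient.mk p0) P) =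
        π (algebraMap R B P) := by
      change _ = π (MvPolynomial.aeval t P)
      rw [MvPolynomial.aeval_def, MvPolynomial.eval₂_map, MvPolynomial.aeval_def, MvPolynomial.hom_eval₂]
      congr 1
      exact RingHom.ext fun x => (hπA0 x).symm
    rw [h1] at hP
    have h2 : P ∈ P0 := by
      rw [← hq'R, ← hqq', Ideal.mem_comap, ← hπker]
      exact hP
    ext m
    rw [MvPolynomial.coeff_map, MvPolynomial.coeff_zero]
    exact Ideal.Quotient.eq_zero_iff_mem.2 (MvPolynomial.mem_map_C_iff.1 h2 m)
  have hind' : AlgebraicIndependent κ (fun i => π (t i)) := hind.extendScalars κ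
  refine (dim_trdeg_aux κ D r (MvPolynomial.aeval fun i => π (t i)) hind' ?_).1
  let h : MvPolynomial (Fin r) κ →ₐ[κ] D := MvPolynomial.aeval fun i => π (t i)
  let Rκ : R →+* MvPolynomial (Fin r) κ := MvPolynomial.map ((algebraMap A κ).comp (algebraMap A0 A))
  have hcomm : h.toRingHom.comp Rκ = π.comp (algebraMap R B) := by
    apply MvPolynomial.ringHom_ext
    · intro x
      have : algebraMap R B (MvPolynomial.C x) = algebraMap A0 B x := (MvPolynomial.aeval t).commutes x
      simp only [RingHom.comp_apply, Rκ, MvPolynomial.map_C, this]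
      rw [IsScalarTower.algebraMap_apply A0 A B, hπA]
      exact h.commutes _
    · intro i
      have : algebraMap R B (MvPolynomial.X i) = t i := MvPolynomial.aeval_X _ _
      simp only [RingHom.comp_apply, Rκ, MvPolynomial.map_X, this]
      exact MvPolynomial.aeval_X _ _
  have hmap : ∀ c : B, c ∈ C → h.toRingHom.IsIntegralElem (π c) := by
    rintro c ⟨P, hP, hPc⟩
    refine ⟨P.map Rκ, hP.map _, ?_⟩
    rw [Polynomial.eval₂_map, hcomm, ← Polynomial.hom_eval₂, hPc, map_zero]
  have ha0κ : algebraMap A κ (algebraMap A0 A a0) ≠ 0 := by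
    rwa [Ne, Ideal.algebraMap_residueField_eq_zero]
  have hκ : ∀ x : κ, h.toRingHom.IsIntegralElem (algebraMap κ D x) := by
    intro x
    rw [← h.commutes]
    exact RingHom.isIntegralElem_map _
  have hB : ∀ b : B, h.toRingHom.IsIntegralElem (π b) := by
    intro b
    obtain ⟨N, hN⟩ := hC b
    have h1 := hmap _ hN
    have h2 : π b = algebraMap κ D ((algebraMap A κ (algebraMap A0 A a0))⁻¹ ^ N) * π (ab ^ N * b) := by
      have : π ab = algebraMap κ D (algebraMap A κ (algebraMap A0 A a0)) := hπA _
      rw [map_mul, ← mul_assoc, map_pow, map_pow, this, ← mul_pow, ← map_mul, inv_mul_cancel₀ ha0κ]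
      simp
    rw [h2]
    exact (hκ _).mul h.toRingHom h1
  intro d
  obtain ⟨d, rfl⟩ := hsurj d
  induction d using TensorProduct.induction_on with
  | zero => rw [map_zero]; exact RingHom.isIntegralElem_zero _
  | add x y hx hy => rw [map_add]; exact hx.add _ hy
  | tmul x b =>
    have : x ⊗ₜ[A] b = algebraMap κ (p.Fiber B) x * jB b := by
      simp [jB, Algebra.TensorProduct.algebraMap_apply]
      rfl
    rw [this, map_mul, mkQ.commutes]
    exact (hκ x).mul h.toRingHom (hB b)

end

section

theorem finite_of_comp_inj {A C M : Type} [CommRing A] [IsNoetherianRing A] [CommRing C] [CommRing M]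
    (h : A →+* C) (F : C →+* M) (hF : Function.Injective F) (hfin : (F.comp h).Finite) : h.Finite := by
  letI := h.toAlgebra
  letI := (F.comp h).toAlgebra
  haveI : Module.Finite A M := hfin
  haveI : IsNoetherian A M := isNoetherian_of_isNoetherianRing_of_finite A M
  let l : C →ₐ[A] M := { F with commutes' := fun x => rfl }
  exact Module.Finite.of_injective l.toLinearMap hF

theorem frob_finite (K : Type) [Field K] [IsAlgClosed K] (n p e : ℕ) [ExpChar K p] :
    (iterateFrobenius (MvPolynomial (Fin n) K) p e).Finite := by
  refine RingHom.IsIntegral.to_finite ?_ ?_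
  · intro x
    refine ⟨Polynomial.X ^ (p ^ e) - Polynomial.C x, Polynomial.monic_X_pow_sub_C _ ?_, ?_⟩
    · exact (expChar_pow_pos K p e).ne'
    · simp [iterateFrobenius_def]
  · haveI := PerfectField.toPerfectRing (K := K) p
    apply RingHom.FiniteType.of_comp_finiteType (f := (MvPolynomial.C : K →+* MvPolynomial (Fin n) K))
    have : (iterateFrobenius (MvPolynomial (Fin n) K) p e).comp MvPolynomial.C =
      MvPolynomial.C.comp (iterateFrobeniusEquiv K p e).toRingHom := by
      ext x
      simp [iterateFrobenius_def]
    rw [this]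
    refine RingHom.FiniteType.comp ?_ ?_
    · have : Algebra.FiniteType K (MvPolynomial (Fin n) K) := inferInstance
      exact RingHom.finiteType_algebraMap.2 this
    · exact RingHom.FiniteType.of_surjective _ (iterateFrobeniusEquiv K p e).surjective

theorem finite_integralClosure_poly (K : Type) [Field K] [IsAlgClosed K] (n : ℕ) (L0 L : Type) [Field L0] [Field L]
    [Algebra (MvPolynomial (Fin n) K) L0] [IsFractionRing (MvPolynomial (Fin n) K) L0]
    [Algebra L0 L] [Algebra (MvPolynomial (Fin n) K) L] [IsScalarTower (MvPolynomial (Fin n) K) L0 L]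
    [FiniteDimensional L0 L] : Module.Finite (MvPolynomial (Fin n) K) (integralClosure (MvPolynomial (Fin n) K) L) := by
  let A0 := MvPolynomial (Fin n) K
  change Module.Finite A0 (integralClosure A0 L)
  let p := ringExpChar K
  haveI : ExpChar K p := inferInstance
  haveI : ExpChar A0 p := inferInstance
  haveI : ExpChar L0 p := expChar_of_injective_algebraMap (IsFractionRing.injective A0 L0) p
  haveI : ExpChar L p := expChar_of_injective_algebraMap (algebraMap L0 L).injective p
  let S := separableClosure L0 L
  letI : Algebra A0 S := ((algebraMap L0 S).comp (algebraMap A0 L0)).toAlgebra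
  haveI : IsScalarTower A0 L0 S := IsScalarTower.of_algebraMap_eq' rfl
  haveI : IsScalarTower A0 S L := IsScalarTower.of_algebraMap_eq fun x => by
    rw [IsScalarTower.algebraMap_apply A0 L0 L]; rfl
  haveI : Module.Finite A0 (integralClosure A0 S) := IsIntegralClosure.finite A0 L0 S _
  haveI : ExpChar S p := expChar_of_injective_algebraMap (algebraMap L0 S).injective p
  haveI : FiniteDimensional S L := inferInstance
  haveI : IsPurelyInseparable.HasExponent S L := inferInstance
  let e := IsPurelyInseparable.exponent S L
  let F0 : L →+* S := IsPurelyInseparable.iterateFrobenius S L p (n := e) le_rfl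
  have hF0 : ∀ x, algebraMap S L (F0 x) = x ^ p ^ e := fun x =>
    IsPurelyInseparable.algebraMap_iterateFrobenius S p le_rfl x
  let F : integralClosure A0 L →+* integralClosure A0 S :=
    (F0.comp (algebraMap _ L)).codRestrict _ (by
      intro x
      have h1 : IsIntegral A0 (algebraMap S L (F0 x)) := by
        rw [hF0]; exact IsIntegral.pow x.2 _
      exact (isIntegral_algebraMap_iff (algebraMap S L).injective).1 h1)
  have hF : Function.Injective F := by
    intro x y hxy
    have : F0 x = F0 y := congrArg Subtype.val hxy
    exact Subtype.ext (F0.injective this)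
  have key : F.comp (algebraMap A0 (integralClosure A0 L)) =
      (algebraMap A0 (integralClosure A0 S)).comp (iterateFrobenius A0 p e) := by
    apply RingHom.ext
    intro x
    apply Subtype.ext
    apply (algebraMap S L).injective
    change algebraMap S L (F0 (algebraMap A0 L x)) = algebraMap S L (algebraMap A0 S (iterateFrobenius A0 p e x))
    rw [hF0, ← IsScalarTower.algebraMap_apply, iterateFrobenius_def, map_pow]
  have h1 : (F.comp (algebraMap A0 (integralClosure A0 L))).Finite := by
    rw [key]
    exact RingHom.Finite.comp (RingHom.finite_algebraMap.2 inferInstance) (frob_finite K n p e)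
  exact RingHom.finite_algebraMap.1 (finite_of_comp_inj _ F hF h1)

theorem finite_integralClosure_fg (K A L : Type) [Field K] [IsAlgClosed K] [CommRing A] [IsDomain A]
    [Algebra K A] [Algebra.FiniteType K A] [Field L] [Algebra A L] [IsFractionRing A L] :
    Module.Finite A (integralClosure A L) := by
  obtain ⟨n, g, hg, hgi⟩ := exists_integral_inj_algHom_of_fg K A
  let A0 := MvPolynomial (Fin n) K
  letI : Algebra A0 A := g.toRingHom.toAlgebra
  letI : Algebra A0 L := ((algebraMap A L).comp (algebraMap A0 A)).toAlgebra
  haveI : IsScalarTower A0 A L := IsScalarTower.of_algebraMap_eq' rfl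
  haveI : IsScalarTower K A0 A := IsScalarTower.of_algebraMap_eq fun x => (g.commutes x).symm
  haveI : Algebra.IsIntegral A0 A := ⟨hgi⟩
  haveI : Algebra.FiniteType A0 A := Algebra.FiniteType.of_restrictScalars_finiteType K A0 A
  haveI : Module.Finite A0 A := Algebra.IsIntegral.finite
  have hinj : Function.Injective (algebraMap A0 L) := (IsFractionRing.injective A L).comp hg
  haveI : FaithfulSMul A0 A := (faithfulSMul_iff_algebraMap_injective _ _).2 hg
  haveI : FaithfulSMul A0 L := (faithfulSMul_iff_algebraMap_injective _ _).2 hinj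
  let L0 := FractionRing A0
  letI : Algebra L0 L := FractionRing.liftAlgebra A0 L
  haveI : IsScalarTower A0 L0 L := FractionRing.isScalarTower_liftAlgebra A0 L
  haveI : FiniteDimensional L0 L := Module.Finite.of_isLocalization A0 A (nonZeroDivisors A0) 
  haveI := finite_integralClosure_poly K n L0 L
  let l : integralClosure A L →ₗ[A0] integralClosure A0 L :=
    { toFun := fun x => ⟨x.1, isIntegral_trans (R := A0) x.1 x.2⟩
      map_add' := fun _ _ => rfl
      map_smul' := fun _ _ => rfl }
  have hl : Function.Injective l := by
    intro x y h
    have := congrArg Subtype.val h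
    exact Subtype.ext this
  haveI : Module.Finite A0 (integralClosure A L) := Module.Finite.of_injective l hl
  exact Module.Finite.of_restrictScalars_finite A0 A _

end

section

open TopologicalSpace in
theorem topdim_le_of_cover {X : Type} [TopologicalSpace X] (d : WithBot ℕ∞)
    (h : ∀ x : X, ∃ (Z : Type) (_ : TopologicalSpace Z) (g : Z → X), Topology.IsOpenEmbedding g ∧
      x ∈ Set.range g ∧ topologicalKrullDim Z ≤ d) : topologicalKrullDim X ≤ d := by
  unfold topologicalKrullDim
  refine iSup_le fun l => ?_
  obtain ⟨x, hx⟩ := l.head.isIrreducible.nonempty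
  obtain ⟨Z, _, g, hg, ⟨z, rfl⟩, hd⟩ := h x
  refine le_trans ?_ hd
  let e := IrreducibleCloseds.orderIsoOfIsOpenEmbedding g hg
  have hne : ∀ i, (g ⁻¹' (l i : Set X)).Nonempty := fun i => ⟨z, l.head_le i hx⟩
  let l' : LTSeries (IrreducibleCloseds Z) :=
    { length := l.length
      toFun := fun i => e.symm ⟨l i, hne i⟩
      step := fun i => by
        refine e.symm.strictMono ?_
        exact l.step i }
  exact Order.LTSeries.length_le_krullDim l'

theorem topdim_zeroLocus (R : Type) [CommRing R] (I : Ideal R) :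
    topologicalKrullDim (PrimeSpectrum.zeroLocus (I : Set R)) = ringKrullDim (R ⧸ I) := by
  rw [← PrimeSpectrum.topologicalKrullDim_eq_ringKrullDim]
  have h1 := PrimeSpectrum.isClosedEmbedding_comap_of_surjective (R := R) _ (Ideal.Quotient.mk I) Ideal.Quotient.mk_surjective
  have h2 : Set.range (PrimeSpectrum.comap (Ideal.Quotient.mk I)) = PrimeSpectrum.zeroLocus (I : Set R) := by
    rw [range_comap_of_surjective _ _ Ideal.Quotient.mk_surjective, Ideal.mk_ker]
  rw [← h2]
  exact (IsHomeomorph.topologicalKrullDim_eq _ h1.isEmbedding.toHomeomorph.isHomeomorph).symm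

theorem topdim_component_spec (R : Type) [CommRing R] (d : WithBot ℕ∞)
    (h : ∀ Q ∈ minimalPrimes R, ringKrullDim (R ⧸ Q) = d) (T : Set (PrimeSpectrum R))
    (hT : T ∈ irreducibleComponents (PrimeSpectrum R)) : topologicalKrullDim T = d := by
  rw [← PrimeSpectrum.zeroLocus_minimalPrimes] at hT
  obtain ⟨Q, hQ, rfl⟩ := hT
  rw [← h Q hQ]
  exact topdim_zeroLocus R Q

theorem pure_of_cover {X : Type} [TopologicalSpace X] (d : WithBot ℕ∞)
    (h : ∀ x : X, ∃ (Z : Type) (_ : TopologicalSpace Z) (g : Z → X), Topology.IsOpenEmbedding g ∧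
      x ∈ Set.range g ∧ ∀ T ∈ irreducibleComponents Z, topologicalKrullDim T = d) :
    ∀ T ∈ irreducibleComponents X, topologicalKrullDim T = d := by
  intro T hT
  have key : ∀ x : T, ∃ (Z : Type) (_ : TopologicalSpace Z) (g : Z → T), Topology.IsOpenEmbedding g ∧
      x ∈ Set.range g ∧ topologicalKrullDim Z = d := by
    rintro ⟨x, hx⟩
    obtain ⟨Z, _, g, hg, hxg, hZ⟩ := h x
    obtain ⟨z, rfl⟩ := hxg
    refine ⟨g ⁻¹' T, inferInstance, T.restrictPreimage g, hg.restrictPreimage T, ⟨⟨z, hx⟩, rfl⟩, ?_⟩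
    exact hZ _ (preimage_mem_irreducibleComponents hT hg ⟨_, hx, z, rfl⟩)
  apply le_antisymm
  · apply topdim_le_of_cover
    intro x
    obtain ⟨Z, i, g, h1, h2, h3⟩ := key x
    exact ⟨Z, i, g, h1, h2, h3.le⟩
  · obtain ⟨x, hx⟩ := hT.1.nonempty
    obtain ⟨Z, i, g, h1, h2, h3⟩ := key ⟨x, hx⟩
    rw [← h3]
    exact h1.isInducing.topologicalKrullDim_le

open scoped TensorProduct in
theorem generic_fibre' (K A B : Type) [Field K] [CommRing A] [IsDomain A] [CommRing B]
    [Algebra K A] [Algebra K B] [Algebra A B] [IsScalarTower K A B] [Algebra.FiniteType K A]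
    [Algebra.FiniteType K B] (d d' : ℕ) (hA : ringKrullDim A = d)
    (hB : ∀ P ∈ minimalPrimes B, ringKrullDim (B ⧸ P) = d') :
    ∃ (a : A), a ≠ 0 ∧
      ∀ (p : Ideal A) [p.IsPrime], a ∉ p → ∀ Q ∈ minimalPrimes (p.Fiber B),
        ringKrullDim (p.Fiber B ⧸ Q) = ((d' - d : ℕ) : WithBot ℕ∞) := by
  classical
  haveI : IsNoetherianRing B := Algebra.FiniteType.isNoetherianRing K B
  have hfin : (minimalPrimes B).Finite := minimalPrimes.finite_of_isNoetherianRing B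
  have key : ∀ P ∈ minimalPrimes B, ∃ a : A, a ≠ 0 ∧ ∀ (p : Ideal A) [p.IsPrime], a ∉ p →
      ∀ Q ∈ minimalPrimes (p.Fiber B), P.map (Algebra.TensorProduct.includeRight : B →ₐ[A] p.Fiber B) ≤ Q →
        ringKrullDim (p.Fiber B ⧸ Q) = ((d' - d : ℕ) : WithBot ℕ∞) := by
    intro P hP
    haveI : P.IsPrime := hP.1.1
    by_cases hinj : Function.Injective (algebraMap A (B ⧸ P))
    · haveI : Algebra.FiniteType K (B ⧸ P) := Algebra.FiniteType.of_surjective (Ideal.Quotient.mkₐ K P) (Ideal.Quotient.mkₐ_surjective K P)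
      obtain ⟨r, a, ha, hdim, H⟩ := generic_fibre K A (B ⧸ P) hinj
      rw [hA, hB P hP] at hdim
      have hr : r = d' - d := by
        have : d' = d + r := by exact_mod_cast hdim
        omega
      refine ⟨a, ha, fun p hp hap Q hQ hPQ => ?_⟩
      haveI : Q.IsPrime := hQ.1.1
      let φ : p.Fiber B →ₐ[A] p.Fiber (B ⧸ P) := Algebra.TensorProduct.map (AlgHom.id A p.ResidueField) (Ideal.Quotient.mkₐ A P)
      have hφ : Function.Surjective φ := by
        exact LinearMap.lTensor_surjective p.ResidueField (Ideal.Quotient.mkₐ_surjective A P)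
      have hker : RingHom.ker φ ≤ Q := by
        have : RingHom.ker φ = _ := Algebra.TensorProduct.lTensor_ker (A := p.ResidueField) (Ideal.Quotient.mkₐ A P) (Ideal.Quotient.mkₐ_surjective A P)
        have h2 : RingHom.ker (Ideal.Quotient.mkₐ A P) = P := Ideal.Quotient.mkₐ_ker A P
        rw [this, h2]
        exact hPQ
      let Q' := Q.map φ
      have hQ' : Q'.comap φ = Q := by
        rw [Ideal.comap_map_of_surjective _ hφ, sup_eq_left]
        exact hker
      haveI : Q'.IsPrime := Ideal.map_isPrime_of_surjective hφ hker
      have hQ'min : Q' ∈ minimalPrimes (p.Fiber (B ⧸ P)) := by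
        refine ⟨⟨inferInstance, bot_le⟩, ?_⟩
        rintro R ⟨hR, -⟩ hRQ
        have h1 : R.comap φ ≤ Q := by rw [← hQ']; exact Ideal.comap_mono hRQ
        have h2 := hQ.2 ⟨Ideal.comap_isPrime φ R, bot_le⟩ h1
        have h3 := Ideal.map_mono (f := φ) h2
        rwa [Ideal.map_comap_of_surjective _ hφ] at h3
      rw [← hr, ← H p hap Q' hQ'min]
      refine ringKrullDim_eq_of_ringEquiv ?_
      let ψ : p.Fiber B →+* p.Fiber (B ⧸ P) ⧸ Q' := (Ideal.Quotient.mk Q').comp φ.toRingHom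
      have hψ : RingHom.ker ψ = Q := by
        rw [← RingHom.comap_ker, Ideal.mk_ker]; exact hQ'
      have hψs : Function.Surjective ψ := Ideal.Quotient.mk_surjective.comp hφ
      exact (Ideal.quotEquivOfEq hψ.symm).trans (RingHom.quotientKerEquivOfSurjective hψs)
    · rw [injective_iff_map_eq_zero] at hinj
      push Not at hinj
      obtain ⟨a, ha, ha0⟩ := hinj
      refine ⟨a, ha0, fun p hp hap Q hQ hPQ => ?_⟩
      exfalso
      haveI : Q.IsPrime := hQ.1.1
      apply hap
      rw [Ideal.over_def Q p]
      change algebraMap A (p.Fiber B) a ∈ Q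
      have h1 : algebraMap A B a ∈ P := Ideal.Quotient.eq_zero_iff_mem.1 ha
      have h2 := hPQ (Ideal.mem_map_of_mem _ h1)
      rwa [AlgHom.commutes] at h2
  choose! a ha H using key
  refine ⟨∏ P ∈ hfin.toFinset, a P, Finset.prod_ne_zero_iff.2 fun P hP => ha P (hfin.mem_toFinset.1 hP), ?_⟩
  intro p hp hap Q hQ
  haveI : Q.IsPrime := hQ.1.1
  obtain ⟨P, hP, hPle⟩ := Ideal.exists_minimalPrimes_le (I := ⊥) (J := Q.comap (Algebra.TensorProduct.includeRight : B →ₐ[A] p.Fiber B)) bot_le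
  refine H P hP p ?_ Q hQ (Ideal.map_le_iff_le_comap.2 hPle)
  intro h
  exact hap (p.mem_of_dvd (Finset.dvd_prod_of_mem a (hfin.mem_toFinset.2 hP)) h)

theorem exists_prime_of_dim (K A : Type) [Field K] [CommRing A] [Algebra K A] [Algebra.FiniteType K A] (q : Ideal A)
    [q.IsPrime] (e : ℕ) (hq : ringKrullDim (A ⧸ q) ≤ e) (k : ℕ) : ∀ (p : Ideal A) [p.IsPrime], p ≤ q →
    ringKrullDim (A ⧸ p) = ((e + k : ℕ) : WithBot ℕ∞) →
    ∃ r : Ideal A, r.IsPrime ∧ p ≤ r ∧ r ≤ q ∧ ringKrullDim (A ⧸ r) = e := by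
  induction k with
  | zero => exact fun p hp hpq h => ⟨p, hp, le_rfl, hpq, h⟩
  | succ k ih =>
    intro p hp hpq h
    haveI : IsNoetherianRing A := Algebra.FiniteType.isNoetherianRing K A
    have hne : p ≠ q := by
      rintro rfl
      rw [h] at hq
      have : e + (k + 1) ≤ e := by exact_mod_cast hq
      omega
    obtain ⟨a, haq, hap⟩ := SetLike.exists_of_lt (lt_of_le_of_ne hpq hne)
    let q' := q.map (Ideal.Quotient.mk p)
    have hq' : q'.comap (Ideal.Quotient.mk p) = q := by
      rw [Ideal.comap_map_of_surjective _ Ideal.Quotient.mk_surjective, sup_eq_left]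
      change RingHom.ker _ ≤ q
      rw [Ideal.mk_ker]; exact hpq
    haveI : q'.IsPrime := Ideal.map_isPrime_of_surjective Ideal.Quotient.mk_surjective (by rw [Ideal.mk_ker]; exact hpq)
    have ha' : Ideal.Quotient.mk p a ≠ 0 := fun h => hap (Ideal.Quotient.eq_zero_iff_mem.1 h)
    have haq' : Ideal.span {Ideal.Quotient.mk p a} ≤ q' := by
      rw [Ideal.span_singleton_le_iff_mem]
      exact Ideal.mem_map_of_mem _ haq
    obtain ⟨r', hr', hle⟩ := Ideal.exists_minimalPrimes_le haq'
    haveI : r'.IsPrime := hr'.1.1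
    have h1 : r'.height ≤ 1 := Ideal.height_le_one_of_isPrincipal_of_mem_minimalPrimes _ _ hr'
    have h2 : r'.height ≠ 0 := by
      rw [Ne, Ideal.height_eq_zero_iff, IsDomain.minimalPrimes_eq_singleton_bot]
      intro h3
      have : Ideal.Quotient.mk p a ∈ r' := hr'.1.2 (Ideal.mem_span_singleton_self _)
      rw [h3] at this
      exact ha' this
    have h3 : r'.height = 1 := le_antisymm h1 (Order.one_le_iff_pos.2 (pos_iff_ne_zero.2 h2))
    haveI : Algebra.FiniteType K (A ⧸ p) := Algebra.FiniteType.of_surjective (Ideal.Quotient.mkₐ K p) (Ideal.Quotient.mkₐ_surjective K p)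
    have h4 := dim_quot_height_one K (A ⧸ p) r' h3
    let r := r'.comap (Ideal.Quotient.mk p)
    have h5 : ringKrullDim (A ⧸ r) = ringKrullDim ((A ⧸ p) ⧸ r') := by
      refine ringKrullDim_eq_of_ringEquiv ?_
      let ψ : A →+* (A ⧸ p) ⧸ r' := (Ideal.Quotient.mk r').comp (Ideal.Quotient.mk p)
      have hψ : RingHom.ker ψ = r := by
        rw [← RingHom.comap_ker, Ideal.mk_ker]
      exact (Ideal.quotEquivOfEq hψ.symm).trans (RingHom.quotientKerEquivOfSurjective (f := ψ)
        (Ideal.Quotient.mk_surjective.comp Ideal.Quotient.mk_surjective))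
    have hpr : p ≤ r := by
      intro x hx
      have : Ideal.Quotient.mk p x = 0 := Ideal.Quotient.eq_zero_iff_mem.2 hx
      change Ideal.Quotient.mk p x ∈ r'
      rw [this]; exact r'.zero_mem
    have hrq : r ≤ q := by rw [← hq']; exact Ideal.comap_mono hle
    have h6 : ringKrullDim (A ⧸ r) = ((e + k : ℕ) : WithBot ℕ∞) := by
      rw [h5]
      rw [h] at h4
      haveI : Algebra.FiniteType K ((A ⧸ p) ⧸ r') := Algebra.FiniteType.of_surjective (Ideal.Quotient.mkₐ K r') (Ideal.Quotient.mkₐ_surjective K r')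
      obtain ⟨n, hn, -⟩ := dim_trdeg K ((A ⧸ p) ⧸ r')
      rw [hn] at h4 ⊢
      have : n + 1 = e + (k + 1) := by exact_mod_cast h4
      have : n = e + k := by omega
      rw [this]
    obtain ⟨s, hs, hrs, hsq, hd⟩ := ih r hrq h6
    exact ⟨s, hs, hpr.trans hrs, hsq, hd⟩

end

section

/-- The ring map `K → Γ(X, U)` induced by a structure morphism. -/
def kmap {X : Scheme} (s : X ⟶ SpecOf K) (U : X.Opens) : K →+* Γ(X, U) :=
  ((Scheme.ΓSpecIso (CommRingCat.of K)).inv ≫ s.appLE ⊤ U (show U ≤ s ⁻¹ᵁ ⊤ from le_top)).hom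

theorem kmap_finiteType {X : Scheme} (s : X ⟶ SpecOf K) [LocallyOfFiniteType s] (U : X.Opens)
    (hU : IsAffineOpen U) : (kmap s U).FiniteType := by
  have h1 := s.finiteType_appLE (isAffineOpen_top _) hU le_top
  have h2 : (Scheme.ΓSpecIso (CommRingCat.of K)).inv.hom.FiniteType :=
    RingHom.FiniteType.of_surjective _ (Scheme.ΓSpecIso (CommRingCat.of K)).symm.commRingCatIsoToRingEquiv.surjective
  exact h1.comp h2

theorem kmap_res {X : Scheme} (s : X ⟶ SpecOf K) {U V : X.Opens} (h : U ≤ V) :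
    (X.presheaf.map (homOfLE h).op).hom.comp (kmap s V) = kmap s U := by
  unfold kmap
  rw [← CommRingCat.hom_comp, Category.assoc, Scheme.Hom.appLE_map]

theorem kmap_appLE {X Y : Scheme} (f : X ⟶ Y) (s : Y ⟶ SpecOf K) {U : X.Opens} {V : Y.Opens} (h : U ≤ f ⁻¹ᵁ V) :
    (f.appLE V U h).hom.comp (kmap s V) = kmap (f ≫ s) U := by
  unfold kmap
  rw [← CommRingCat.hom_comp, Category.assoc, Scheme.Hom.appLE_comp_appLE]

/-- The ring map from `K` to the residue field at a point. -/
def kres {X : Scheme} (s : X ⟶ SpecOf K) (x : X) : K →+* X.residueField x :=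
  (X.evaluation ⊤ x (Opens.mem_top x)).hom.comp (kmap s ⊤)

theorem evaluation_res {X : Scheme} {U V : X.Opens} (h : U ≤ V) (x : X) (hx : x ∈ U) :
    X.presheaf.map (homOfLE h).op ≫ X.evaluation U x hx = X.evaluation V x (h hx) := by
  rw [← Scheme.germ_residue, ← Scheme.germ_residue, TopCat.Presheaf.germ_res_assoc]

theorem evaluation_kmap {X : Scheme} (s : X ⟶ SpecOf K) (U : X.Opens) (x : X) (hx : x ∈ U) :
    (X.evaluation U x hx).hom.comp (kmap s U) = kres s x := by
  rw [← kmap_res s (le_top : U ≤ ⊤), ← RingHom.comp_assoc, ← CommRingCat.hom_comp, evaluation_res]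
  rfl

/-- Dimension of a point, as transcendence degree of the residue field. -/
def dimPt {X : Scheme} (s : X ⟶ SpecOf K) (x : X) : ℕ :=
  letI := (kres s x).toAlgebra
  Cardinal.toNat (Algebra.trdeg K (X.residueField x))

/-- The prime ideal of a point. -/
def ptIdeal {X : Scheme} (U : X.Opens) (x : X) (hx : x ∈ U) : Ideal Γ(X, U) :=
  RingHom.ker (X.evaluation U x hx).hom

instance {X : Scheme} (U : X.Opens) (x : X) (hx : x ∈ U) : (ptIdeal U x hx).IsPrime :=
  RingHom.ker_isPrime _

theorem mem_ptIdeal {X : Scheme} (U : X.Opens) (x : X) (hx : x ∈ U) (f : Γ(X, U)) :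
    f ∈ ptIdeal U x hx ↔ x ∉ X.basicOpen f :=
  X.evaluation_eq_zero_iff_notMem_basicOpen x hx f

theorem exists_frac {X : Scheme} {U : X.Opens} (hU : IsAffineOpen U) (x : X) (hx : x ∈ U)
    (y : X.residueField x) : ∃ a b : Γ(X, U), X.evaluation U x hx b ≠ 0 ∧
      y * X.evaluation U x hx b = X.evaluation U x hx a := by
  obtain ⟨t, rfl⟩ := X.residue_surjective x y
  letI := (X.presheaf.germ U x hx).hom.toAlgebra
  haveI : IsLocalization.AtPrime (X.presheaf.stalk x) (hU.primeIdealOf ⟨x, hx⟩).asIdeal := hU.isLocalization_stalk ⟨x, hx⟩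
  obtain ⟨⟨a, b⟩, hab⟩ := IsLocalization.surj (hU.primeIdealOf ⟨x, hx⟩).asIdeal.primeCompl t
  have hu := IsLocalization.map_units (X.presheaf.stalk x) b
  refine ⟨a, b, ?_, ?_⟩
  · have := hu.map (X.residue x).hom
    exact this.ne_zero
  · have := congrArg (X.residue x) hab
    rw [map_mul] at this
    exact this

set_option maxHeartbeats 400000 in
theorem dim_ptIdeal' {X : Scheme} (s : X ⟶ SpecOf K) [LocallyOfFiniteType s] {U : X.Opens}
    (hU : IsAffineOpen U) (x : X) (hx : x ∈ U) :
    ∃ n : ℕ, ringKrullDim (Γ(X, U) ⧸ ptIdeal U x hx) = n ∧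
      (letI := (kres s x).toAlgebra; Algebra.trdeg K (X.residueField x) = n) := by
  letI : Algebra K Γ(X, U) := (kmap s U).toAlgebra
  haveI : Algebra.FiniteType K Γ(X, U) := kmap_finiteType s U hU
  letI : Algebra K (X.residueField x) := (kres s x).toAlgebra
  let A := Γ(X, U) ⧸ ptIdeal U x hx
  haveI : Algebra.FiniteType K A := Algebra.FiniteType.of_surjective (Ideal.Quotient.mkₐ K _) (Ideal.Quotient.mkₐ_surjective K _)
  letI : Algebra A (X.residueField x) := (RingHom.kerLift (X.evaluation U x hx).hom).toAlgebra
  have hinj : Function.Injective (algebraMap A (X.residueField x)) := RingHom.kerLift_injective _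
  haveI : FaithfulSMul A (X.residueField x) := (faithfulSMul_iff_algebraMap_injective _ _).2 hinj
  haveI : IsScalarTower K A (X.residueField x) := IsScalarTower.of_algebraMap_eq' (evaluation_kmap s U x hx).symm
  haveI : Algebra.IsAlgebraic A (X.residueField x) := by
    constructor
    intro y
    obtain ⟨a, b, hb, hab⟩ := exists_frac hU x hx y
    have hb' : IsAlgebraic A (algebraMap A (X.residueField x) (Ideal.Quotient.mk _ b)) := isAlgebraic_algebraMap _
    have ha' : IsAlgebraic A (algebraMap A (X.residueField x) (Ideal.Quotient.mk _ a)) := isAlgebraic_algebraMap _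
    refine IsAlgebraic.of_mul (mem_nonZeroDivisors_of_ne_zero hb) hb' ?_
    rw [mul_comm]
    change IsAlgebraic A (y * X.evaluation U x hx b)
    rw [hab]
    exact ha'
  obtain ⟨n, h1, h2⟩ := dim_trdeg K A
  refine ⟨n, h1, ?_⟩
  have h3 := trdeg_add_eq K A (A := X.residueField x)
  rw [_root_.trdeg_eq_zero (R := A) (A := X.residueField x), h2, add_zero] at h3
  exact h3.symm

theorem dim_ptIdeal {X : Scheme} (s : X ⟶ SpecOf K) [LocallyOfFiniteType s] {U : X.Opens}
    (hU : IsAffineOpen U) (x : X) (hx : x ∈ U) :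
    ringKrullDim (Γ(X, U) ⧸ ptIdeal U x hx) = dimPt s x := by
  obtain ⟨n, h1, h2⟩ := dim_ptIdeal' s hU x hx
  rw [h1, dimPt, h2]
  simp

theorem trdeg_eq_dimPt {X : Scheme} (s : X ⟶ SpecOf K) [LocallyOfFiniteType s] (x : X) :
    (letI := (kres s x).toAlgebra; Algebra.trdeg K (X.residueField x) = dimPt s x) := by
  obtain ⟨U, hU, hx, -⟩ := exists_isAffineOpen_mem_and_subset (x := x) (U := ⊤) trivial
  obtain ⟨n, h1, h2⟩ := dim_ptIdeal' s hU x hx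
  have h3 := dim_ptIdeal s hU x hx
  rw [h1] at h3
  have : n = dimPt s x := by exact_mod_cast h3
  rw [← this]
  exact h2

theorem kres_comp {X Y : Scheme} (f : X ⟶ Y) (s : Y ⟶ SpecOf K) (x : X) :
    (f.residueFieldMap x).hom.comp (kres s (f x)) = kres (f ≫ s) x := by
  unfold kres
  rw [← RingHom.comp_assoc, ← CommRingCat.hom_comp, Scheme.evaluation_naturality, CommRingCat.hom_comp, RingHom.comp_assoc]
  congr 1
  have := kmap_appLE f s (U := ⊤) (V := ⊤) le_top
  rw [← this]
  congr 2
  rw [Scheme.Hom.app_eq_appLE]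
  rfl

theorem dimPt_le {X Y : Scheme} (f : X ⟶ Y) (s : Y ⟶ SpecOf K) [LocallyOfFiniteType s]
    [LocallyOfFiniteType (f ≫ s)] (x : X) : dimPt s (f x) ≤ dimPt (f ≫ s) x := by
  have h1 := trdeg_eq_dimPt s (f x)
  have h2 := trdeg_eq_dimPt (f ≫ s) x
  letI := (kres s (f x)).toAlgebra
  letI := (kres (f ≫ s) x).toAlgebra
  let g : Y.residueField (f x) →ₐ[K] X.residueField x :=
    { (f.residueFieldMap x).hom with
      commutes' := fun k => congrArg (fun h => h k) (kres_comp f s x) }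
  have h3 := _root_.trdeg_le_of_injective g (f.residueFieldMap x).hom.injective
  dsimp only at h1 h2
  rw [h1, h2] at h3
  exact_mod_cast h3

theorem dimPt_eq {X Y : Scheme} (f : X ⟶ Y) [SurjectiveOnStalks f] (s : Y ⟶ SpecOf K) [LocallyOfFiniteType s]
    [LocallyOfFiniteType (f ≫ s)] (x : X) : dimPt s (f x) = dimPt (f ≫ s) x := by
  apply le_antisymm (dimPt_le f s x)
  have h1 := trdeg_eq_dimPt s (f x)
  have h2 := trdeg_eq_dimPt (f ≫ s) x
  letI := (kres s (f x)).toAlgebra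
  letI := (kres (f ≫ s) x).toAlgebra
  let g : Y.residueField (f x) →ₐ[K] X.residueField x :=
    { (f.residueFieldMap x).hom with
      commutes' := fun k => congrArg (fun h => h k) (kres_comp f s x) }
  have hsurj : Function.Surjective g := by
    intro y
    obtain ⟨t, rfl⟩ := X.residue_surjective x y
    obtain ⟨u, rfl⟩ := f.stalkMap_surjective x t
    refine ⟨Y.residue (f x) u, ?_⟩
    exact congrArg (fun h => h.hom u) (Scheme.residue_residueFieldMap f x)
  let e := AlgEquiv.ofBijective g ⟨(f.residueFieldMap x).hom.injective, hsurj⟩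
  have h3 := _root_.trdeg_le_of_injective e.symm.toAlgHom e.symm.injective
  dsimp only at h1 h2
  rw [h1, h2] at h3
  exact_mod_cast h3

end

section

theorem ptIdeal_fromSpec {X : Scheme} {U : X.Opens} (hU : IsAffineOpen U) (p : PrimeSpectrum Γ(X, U))
    (h : hU.fromSpec p ∈ U) : ptIdeal U (hU.fromSpec p) h = p.asIdeal := by
  ext f
  rw [mem_ptIdeal]
  have h1 := hU.fromSpec_preimage_basicOpen f
  have h2 : hU.fromSpec p ∈ X.basicOpen f ↔ p ∈ PrimeSpectrum.basicOpen f := by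
    rw [← h1]; rfl
  rw [h2, PrimeSpectrum.mem_basicOpen, not_not]

theorem fromSpec_mem {X : Scheme} {U : X.Opens} (hU : IsAffineOpen U) (p : PrimeSpectrum Γ(X, U)) :
    hU.fromSpec p ∈ U := by
  have : hU.fromSpec p ∈ Set.range hU.fromSpec := ⟨p, rfl⟩
  rw [hU.range_fromSpec] at this
  exact this

theorem fromSpec_ptIdeal {X : Scheme} {U : X.Opens} (hU : IsAffineOpen U) (x : X) (hx : x ∈ U) :
    hU.fromSpec (⟨ptIdeal U x hx, inferInstance⟩ : PrimeSpectrum Γ(X, U)) = x := by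
  have : x ∈ Set.range hU.fromSpec := by rw [hU.range_fromSpec]; exact hx
  obtain ⟨p, rfl⟩ := this
  congr 1
  apply PrimeSpectrum.ext
  exact ptIdeal_fromSpec hU p hx

theorem specializes_fromSpec {X : Scheme} {U : X.Opens} (hU : IsAffineOpen U) (p q : PrimeSpectrum Γ(X, U)) :
    hU.fromSpec p ⤳ hU.fromSpec q ↔ p.asIdeal ≤ q.asIdeal := by
  refine Iff.trans (hU.fromSpec.isOpenEmbedding.isInducing.specializes_iff (x := p) (y := q)) ?_
  exact (PrimeSpectrum.le_iff_specializes p q).symm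

theorem ptIdeal_le {X : Scheme} {U : X.Opens} (hU : IsAffineOpen U) {x y : X} (hx : x ∈ U) (hy : y ∈ U) :
    x ⤳ y ↔ ptIdeal U x hx ≤ ptIdeal U y hy := by
  conv_lhs => rw [← fromSpec_ptIdeal hU x hx, ← fromSpec_ptIdeal hU y hy]
  exact specializes_fromSpec hU _ _

theorem dim_quot_lt {R : Type} [CommRing R] {p q : Ideal R} [p.IsPrime] [q.IsPrime] (h : p < q) :
    ringKrullDim (R ⧸ q) + 1 ≤ ringKrullDim (R ⧸ p) := by
  obtain ⟨r, hrq, hrp⟩ := SetLike.exists_of_lt h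
  have hr : Ideal.Quotient.mk p r ∈ nonZeroDivisors (R ⧸ p) := by
    apply mem_nonZeroDivisors_of_ne_zero
    rwa [Ne, Ideal.Quotient.eq_zero_iff_mem]
  have h1 := ringKrullDim_quotient_succ_le_of_nonZeroDivisor hr
  refine le_trans ?_ h1
  gcongr
  let f : (R ⧸ p) ⧸ Ideal.span {Ideal.Quotient.mk p r} →+* R ⧸ q :=
    Ideal.Quotient.lift _ (Ideal.Quotient.factor h.le) (by
      intro a ha
      obtain ⟨b, rfl⟩ := Ideal.mem_span_singleton'.1 ha
      rw [map_mul, Ideal.Quotient.factor_mk, Ideal.Quotient.eq_zero_iff_mem.2 hrq, mul_zero])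
  apply ringKrullDim_le_of_surjective f
  intro y
  obtain ⟨y, rfl⟩ := Ideal.Quotient.mk_surjective y
  exact ⟨Ideal.Quotient.mk _ (Ideal.Quotient.mk _ y), by simp [f]⟩

theorem dimPt_lt {X : Scheme} (s : X ⟶ SpecOf K) [LocallyOfFiniteType s] {η x : X} (h : η ⤳ x)
    (hne : η ≠ x) : dimPt s x < dimPt s η := by
  obtain ⟨U, hU, hx, -⟩ := exists_isAffineOpen_mem_and_subset (x := x) (U := ⊤) trivial
  have hη : η ∈ U := h.mem_open U.2 hx
  have h1 := (ptIdeal_le hU hη hx).1 h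
  have h2 : ptIdeal U η hη < ptIdeal U x hx := by
    refine lt_of_le_of_ne h1 fun h3 => hne ?_
    rw [← fromSpec_ptIdeal hU x hx, ← fromSpec_ptIdeal hU η hη]
    congr 1
    exact PrimeSpectrum.ext h3
  have h3 := dim_quot_lt h2
  rw [dim_ptIdeal s hU, dim_ptIdeal s hU] at h3
  exact_mod_cast h3

theorem dimPt_mono {X : Scheme} (s : X ⟶ SpecOf K) [LocallyOfFiniteType s] {η x : X} (h : η ⤳ x) :
    dimPt s x ≤ dimPt s η := by
  by_cases hne : η = x
  · rw [hne]
  · exact (dimPt_lt s h hne).le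

theorem exists_dimPt {X : Scheme} (s : X ⟶ SpecOf K) [LocallyOfFiniteType s] {η x : X} (h : η ⤳ x)
    (e : ℕ) (h1 : dimPt s x ≤ e) (h2 : e ≤ dimPt s η) : ∃ z, η ⤳ z ∧ z ⤳ x ∧ dimPt s z = e := by
  obtain ⟨U, hU, hx, -⟩ := exists_isAffineOpen_mem_and_subset (x := x) (U := ⊤) trivial
  have hη : η ∈ U := h.mem_open U.2 hx
  have hle := (ptIdeal_le hU hη hx).1 h
  letI : Algebra K Γ(X, U) := (kmap s U).toAlgebra
  haveI : Algebra.FiniteType K Γ(X, U) := kmap_finiteType s U hU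
  obtain ⟨k, hk⟩ := Nat.exists_eq_add_of_le h2
  obtain ⟨r, hr, hr1, hr2, hr3⟩ := exists_prime_of_dim K Γ(X, U) (ptIdeal U x hx) e
    (by rw [dim_ptIdeal s hU]; exact_mod_cast h1) k (ptIdeal U η hη) hle
    (by rw [dim_ptIdeal s hU, hk])
  have hz := fromSpec_mem hU ⟨r, hr⟩
  have hz1 := ptIdeal_fromSpec hU ⟨r, hr⟩ hz
  refine ⟨hU.fromSpec (⟨r, hr⟩ : PrimeSpectrum _), ?_, ?_, ?_⟩
  · rw [ptIdeal_le hU hη hz, hz1]; exact hr1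
  · rw [ptIdeal_le hU hz hx, hz1]; exact hr2
  · have := dim_ptIdeal s hU _ hz
    rw [hz1] at this
    dsimp only at this
    rw [hr3] at this
    exact_mod_cast this.symm

theorem topdim_le_of_dimPt {X : Scheme} (s : X ⟶ SpecOf K) [LocallyOfFiniteType s] (Z : Set X)
    (hZ : IsClosed Z) (n : ℕ) (h : ∀ x ∈ Z, dimPt s x ≤ n) : topologicalKrullDim Z ≤ n := by
  haveI : QuasiSober Z := hZ.isClosedEmbedding_subtypeVal.quasiSober
  have hc : ∀ T : IrreducibleCloseds Z, ∃ z : Z, closure {z} = (T : Set Z) := fun T =>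
    QuasiSober.sober T.isIrreducible T.isClosed
  choose g hg using hc
  let m : IrreducibleCloseds Z → Fin (n + 1) := fun T => ⟨dimPt s (g T).1, Nat.lt_succ_of_le (h _ (g T).2)⟩
  have hm : StrictMono m := by
    intro T₁ T₂ hT
    have h1 : g T₂ ⤳ g T₁ := by
      rw [specializes_iff_mem_closure, hg T₂]
      apply (show (T₁ : Set Z) ⊆ T₂ from hT.le)
      rw [← hg T₁]
      exact subset_closure rfl
    refine dimPt_lt s (h1.map continuous_subtype_val) fun h2 => ?_
    have h3 : g T₂ = g T₁ := Subtype.ext h2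
    apply hT.ne
    apply IrreducibleCloseds.ext
    rw [← hg, ← hg, h3]
  have := Order.krullDim_le_of_strictMono m hm
  refine this.trans ?_
  apply iSup_le
  intro l
  have := l.length_lt_card
  rw [Fintype.card_fin] at this
  exact_mod_cast Nat.le_of_lt_succ this

theorem topdim_closure {X : Scheme} (s : X ⟶ SpecOf K) [LocallyOfFiniteType s] (x : X) :
    topologicalKrullDim (closure {x} : Set X) = dimPt s x := by
  apply le_antisymm
  · apply topdim_le_of_dimPt s _ isClosed_closure
    intro y hy
    exact dimPt_mono s (specializes_iff_mem_closure.2 hy)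
  · obtain ⟨U, hU, hx, -⟩ := exists_isAffineOpen_mem_and_subset (x := x) (U := ⊤) trivial
    rw [← dim_ptIdeal s hU x hx, ← topdim_zeroLocus]
    let g : PrimeSpectrum.zeroLocus (ptIdeal U x hx : Set Γ(X, U)) → (closure {x} : Set X) :=
      fun p => ⟨hU.fromSpec p.1, by
        rw [← specializes_iff_mem_closure]
        conv_lhs => rw [← fromSpec_ptIdeal hU x hx]
        exact (specializes_fromSpec hU _ _).2 p.2⟩
    have hg : Topology.IsInducing g := by
      have h1 : Topology.IsInducing (fun p : PrimeSpectrum.zeroLocus (ptIdeal U x hx : Set Γ(X, U)) => hU.fromSpec p.1) :=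
        hU.fromSpec.isOpenEmbedding.isInducing.comp Topology.IsInducing.subtypeVal
      exact Topology.IsInducing.of_comp_iff Topology.IsInducing.subtypeVal |>.1 h1
    exact hg.topologicalKrullDim_le

theorem exists_dim {X : Scheme} (s : X ⟶ SpecOf K) [LocallyOfFiniteType s] [QuasiCompact s] [Nonempty X] :
    ∃ d : ℕ, topologicalKrullDim X = d ∧ ∀ x, dimPt s x ≤ d := by
  haveI : CompactSpace X :=
    QuasiCompact.compactSpace_of_compactSpace s
  have hb : ∃ n : ℕ, ∀ x, dimPt s x ≤ n := by
    have h1 : ∀ x : X, ∃ (U : X.Opens) (n : ℕ), x ∈ U ∧ ∀ y ∈ U, dimPt s y ≤ n := by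
      intro x
      obtain ⟨U, hU, hx, -⟩ := exists_isAffineOpen_mem_and_subset (x := x) (U := ⊤) trivial
      letI : Algebra K Γ(X, U) := (kmap s U).toAlgebra
      haveI : Algebra.FiniteType K Γ(X, U) := kmap_finiteType s U hU
      obtain ⟨n, f, hf⟩ := Algebra.FiniteType.iff_quotient_mvPolynomial''.1 this
      refine ⟨U, n, hx, fun y hy => ?_⟩
      have h2 := ringKrullDim_le_of_surjective ((Ideal.Quotient.mk (ptIdeal U y hy)).comp f.toRingHom)
        (Ideal.Quotient.mk_surjective.comp hf)
      rw [MvPolynomial.ringKrullDim_of_isNoetherianRing, ringKrullDim_eq_zero_of_field, dim_ptIdeal s hU] at h2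
      simpa using h2
    choose U n hU hn using h1
    obtain ⟨t, ht⟩ := isCompact_univ.elim_finite_subcover (fun x => (U x : Set X)) (fun x => (U x).2)
      (fun x _ => Set.mem_iUnion.2 ⟨x, hU x⟩)
    refine ⟨t.sup n, fun x => ?_⟩
    obtain ⟨y, hy, hxy⟩ := Set.mem_iUnion₂.1 (ht (Set.mem_univ x))
    exact (hn y x hxy).trans (Finset.le_sup hy)
  have hne : (Set.range (dimPt s)).Nonempty := Set.range_nonempty _
  have hbd : BddAbove (Set.range (dimPt s)) := by
    obtain ⟨n, hn⟩ := hb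
    exact ⟨n, by rintro _ ⟨x, rfl⟩; exact hn x⟩
  obtain ⟨x, hx⟩ := Nat.sSup_mem hne hbd
  have hle : ∀ y, dimPt s y ≤ dimPt s x := fun y => by
    rw [hx]; exact le_csSup hbd ⟨y, rfl⟩
  refine ⟨dimPt s x, le_antisymm ?_ ?_, hle⟩
  · have := topdim_le_of_dimPt s Set.univ isClosed_univ (dimPt s x) (fun y _ => hle y)
    rwa [IsHomeomorph.topologicalKrullDim_eq _ (Homeomorph.Set.univ X).isHomeomorph] at this
  · rw [← topdim_closure s]
    exact topologicalKrullDim_subspace_le _ _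

theorem dimPt_of_component {X : Scheme} (s : X ⟶ SpecOf K) [LocallyOfFiniteType s] (T : Set X)
    (hT : T ∈ irreducibleComponents X) : ∃ x, closure {x} = T ∧ topologicalKrullDim T = dimPt s x := by
  obtain ⟨x, hx⟩ := QuasiSober.sober hT.1 (isClosed_of_mem_irreducibleComponents T hT)
  exact ⟨x, hx, by rw [← hx, topdim_closure s]⟩

end

section

theorem exists_lift_closed {X Y W : Scheme} (j : W ⟶ Y) [IsClosedImmersion j] (f : X ⟶ Y) [IsReduced X]
    (h : Set.range f ⊆ Set.range j) : ∃ g : X ⟶ W, g ≫ j = f := by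
  haveI : Surjective (pullback.fst f j) := by
    constructor
    intro x
    have : x ∈ Set.range (pullback.fst f j) := by
      rw [Scheme.Pullback.range_fst]
      exact h ⟨x, rfl⟩
    exact this
  haveI := isIso_of_isClosedImmersion_of_surjective (pullback.fst f j)
  refine ⟨inv (pullback.fst f j) ≫ pullback.snd f j, ?_⟩
  rw [Category.assoc, ← pullback.condition, IsIso.inv_hom_id_assoc]

theorem exists_redSub {Y : Scheme} (Z : Set Y) (hZ : IsClosed Z) :
    ∃ (W : Scheme) (j : W ⟶ Y), IsReduced W ∧ IsClosedImmersion j ∧ Set.range j = Z := by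
  let I := Scheme.IdealSheafData.vanishingIdeal (⟨Z, hZ⟩ : Closeds Y)
  refine ⟨I.subscheme, I.subschemeι, ?_, inferInstance, ?_⟩
  · haveI : ∀ i, IsReduced (I.subschemeCover.openCover.X i) := by
      intro (U : Y.affineOpens)
      haveI : _root_.IsReduced (Γ(Y, U) ⧸ I.ideal U) := by
        rw [← Ideal.isRadical_iff_quotient_reduced]
        exact PrimeSpectrum.isRadical_vanishingIdeal _
      change IsReduced (Spec (CommRingCat.of (Γ(Y, U) ⧸ I.ideal U)))
      infer_instance
    exact IsReduced.of_openCover _ I.subschemeCover.openCover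
  · rw [Scheme.IdealSheafData.range_subschemeι]
    rfl

theorem noetherianSpace_of_ft {X : Scheme} (s : X ⟶ SpecOf K) [LocallyOfFiniteType s] [QuasiCompact s] :
    NoetherianSpace X := by
  haveI : IsLocallyNoetherian X := LocallyOfFiniteType.isLocallyNoetherian s
  haveI : CompactSpace X := QuasiCompact.compactSpace_of_compactSpace s
  haveI : IsNoetherian X := {}
  infer_instance

/-- Purity of the reduced closed subscheme supported on a union of closures of points
of the same dimension. -/
theorem pure_of_points {Y W : Scheme} (j : W ⟶ Y) [IsClosedImmersion j] (s : Y ⟶ SpecOf K) [LocallyOfFiniteType s]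
    (S : Set Y) (d : ℕ) (hS : ∀ z ∈ S, dimPt s z = d)
    (hj : Set.range j = ⋃ z ∈ S, closure {z}) : IsPureOfDim W d := by
  intro T hT
  obtain ⟨x, hx, -⟩ := dimPt_of_component (j ≫ s) T hT
  have h1 : j x ∈ ⋃ z ∈ S, closure {z} := by rw [← hj]; exact ⟨x, rfl⟩
  obtain ⟨z, hz, hzx⟩ := Set.mem_iUnion₂.1 h1
  have h2 : z ∈ Set.range j := by
    rw [hj]
    exact Set.mem_iUnion₂.2 ⟨z, hz, subset_closure rfl⟩
  obtain ⟨x', rfl⟩ := h2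
  have h3 : x' ⤳ x := j.isClosedEmbedding.isInducing.specializes_iff.1 (specializes_iff_mem_closure.2 hzx)
  have h4 : T ⊆ closure {x'} := by
    rw [← hx]
    exact h3.closure_subset
  have h5 : closure {x'} = T := Set.Subset.antisymm (hT.2 isIrreducible_singleton.closure h4) h4
  rw [← h5, topdim_closure (j ≫ s), ← dimPt_eq j s x', hS _ hz]

theorem component_of_max {X : Scheme} (x : X) (h : ∀ η, η ⤳ x → η = x) :
    closure {x} ∈ irreducibleComponents X := by
  refine ⟨isIrreducible_singleton.closure, fun T hT hxT => ?_⟩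
  obtain ⟨η, hη⟩ := QuasiSober.sober hT.closure isClosed_closure
  have h1 : η ⤳ x := by
    rw [specializes_iff_mem_closure, hη]
    exact subset_closure (hxT (subset_closure rfl))
  rw [← h η h1, hη]
  exact subset_closure

theorem minimalPrimes_dim {X : Scheme} (s : X ⟶ SpecOf K) [LocallyOfFiniteType s] (d : ℕ)
    (hX : IsPureOfDim X d) {U : X.Opens} (hU : IsAffineOpen U) (Q : Ideal Γ(X, U)) (hQ : Q ∈ minimalPrimes Γ(X, U)) :
    ringKrullDim (Γ(X, U) ⧸ Q) = d := by
  haveI : Q.IsPrime := hQ.1.1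
  have hx := fromSpec_mem hU ⟨Q, inferInstance⟩
  have hxQ := ptIdeal_fromSpec hU ⟨Q, inferInstance⟩ hx
  set x : X := hU.fromSpec (⟨Q, inferInstance⟩ : PrimeSpectrum Γ(X, U)) with hxdef
  have h1 := component_of_max x (fun η hη => by
    have hηU : η ∈ U := hη.mem_open U.2 hx
    have h2 := (ptIdeal_le hU hηU hx).1 hη
    rw [hxQ] at h2
    have h3 : ptIdeal U η hηU = Q := le_antisymm h2 (hQ.2 ⟨inferInstance, bot_le⟩ h2)
    rw [← fromSpec_ptIdeal hU η hηU]
    rw [hxdef]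
    congr 1
    exact PrimeSpectrum.ext h3)
  have h2 := hX _ h1
  rw [topdim_closure s, ← dim_ptIdeal s hU x hx, hxQ] at h2
  exact h2

theorem dense_of_generic {W : Scheme} (U : W.Opens) (h : ∀ w : W, closure {w} ∈ irreducibleComponents W → w ∈ U) :
    Dense (U : Set W) := by
  intro y
  obtain ⟨T, hT, hyT⟩ := exists_mem_irreducibleComponents_subset_of_isIrreducible {y} isIrreducible_singleton
  obtain ⟨w, hw⟩ := QuasiSober.sober hT.1 (isClosed_of_mem_irreducibleComponents T hT)
  have hw' : closure {w} = T := hw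
  have h1 : w ∈ U := h w (by rw [hw']; exact hT)
  have h2 : y ∈ closure {w} := by rw [hw']; exact hyT rfl
  exact closure_mono (Set.singleton_subset_iff.2 h1) h2

theorem generic_nbhd {W : Scheme} (s : W ⟶ SpecOf K) [LocallyOfFiniteType s] [QuasiCompact s] [IsReduced W]
    (w : W) (hw : closure {w} ∈ irreducibleComponents W) :
    ∃ (U : W.Opens) (hU : IsAffineOpen U) (hwU : w ∈ U), ptIdeal U w hwU = ⊥ := by
  haveI := noetherianSpace_of_ft s
  have hfin : (irreducibleComponents W).Finite := NoetherianSpace.finite_irreducibleComponents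
  let C : Set W := ⋃ T ∈ irreducibleComponents W \ {closure {w}}, T
  have hC : IsClosed C := (hfin.subset Set.diff_subset).isClosed_biUnion
    fun T hT => isClosed_of_mem_irreducibleComponents T hT.1
  have hwC : w ∉ C := by
    intro h
    obtain ⟨T, hT, hwT⟩ := Set.mem_iUnion₂.1 h
    have h1 : closure {w} ⊆ T := closure_minimal (Set.singleton_subset_iff.2 hwT)
      (isClosed_of_mem_irreducibleComponents T hT.1)
    exact hT.2 (Set.Subset.antisymm (hw.2 hT.1.1 h1) h1)
  obtain ⟨U, hU, hwU, hUC⟩ := exists_isAffineOpen_mem_and_subset (x := w) (U := ⟨Cᶜ, hC.isOpen_compl⟩) hwC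
  refine ⟨U, hU, hwU, ?_⟩
  rw [eq_bot_iff]
  intro f hf
  rw [mem_ptIdeal] at hf
  rw [Ideal.mem_bot, ← basicOpen_eq_bot_iff]
  ext y
  constructor
  swap
  · intro h; exact h.elim
  intro hy
  exfalso
  have hyU : y ∈ U := W.basicOpen_le f hy
  have hyC : y ∉ C := hUC hyU
  obtain ⟨T, hT, hyT⟩ := exists_mem_irreducibleComponents_subset_of_isIrreducible {y} isIrreducible_singleton
  by_cases hTw : T = closure {w}
  · have h1 : w ⤳ y := specializes_iff_mem_closure.2 (hTw ▸ hyT rfl)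
    exact hf (h1.mem_open (W.basicOpen f).2 hy)
  · exact hyC (Set.mem_iUnion₂.2 ⟨T, ⟨hT, hTw⟩, hyT rfl⟩)

theorem fibre_chart {X W : Scheme.{0}} (f : X ⟶ W) {U : W.Opens} (hU : IsAffineOpen U) {V : X.Opens}
    (hV : IsAffineOpen V) (e : V ≤ f ⁻¹ᵁ U) (y : W) (hy : y ∈ U) (x : fiber f y) (hx : x.1 ∈ V) (d : WithBot ℕ∞)
    (h : letI : Algebra Γ(W, U) Γ(X, V) := (f.appLE U V e).hom.toAlgebra;
      ∀ Q ∈ minimalPrimes ((ptIdeal U y hy).Fiber Γ(X, V)), ringKrullDim ((ptIdeal U y hy).Fiber Γ(X, V) ⧸ Q) = d) :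
    ∃ (Z : Type) (_ : TopologicalSpace Z) (g : Z → fiber f y), Topology.IsOpenEmbedding g ∧
      x ∈ Set.range g ∧ ∀ T ∈ irreducibleComponents Z, topologicalKrullDim T = d := by
  letI : Algebra Γ(W, U) Γ(X, V) := (f.appLE U V e).hom.toAlgebra
  let p : PrimeSpectrum Γ(W, U) := ⟨ptIdeal U y hy, inferInstance⟩
  have hset : (PrimeSpectrum.comap (algebraMap Γ(W, U) Γ(X, V)) ⁻¹' {p} : Set (PrimeSpectrum Γ(X, V))) =
      hV.fromSpec ⁻¹' (fiber f y) := by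
    ext q
    have h1 : f (hV.fromSpec q) = hU.fromSpec (PrimeSpectrum.comap (algebraMap Γ(W, U) Γ(X, V)) q) := by
      have := congrArg (fun m => m q) (IsAffineOpen.SpecMap_appLE_fromSpec f hU hV e)
      exact this.symm
    constructor
    · intro h2
      change f (hV.fromSpec q) = y
      rw [h1, Set.mem_singleton_iff.1 h2]
      exact fromSpec_ptIdeal hU y hy
    · intro h2
      have h3 : f (hV.fromSpec q) = y := h2
      rw [h1, ← fromSpec_ptIdeal hU y hy] at h3
      exact hU.fromSpec.isOpenEmbedding.injective h3
  let e1 := (PrimeSpectrum.preimageHomeomorphFiber Γ(W, U) Γ(X, V) p).symm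
  let e2 : (PrimeSpectrum.comap (algebraMap Γ(W, U) Γ(X, V)) ⁻¹' {p} : Set (PrimeSpectrum Γ(X, V))) ≃ₜ
    (hV.fromSpec ⁻¹' (fiber f y) : Set _) := Homeomorph.setCongr hset
  let e3 := e1.trans e2
  let g : (hV.fromSpec ⁻¹' (fiber f y) : Set _) → fiber f y := (fiber f y).restrictPreimage hV.fromSpec
  have hg : Topology.IsOpenEmbedding g := hV.fromSpec.isOpenEmbedding.restrictPreimage _
  refine ⟨_, _, g ∘ e3, hg.comp e3.isOpenEmbedding, ?_, ?_⟩
  · rw [e3.surjective.range_comp]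
    have : x.1 ∈ Set.range hV.fromSpec := by rw [hV.range_fromSpec]; exact hx
    obtain ⟨q, hq⟩ := this
    exact ⟨⟨q, by rw [Set.mem_preimage, hq]; exact x.2⟩, Subtype.ext hq⟩
  · exact topdim_component_spec _ d h

theorem generic_purity {X W : Scheme} (f : X ⟶ W) [QuasiCompact f] (s : W ⟶ SpecOf K) [LocallyOfFiniteType s] [QuasiCompact s]
    [IsReduced W] [LocallyOfFiniteType (f ≫ s)] (d d' : ℕ) (hX : IsPureOfDim X d') (hW : IsPureOfDim W d) :
    ∃ U : W.Opens, Dense (U : Set W) ∧ ∀ y : W, y ∈ U → IsPure (fiber f y) := by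
  have key : ∀ w : W, closure {w} ∈ irreducibleComponents W →
      ∃ U : W.Opens, w ∈ U ∧ ∀ y : W, y ∈ U → IsPure (fiber f y) := by
    intro w hw
    obtain ⟨U, hU, hwU, hbot⟩ := generic_nbhd s w hw
    haveI : IsDomain Γ(W, U) := by
      have : (⊥ : Ideal Γ(W, U)).IsPrime := hbot ▸ inferInstance
      exact IsDomain.of_bot_isPrime _
    letI : Algebra K Γ(W, U) := (kmap s U).toAlgebra
    haveI : Algebra.FiniteType K Γ(W, U) := kmap_finiteType s U hU
    have hdim : ringKrullDim Γ(W, U) = d := by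
      have h1 := hW _ hw
      rw [topdim_closure s, ← dim_ptIdeal s hU w hwU, hbot] at h1
      rw [← h1]
      exact (ringKrullDim_eq_of_ringEquiv (RingEquiv.quotientBot _)).symm
    have hcov : ∀ x : (f ⁻¹ᵁ U), ∃ (V : X.Opens), IsAffineOpen V ∧ x.1 ∈ V ∧ V ≤ f ⁻¹ᵁ U := by
      intro x
      obtain ⟨V, hV, hx, hVU⟩ := exists_isAffineOpen_mem_and_subset (x := x.1) (U := f ⁻¹ᵁ U) x.2
      exact ⟨V, hV, hx, hVU⟩
    choose V hV hxV hVU using hcov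
    have hcomp : IsCompact ((f ⁻¹ᵁ U : X.Opens) : Set X) := QuasiCompact.isCompact_preimage _ U.2 hU.isCompact
    obtain ⟨t, ht⟩ := hcomp.elim_finite_subcover (fun x => (V x : Set X)) (fun x => (V x).2)
      (fun x hx => Set.mem_iUnion.2 ⟨⟨x, hx⟩, hxV _⟩)
    have ha : ∀ x, ∃ a : Γ(W, U), a ≠ 0 ∧ ∀ (p : Ideal Γ(W, U)) [p.IsPrime], a ∉ p →
        (letI : Algebra Γ(W, U) Γ(X, V x) := (f.appLE U (V x) (hVU x)).hom.toAlgebra;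
        ∀ Q ∈ minimalPrimes (p.Fiber Γ(X, V x)), ringKrullDim (p.Fiber Γ(X, V x) ⧸ Q) = ((d' - d : ℕ) : WithBot ℕ∞)) := by
      intro x
      letI : Algebra Γ(W, U) Γ(X, V x) := (f.appLE U (V x) (hVU x)).hom.toAlgebra
      letI : Algebra K Γ(X, V x) := (kmap (f ≫ s) (V x)).toAlgebra
      haveI : Algebra.FiniteType K Γ(X, V x) := kmap_finiteType (f ≫ s) (V x) (hV x)
      haveI : IsScalarTower K Γ(W, U) Γ(X, V x) := IsScalarTower.of_algebraMap_eq' (kmap_appLE f s (hVU x)).symm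
      exact generic_fibre' K Γ(W, U) Γ(X, V x) d d' hdim (minimalPrimes_dim (f ≫ s) d' hX (hV x))
    choose a ha0 ha using ha
    refine ⟨W.basicOpen (∏ x ∈ t, a x), ?_, ?_⟩
    · by_contra h
      rw [← mem_ptIdeal U w hwU, hbot, Ideal.mem_bot, Finset.prod_eq_zero_iff] at h
      obtain ⟨x, -, hx⟩ := h
      exact ha0 x hx
    · intro y hy
      have hyU : y ∈ U := W.basicOpen_le _ hy
      refine ⟨((d' - d : ℕ) : WithBot ℕ∞), pure_of_cover _ ?_⟩
      rintro ⟨x, hx⟩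
      have hxU : x ∈ f ⁻¹ᵁ U := by
        change f x ∈ U
        rw [show f x = y from hx]; exact hyU
      obtain ⟨v, hvt, hv⟩ := Set.mem_iUnion₂.1 (ht hxU)
      refine fibre_chart f hU (hV v) (hVU v) y hyU ⟨x, hx⟩ hv _ (ha v (ptIdeal U y hyU) ?_)
      intro h
      have h1 : (∏ x ∈ t, a x) ∈ ptIdeal U y hyU :=
        Ideal.mem_of_dvd _ (Finset.dvd_prod_of_mem a hvt) h
      exact (mem_ptIdeal U y hyU _).1 h1 hy
  choose! U hU1 hU2 using key
  refine ⟨⨆ (w : W) (hw : closure {w} ∈ irreducibleComponents W), U w, dense_of_generic _ ?_, ?_⟩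
  · intro w hw
    simp only [Opens.mem_iSup]
    exact ⟨w, hw, hU1 w hw⟩
  · intro y hy
    simp only [Opens.mem_iSup] at hy
    obtain ⟨w, hw, hy⟩ := hy
    exact hU2 w hw y hy

end

section

/-- Restriction of sections. -/
def rs {X : Scheme.{0}} {U V : X.Opens} (h : U ≤ V) : Γ(X, V) →+* Γ(X, U) :=
  (X.presheaf.map (homOfLE h).op).hom

theorem rs_rs {X : Scheme.{0}} {U V W : X.Opens} (h : U ≤ V) (h' : V ≤ W) (a : Γ(X, W)) :
    rs h (rs h' a) = rs (h.trans h') a := by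
  have := X.presheaf.map_comp (homOfLE h').op (homOfLE h).op
  exact (congrArg (fun m => m.hom a) this).symm

theorem rs_self {X : Scheme.{0}} {U : X.Opens} (h : U ≤ U) (a : Γ(X, U)) : rs h a = a := by
  have := X.presheaf.map_id (Opposite.op U)
  exact congrArg (fun m => m.hom a) this

theorem rs_inj_of_eq {X : Scheme.{0}} {U V : X.Opens} (h : U ≤ V) (h' : V ≤ U) : Function.Injective (rs h : Γ(X, V) →+* Γ(X, U)) := by
  intro a b hab
  have := congrArg (rs h') hab
  rwa [rs_rs, rs_rs, rs_self, rs_self] at this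

theorem basicOpen_rs {X : Scheme.{0}} {U V : X.Opens} (h : U ≤ V) (a : Γ(X, V)) :
    X.basicOpen (rs h a) = U ⊓ X.basicOpen a :=
  X.basicOpen_res a (homOfLE h).op

theorem rs_surj {X : Scheme.{0}} {U V : X.Opens} (hV : IsAffineOpen V) (h : U ≤ V) (f : Γ(X, V))
    (e : U = X.basicOpen f) (b : Γ(X, U)) : ∃ (n : ℕ) (a : Γ(X, V)), rs h a = rs h f ^ n * b := by
  letI : Algebra Γ(X, V) Γ(X, U) := (rs h).toAlgebra
  haveI : IsLocalization.Away f Γ(X, U) := hV.isLocalization_of_eq_basicOpen f (homOfLE h) e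
  obtain ⟨n, a, hn⟩ := IsLocalization.Away.surj f b
  exact ⟨n, a, by rw [mul_comm]; exact hn.symm⟩

theorem rs_zero {X : Scheme.{0}} {U V : X.Opens} (hV : IsAffineOpen V) (h : U ≤ V) (f : Γ(X, V))
    (e : U = X.basicOpen f) (a : Γ(X, V)) (ha : rs h a = 0) : ∃ n : ℕ, f ^ n * a = 0 := by
  letI : Algebra Γ(X, V) Γ(X, U) := (rs h).toAlgebra
  haveI : IsLocalization.Away f Γ(X, U) := hV.isLocalization_of_eq_basicOpen f (homOfLE h) e
  obtain ⟨⟨_, n, rfl⟩, hn⟩ := (IsLocalization.map_eq_zero_iff (Submonoid.powers f) Γ(X, U) a).1 ha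
  exact ⟨n, hn⟩

/-- Ample data on a scheme: affine charts with transition functions of a line bundle. -/
structure AmpleData (X : Scheme.{0}) where
  I : Type
  fin : Finite I
  U : I → X.Opens
  aff : ∀ i, IsAffineOpen (U i)
  cov : ∀ x : X, ∃ i, x ∈ U i
  f : ∀ i, I → Γ(X, U i)
  self : ∀ i, f i i = 1
  coc : ∀ i k j, rs (inf_le_left : U i ⊓ U k ≤ U i) (f i j) =
    rs (inf_le_left : U i ⊓ U k ≤ U i) (f i k) * rs (inf_le_right : U i ⊓ U k ≤ U k) (f k j)
  bas : ∀ i k, X.basicOpen (f i k) = U i ⊓ U k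

theorem AmpleData.coc' {X : Scheme.{0}} (D : AmpleData X) (i k j) (V : X.Opens) (h1 : V ≤ D.U i) (h2 : V ≤ D.U k) :
    rs h1 (D.f i j) = rs h1 (D.f i k) * rs h2 (D.f k j) := by
  have := congrArg (rs (le_inf h1 h2)) (D.coc i k j)
  rwa [map_mul, rs_rs, rs_rs, rs_rs] at this

theorem AmpleData.extend {X : Scheme.{0}} (D : AmpleData X) (i : D.I) (b : Γ(X, D.U i)) :
    ∃ (m : ℕ), ∀ m' ≥ m, ∃ (g : ∀ k, Γ(X, D.U k)), g i = b ∧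
      ∀ k l, rs (inf_le_left : D.U k ⊓ D.U l ≤ D.U k) (g k) =
        rs (inf_le_left : D.U k ⊓ D.U l ≤ D.U k) (D.f k l) ^ m' *
          rs (inf_le_right : D.U k ⊓ D.U l ≤ D.U l) (g l) := by
  classical
  haveI := D.fin
  cases nonempty_fintype D.I
  have h1 : ∀ k, ∃ (n : ℕ) (a : Γ(X, D.U k)), rs (inf_le_left : D.U k ⊓ D.U i ≤ D.U k) a =
      rs (inf_le_left : D.U k ⊓ D.U i ≤ D.U k) (D.f k i) ^ n * rs (inf_le_right : D.U k ⊓ D.U i ≤ D.U i) b :=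
    fun k => rs_surj (D.aff k) inf_le_left (D.f k i) (D.bas k i).symm _
  choose n0 a0 ha0 using h1
  let n := Finset.univ.sup n0
  have hn : ∀ k, n0 k ≤ n := fun k => Finset.le_sup (Finset.mem_univ k)
  obtain ⟨a, ha⟩ : ∃ a : ∀ k, Γ(X, D.U k), ∀ k, rs (inf_le_left : D.U k ⊓ D.U i ≤ D.U k) (a k) =
      rs (inf_le_left : D.U k ⊓ D.U i ≤ D.U k) (D.f k i) ^ n * rs (inf_le_right : D.U k ⊓ D.U i ≤ D.U i) b := by
    refine ⟨fun k => D.f k i ^ (n - n0 k) * a0 k, fun k => ?_⟩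
    simp only [map_mul, map_pow]
    rw [ha0, ← mul_assoc, ← pow_add, Nat.sub_add_cancel (hn k)]
  have ha' : ∀ k (V : X.Opens) (h1 : V ≤ D.U k) (h2 : V ≤ D.U i), rs h1 (a k) = rs h1 (D.f k i) ^ n * rs h2 b := by
    intro k V h1 h2
    have := congrArg (rs (le_inf h1 h2)) (ha k)
    rwa [map_mul, map_pow, rs_rs, rs_rs, rs_rs] at this
  have h2 : ∀ kl : D.I × D.I, ∃ p : ℕ, rs (inf_le_left : D.U kl.1 ⊓ D.U kl.2 ≤ D.U kl.1) (D.f kl.1 i) ^ p *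
      (rs (inf_le_left : D.U kl.1 ⊓ D.U kl.2 ≤ D.U kl.1) (a kl.1) -
        rs (inf_le_left : D.U kl.1 ⊓ D.U kl.2 ≤ D.U kl.1) (D.f kl.1 kl.2) ^ n *
          rs (inf_le_right : D.U kl.1 ⊓ D.U kl.2 ≤ D.U kl.2) (a kl.2)) = 0 := by
    rintro ⟨k, l⟩
    have haff : IsAffineOpen (D.U k ⊓ D.U l) := by
      rw [← D.bas]; exact (D.aff k).basicOpen _
    refine rs_zero haff (inf_le_left : (D.U k ⊓ D.U l) ⊓ D.U i ≤ _) _ ?_ _ ?_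
    · rw [basicOpen_rs, D.bas]
      ext x; simp; tauto
    · simp only [map_sub, map_mul, map_pow, rs_rs]
      rw [ha' k _ _ inf_le_right, ha' l _ _ inf_le_right, D.coc' k l i _ (inf_le_left.trans inf_le_left) (inf_le_left.trans inf_le_right)]
      ring
  choose p0 hp0 using h2
  let p := Finset.univ.sup p0
  have hp : ∀ k, p0 k ≤ p := fun k => Finset.le_sup (Finset.mem_univ k)
  refine ⟨n + p, fun m' hm' => ?_⟩
  obtain ⟨q, rfl⟩ := Nat.exists_eq_add_of_le hm'
  refine ⟨fun k => D.f k i ^ (p + q) * a k, ?_, ?_⟩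
  · simp only [D.self, one_pow, one_mul]
    have := ha' i (D.U i) le_rfl le_rfl
    rwa [rs_self, rs_self, rs_self, D.self, one_pow, one_mul] at this
  · intro k l
    have h3 : rs (inf_le_left : D.U k ⊓ D.U l ≤ D.U k) (D.f k i) ^ (p + q) *
      (rs (inf_le_left : D.U k ⊓ D.U l ≤ D.U k) (a k) -
        rs (inf_le_left : D.U k ⊓ D.U l ≤ D.U k) (D.f k l) ^ n *
          rs (inf_le_right : D.U k ⊓ D.U l ≤ D.U l) (a l)) = 0 := by
      have h4 : p + q = (p + q - p0 (k, l)) + p0 (k, l) := by have := hp (k, l); omega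
      rw [h4, pow_add, mul_assoc]
      have := hp0 (k, l)
      dsimp only at this
      rw [this, mul_zero]
    rw [mul_sub, sub_eq_zero] at h3
    simp only [map_mul, map_pow]
    rw [h3, D.coc k l i]
    ring

end

section

/-- Pull back of sections. -/
def pbs {X Y : Scheme.{0}} (f : X ⟶ Y) {U : Y.Opens} {V : X.Opens} (h : V ≤ f ⁻¹ᵁ U) : Γ(Y, U) →+* Γ(X, V) :=
  (f.appLE U V h).hom

theorem pbs_rs {X Y : Scheme.{0}} (f : X ⟶ Y) {U U' : Y.Opens} {V : X.Opens} (h : V ≤ f ⁻¹ᵁ U) (h' : U ≤ U')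
   (a : Γ(Y, U')) : pbs f h (rs h' a) = pbs f (h.trans (fun _ hx => h' hx)) a := by
  exact congrArg (fun m => m.hom a) (Scheme.Hom.map_appLE f h (homOfLE h').op)

theorem rs_pbs {X Y : Scheme.{0}} (f : X ⟶ Y) {U : Y.Opens} {V V' : X.Opens} (h : V ≤ f ⁻¹ᵁ U) (h' : V' ≤ V)
   (a : Γ(Y, U)) : rs h' (pbs f h a) = pbs f (h'.trans h) a := by
  exact congrArg (fun m => m.hom a) (Scheme.Hom.appLE_map f h (homOfLE h').op)

theorem basicOpen_pbs {X Y : Scheme.{0}} (f : X ⟶ Y) {U : Y.Opens} {V : X.Opens} (h : V ≤ f ⁻¹ᵁ U) 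
   (a : Γ(Y, U)) : X.basicOpen (pbs f h a) = V ⊓ f ⁻¹ᵁ (Y.basicOpen a) := by
  exact Scheme.basicOpen_appLE f V U h a

theorem AmpleData.pbs_coc {X Y : Scheme.{0}} (f : X ⟶ Y) (D : AmpleData Y) (i k j) (V : X.Opens)
    (h1 : V ≤ f ⁻¹ᵁ (D.U i)) (h2 : V ≤ f ⁻¹ᵁ (D.U k)) :
    pbs f h1 (D.f i j) = pbs f h1 (D.f i k) * pbs f h2 (D.f k j) := by
  have h3 : V ≤ f ⁻¹ᵁ (D.U i ⊓ D.U k) := le_inf h1 h2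
  have := congrArg (pbs f h3) (D.coc i k j)
  rwa [map_mul, pbs_rs, pbs_rs, pbs_rs] at this

/-- Ample data pulled back along an affine morphism. -/
def AmpleData.pullback {X Y : Scheme.{0}} (f : X ⟶ Y) [IsAffineHom f] (D : AmpleData Y) : AmpleData X where
  I := D.I
  fin := D.fin
  U i := f ⁻¹ᵁ (D.U i)
  aff i := (D.aff i).preimage f
  cov x := D.cov (f x)
  f i j := pbs f le_rfl (D.f i j)
  self i := by rw [D.self, map_one]
  coc i k j := by
    simp only [rs_pbs]
    exact D.pbs_coc f i k j _ _ _
  bas i k := by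
    rw [basicOpen_pbs, D.bas]
    ext x; simp

/-- Ample data on a product. -/
def AmpleData.prod {X Y S : Scheme.{0}} [IsAffine S] (s : X ⟶ S) (t : Y ⟶ S) (D : AmpleData X) (E : AmpleData Y) :
    AmpleData (Limits.pullback s t) where
  I := D.I × E.I
  fin := by
    haveI := D.fin
    haveI := E.fin
    infer_instance
  U i := (pullback.fst s t) ⁻¹ᵁ (D.U i.1) ⊓ (pullback.snd s t) ⁻¹ᵁ (E.U i.2)
  aff i := by
    haveI : IsAffine (D.U i.1).toScheme := D.aff i.1
    haveI : IsAffine (E.U i.2).toScheme := E.aff i.2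
    let m := pullback.map ((D.U i.1).ι ≫ s) ((E.U i.2).ι ≫ t) s t (D.U i.1).ι (E.U i.2).ι (𝟙 S) (by simp) (by simp)
    have : IsAffineOpen m.opensRange := isAffineOpen_opensRange m
    convert this
    ext1
    have := Scheme.Pullback.range_map (f := (D.U i.1).ι ≫ s) (g := (E.U i.2).ι ≫ t) s t (D.U i.1).ι (E.U i.2).ι (𝟙 S) (by simp) (by simp)
    refine Eq.trans ?_ this.symm
    simp
  cov x := by
    obtain ⟨i, hi⟩ := D.cov (pullback.fst s t x)
    obtain ⟨k, hk⟩ := E.cov (pullback.snd s t x)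
    exact ⟨⟨i, k⟩, hi, hk⟩
  f i j := pbs (pullback.fst s t) inf_le_left (D.f i.1 j.1) * pbs (pullback.snd s t) inf_le_right (E.f i.2 j.2)
  self i := by simp [D.self, E.self]
  coc i k j := by
    simp only [map_mul, rs_pbs]
    have h1 := D.pbs_coc (pullback.fst s t) i.1 k.1 j.1 _ (inf_le_left.trans inf_le_left : pullback.fst s t ⁻¹ᵁ (D.U i.1) ⊓ (pullback.snd s t) ⁻¹ᵁ (E.U i.2) ⊓ ((pullback.fst s t) ⁻¹ᵁ (D.U k.1) ⊓ (pullback.snd s t) ⁻¹ᵁ (E.U k.2)) ≤ _) (inf_le_right.trans inf_le_left)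
    have h2 := E.pbs_coc (pullback.snd s t) i.2 k.2 j.2 _ (inf_le_left.trans inf_le_right : pullback.fst s t ⁻¹ᵁ (D.U i.1) ⊓ (pullback.snd s t) ⁻¹ᵁ (E.U i.2) ⊓ ((pullback.fst s t) ⁻¹ᵁ (D.U k.1) ⊓ (pullback.snd s t) ⁻¹ᵁ (E.U k.2)) ≤ _) (inf_le_right.trans inf_le_right)
    rw [h1, h2]
    ring
  bas i k := by
    rw [Scheme.basicOpen_mul, basicOpen_pbs, basicOpen_pbs, D.bas, E.bas]
    ext x; simp; tauto

end

section

abbrev gr (K : Type) [CommRing K] (n : ℕ) := MvPolynomial.homogeneousSubmodule (Fin (n + 1)) K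

theorem X_mem_gr (n : ℕ) (a : Fin (n+1)) : (MvPolynomial.X a : MvPolynomial (Fin (n+1)) K) ∈ gr K n 1 :=
  MvPolynomial.isHomogeneous_X _ _

/-- The element `x_b / x_a`. -/
def ratio (K : Type) [Field K] (n : ℕ) (a b : Fin (n+1)) :
    HomogeneousLocalization.Away (gr K n) (MvPolynomial.X a) :=
  HomogeneousLocalization.Away.mk (gr K n) (X_mem_gr n a) 1 (MvPolynomial.X b) (by simpa using X_mem_gr n b)

def Us (K : Type) [Field K] (n : ℕ) (a : Fin (n+1)) : (ProjSpace K n).Opens := Proj.basicOpen (gr K n) (MvPolynomial.X a)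

def ratioS (K : Type) [Field K] (n : ℕ) (a b : Fin (n+1)) : Γ(ProjSpace K n, Us K n a) :=
  (Proj.awayToSection (gr K n) (MvPolynomial.X a)).hom (ratio K n a b)

def ptP {K : Type} [Field K] {n : ℕ} (y : ProjSpace K n) : ProjectiveSpectrum (gr K n) := y

/-- Evaluate section at point -/
def evS {K : Type} [Field K] {n : ℕ} (V : (ProjSpace K n).Opens) (y : ProjSpace K n) (hy : y ∈ V) :
    Γ(ProjSpace K n, V) →+* HomogeneousLocalization.AtPrime (gr K n) (ptP y).asHomogeneousIdeal.toIdeal where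
  toFun s := s.1 ⟨y, hy⟩
  map_one' := rfl
  map_mul' _ _ := rfl
  map_add' _ _ := rfl
  map_zero' := rfl

theorem evS_rs {n : ℕ} {V W : (ProjSpace K n).Opens} (h : V ≤ W) (y : ProjSpace K n) (hy : y ∈ V)
    (s : Γ(ProjSpace K n, W)) : evS V y hy (rs h s) = evS W y (h hy) s := rfl

theorem evS_ext {n : ℕ} {V : (ProjSpace K n).Opens} (s t : Γ(ProjSpace K n, V))
    (h : ∀ y hy, evS V y hy s = evS V y hy t) : s = t := by
  apply Subtype.ext
  ext1 ⟨y, hy⟩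
  exact h y hy

theorem evS_ratio {n : ℕ} (a b : Fin (n+1)) (y : ProjSpace K n) (hy : y ∈ Us K n a) :
    (evS (Us K n a) y hy (ratioS K n a b)).val = Localization.mk (MvPolynomial.X b) (⟨MvPolynomial.X a, hy⟩ : (ptP y).asHomogeneousIdeal.toIdeal.primeCompl) := by
  refine (ProjectiveSpectrum.Proj.awayToSection_apply (gr K n) (MvPolynomial.X a) (ratio K n a b) ⟨y, hy⟩).trans ?_
  rw [ratio, HomogeneousLocalization.Away.val_mk, Localization.mk_eq_mk', IsLocalization.map_mk']
  rw [Localization.mk_eq_mk']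
  congr 1
  ext1
  simp

theorem ratio_self (n : ℕ) (a : Fin (n+1)) : ratioS K n a a = 1 := by
  apply evS_ext
  intro y hy
  apply HomogeneousLocalization.val_injective
  rw [evS_ratio, map_one, HomogeneousLocalization.val_one]
  exact Localization.mk_self (⟨MvPolynomial.X a, hy⟩ : (ptP y).asHomogeneousIdeal.toIdeal.primeCompl)

theorem ratio_coc (n : ℕ) (a b c : Fin (n+1)) : rs (inf_le_left : Us K n a ⊓ Us K n b ≤ _) (ratioS K n a c) =
   rs (inf_le_left : Us K n a ⊓ Us K n b ≤ _) (ratioS K n a b) * rs (inf_le_right : Us K n a ⊓ Us K n b ≤ _) (ratioS K n b c) := by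
  apply evS_ext
  intro y hy
  apply HomogeneousLocalization.val_injective
  rw [map_mul, HomogeneousLocalization.val_mul, evS_rs, evS_rs, evS_rs, evS_ratio, evS_ratio, evS_ratio, Localization.mk_mul]
  refine Localization.mk_eq_mk_iff.mpr ?_
  rw [Localization.r_iff_exists]
  use 1
  simp
  ring

theorem Us_cov (n : ℕ) (y : ProjSpace K n) : ∃ a, y ∈ Us K n a := by
  have := Proj.iSup_basicOpen_eq_top' (gr K n) (fun a : Fin (n+1) => (MvPolynomial.X a : MvPolynomial (Fin (n+1)) K))
    (fun a => ⟨1, X_mem_gr n a⟩) (by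
      rw [eq_top_iff]
      intro p _
      have hp : p ∈ Algebra.adjoin K (Set.range (MvPolynomial.X : Fin (n+1) → MvPolynomial (Fin (n+1)) K)) := by
        rw [MvPolynomial.adjoin_range_X]; trivial
      induction hp using Algebra.adjoin_induction with
      | mem x hx => exact Algebra.subset_adjoin hx
      | algebraMap r => 
        have : (algebraMap K (MvPolynomial (Fin (n+1)) K) r) = algebraMap (gr K n 0) (MvPolynomial (Fin (n+1)) K) (algebraMap K _ r) := rfl
        rw [this]
        exact Subalgebra.algebraMap_mem _ _
      | add x y _ _ h1 h2 => exact add_mem (h1 trivial) (h2 trivial)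
      | mul x y _ _ h1 h2 => exact mul_mem (h1 trivial) (h2 trivial))
  have h2 : y ∈ ⨆ a, Us K n a := by
    have h3 : ⨆ a, Us K n a = ⊤ := this
    rw [h3]; trivial
  simpa using h2

theorem ratio_bas (n : ℕ) (a b : Fin (n+1)) : (ProjSpace K n).basicOpen (ratioS K n a b) = Us K n a ⊓ Us K n b := by
  apply le_antisymm
  · intro y hy
    have hya : y ∈ Us K n a := (ProjSpace K n).basicOpen_le _ hy
    refine ⟨hya, ?_⟩
    have h1 : IsUnit (rs ((ProjSpace K n).basicOpen_le (ratioS K n a b)) (ratioS K n a b)) :=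
      RingedSpace.isUnit_res_basicOpen _ _
    have h2 := h1.map (evS _ y hy)
    rw [evS_rs, ← HomogeneousLocalization.isUnit_iff_isUnit_val, evS_ratio, Localization.mk_eq_mk', 
      IsLocalization.AtPrime.isUnit_mk'_iff _ (ptP y).asHomogeneousIdeal.toIdeal] at h2
    exact h2
  · have h1 : IsUnit (rs (inf_le_left : Us K n a ⊓ Us K n b ≤ _) (ratioS K n a b)) := by
      have := ratio_coc (K := K) n a b a
      rw [ratio_self, map_one] at this
      exact IsUnit.of_mul_eq_one _ this.symm
    have := ((ProjSpace K n).basicOpen_of_isUnit h1)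
    rw [basicOpen_rs] at this
    rw [← this]
    exact inf_le_right

def ampleProj (K : Type) [Field K] (n : ℕ) : AmpleData (ProjSpace K n) where
  I := Fin (n+1)
  fin := inferInstance
  U := Us K n
  aff a := Proj.isAffineOpen_basicOpen _ _ (X_mem_gr n a) one_pos
  cov := Us_cov n
  f := ratioS K n
  self := ratio_self n
  coc := ratio_coc n
  bas := ratio_bas n

end

section

/-- Ring map from the degree zero part of a localization given by a tuple. -/
def awl {R : Type} [CommRing R] (k : K →+* R) {N : ℕ} (t : Fin (N+1) → R) (x : MvPolynomial (Fin (N+1)) K)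
    (hx : IsUnit (MvPolynomial.eval₂Hom k t x)) : HomogeneousLocalization.Away (gr K N) x →+* R :=
  (IsLocalization.Away.lift x (S := Localization.Away x) (g := MvPolynomial.eval₂Hom k t) hx).comp
    (algebraMap (HomogeneousLocalization.Away (gr K N) x) (Localization.Away x))

theorem awl_mk {R : Type} [CommRing R] (k : K →+* R) {N : ℕ} (t : Fin (N+1) → R) (x : MvPolynomial (Fin (N+1)) K)
    (hx : IsUnit (MvPolynomial.eval₂Hom k t x)) {d : ℕ} (hd : x ∈ gr K N d) (n : ℕ) (a) (ha : a ∈ gr K N (n • d)) :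
    awl k t x hx (HomogeneousLocalization.Away.mk (gr K N) hd n a ha) * (MvPolynomial.eval₂Hom k t x)^n
      = MvPolynomial.eval₂Hom k t a := by
  have h : awl k t x hx (HomogeneousLocalization.Away.mk (gr K N) hd n a ha) =
    (IsLocalization.Away.lift x (S := Localization.Away x) (g := MvPolynomial.eval₂Hom k t) hx) 
      (Localization.mk a ⟨x ^ n, n, rfl⟩) := by
    rw [← HomogeneousLocalization.Away.val_mk (gr K N) n hd a ha]; rfl
  have h2 : Localization.mk a (⟨x ^ n, n, rfl⟩ : Submonoid.powers x) * algebraMap _ (Localization.Away x) (x ^ n) = algebraMap _ (Localization.Away x) a := by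
    rw [Localization.mk_eq_mk']
    exact IsLocalization.mk'_spec (Localization.Away x) a (⟨x ^ n, n, rfl⟩ : Submonoid.powers x)
  have h3 := congrArg (IsLocalization.Away.lift x (S := Localization.Away x) (g := MvPolynomial.eval₂Hom k t) hx) h2
  rw [map_mul, IsLocalization.Away.lift_eq, IsLocalization.Away.lift_eq, ← h, map_pow] at h3
  exact h3

theorem awl_zero {R : Type} [CommRing R] (k : K →+* R) {N : ℕ} (t : Fin (N+1) → R) (x : MvPolynomial (Fin (N+1)) K)
    (hx : IsUnit (MvPolynomial.eval₂Hom k t x)) (c : K) :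
    awl k t x hx (HomogeneousLocalization.fromZeroRingHom (gr K N) (.powers x) (algebraMap K (gr K N 0) c)) = k c := by
  have h : awl k t x hx (HomogeneousLocalization.fromZeroRingHom (gr K N) (.powers x) (algebraMap K (gr K N 0) c)) =
    (IsLocalization.Away.lift x (S := Localization.Away x) (g := MvPolynomial.eval₂Hom k t) hx) 
      (algebraMap (MvPolynomial (Fin (N+1)) K) (Localization.Away x) (MvPolynomial.C c)) := by
    unfold awl
    rw [RingHom.comp_apply]
    congr 1
  rw [h, IsLocalization.Away.lift_eq]
  simp

theorem awl_map {R : Type} [CommRing R] (k : K →+* R) {N : ℕ} (t : Fin (N+1) → R) (x y z : MvPolynomial (Fin (N+1)) K)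
    (hx : IsUnit (MvPolynomial.eval₂Hom k t x)) (hz : IsUnit (MvPolynomial.eval₂Hom k t z)) {d e : ℕ} (hd : x ∈ gr K N d) 
    (he : y ∈ gr K N e) (hxy : z = x * y) :
    (awl k t z hz).comp (HomogeneousLocalization.awayMap (gr K N) he hxy) = awl k t x hx := by
  ext w
  obtain ⟨n, a, ha, rfl⟩ := HomogeneousLocalization.Away.mk_surjective (gr K N) hd w
  have h1 := awl_mk k t x hx hd n a ha
  rw [RingHom.comp_apply, HomogeneousLocalization.awayMap_mk]
  have h2 := awl_mk k t z hz (d := d + e) (hxy ▸ SetLike.mul_mem_graded hd he) n (a * y ^ n) (by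
    rw [smul_add]; exact SetLike.mul_mem_graded ha (SetLike.pow_mem_graded n he))
  apply (hz.pow n).mul_left_injective
  refine Eq.trans h2 ?_
  rw [map_mul, ← h1]
  subst hxy
  simp only [map_mul, map_pow]
  ring

theorem awl_smul {R : Type} [CommRing R] (k : K →+* R) {N : ℕ} (t t' : Fin (N+1) → R) (u : R) (hu : IsUnit u)
    (h : ∀ j, t j = u * t' j) (x : MvPolynomial (Fin (N+1)) K)
    (hx : IsUnit (MvPolynomial.eval₂Hom k t x)) (hx' : IsUnit (MvPolynomial.eval₂Hom k t' x)) {d : ℕ} (hd : x ∈ gr K N d) :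
    awl k t x hx = awl k t' x hx' := by
  have key : ∀ (m : ℕ) (a), a ∈ gr K N m → MvPolynomial.eval₂Hom k t a = u ^ m * MvPolynomial.eval₂Hom k t' a := by
    intro m a ha
    have h0 : t = fun j => u * t' j := funext h
    simp only [MvPolynomial.coe_eval₂Hom, MvPolynomial.eval₂_eq, h0]
    rw [Finset.mul_sum]
    refine Finset.sum_congr rfl fun c hc => ?_
    have hm : c.degree = m := by
      have := (MvPolynomial.mem_homogeneousSubmodule _ _).1 ha (MvPolynomial.mem_support_iff.1 hc)
      rw [Finsupp.degree_eq_weight_one]; exact this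
    simp only [mul_pow, Finset.prod_mul_distrib, Finset.prod_pow_eq_pow_sum]
    have : ∑ i ∈ c.support, c i = m := hm
    rw [this]
    ring
  ext w
  obtain ⟨n, a, ha, rfl⟩ := HomogeneousLocalization.Away.mk_surjective (gr K N) hd w
  have h1 := awl_mk k t x hx hd n a ha
  have h2 := awl_mk k t' x hx' hd n a ha
  rw [key _ _ ha, ← h2, key _ _ hd, smul_eq_mul, mul_pow, ← pow_mul, mul_comm d n] at h1
  apply ((hu.pow (n*d)).mul (hx'.pow n)).mul_left_injective
  simp only
  rw [h1]; ring

theorem eval_X_unit {R : Type} [CommRing R] (k : K →+* R) {N : ℕ} (t : Fin (N+1) → R) (i) (h : IsUnit (t i)) :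
   IsUnit (MvPolynomial.eval₂Hom k t (MvPolynomial.X i)) := by simpa using h

theorem awl_surj {R : Type} [CommRing R] (k : K →+* R) {N : ℕ} (t : Fin (N+1) → R) (i : Fin (N+1))
    (h : IsUnit (t i)) (h1 : t i = 1) (hs : Function.Surjective (MvPolynomial.eval₂Hom k t)) :
    Function.Surjective (awl k t (MvPolynomial.X i) (eval_X_unit k t i h)) := by
  have hj : ∀ j, t j ∈ (awl k t (MvPolynomial.X i) (eval_X_unit k t i h)).range := by
    intro j
    refine ⟨ratio K N i j, ?_⟩
    have := awl_mk k t (MvPolynomial.X i) (eval_X_unit k t i h) (X_mem_gr N i) 1 (MvPolynomial.X j) (by simpa using X_mem_gr N j)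
    simpa [h1, ratio] using this
  have : ∀ p, MvPolynomial.eval₂Hom k t p ∈ (awl k t (MvPolynomial.X i) (eval_X_unit k t i h)).range := by
    intro p
    induction p using MvPolynomial.induction_on with
    | C c => 
      rw [MvPolynomial.eval₂Hom_C]
      exact ⟨_, awl_zero k t _ (eval_X_unit k t i h) c⟩
    | add p q hp hq => rw [map_add]; exact add_mem hp hq
    | mul_X p j hp => rw [map_mul]; exact mul_mem hp (by simpa using hj j)
  intro r
  obtain ⟨p, rfl⟩ := hs r
  exact this p

/-- The morphism to projective space given by a tuple. -/
def tupleMap {R : Type} [CommRing R] (k : K →+* R) {N : ℕ} (t : Fin (N+1) → R) (i : Fin (N+1)) (h : IsUnit (t i)) :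
    Spec (CommRingCat.of R) ⟶ ProjSpace K N :=
  Spec.map (CommRingCat.ofHom (awl k t (MvPolynomial.X i) (eval_X_unit k t i h))) ≫ Proj.awayι (gr K N) _ (X_mem_gr N i) one_pos

theorem tupleMap_over {R : Type} [CommRing R] (k : K →+* R) {N : ℕ} (t : Fin (N+1) → R) (i : Fin (N+1)) (h : IsUnit (t i)) :
    tupleMap k t i h ≫ ProjSpace.structMap K N = Spec.map (CommRingCat.ofHom k) := by
  unfold tupleMap ProjSpace.structMap
  rw [Category.assoc, Proj.awayι_toSpecZero_assoc, ← Spec.map_comp, ← Spec.map_comp]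
  congr 1
  ext c
  exact awl_zero k t _ (eval_X_unit k t i h) c

theorem tupleMap_comp {R R' : Type} [CommRing R] [CommRing R'] (k : K →+* R) {N : ℕ} (t : Fin (N+1) → R) (i : Fin (N+1)) (h : IsUnit (t i))
    (r : R →+* R') (k' : K →+* R') (hk : r.comp k = k') (t' : Fin (N+1) → R') (ht : ∀ j, t' j = r (t j)) (h' : IsUnit (t' i)) :
    Spec.map (CommRingCat.ofHom r) ≫ tupleMap k t i h = tupleMap k' t' i h' := by
  unfold tupleMap
  rw [← Spec.map_comp_assoc]
  congr 2
  rw [← CommRingCat.ofHom_comp]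
  congr 1
  subst hk
  obtain rfl : t' = fun j => r (t j) := funext ht
  have key : ∀ a, MvPolynomial.eval₂Hom (r.comp k) (fun j => r (t j)) a = r (MvPolynomial.eval₂Hom k t a) := by
    intro a
    exact (MvPolynomial.eval₂_comp_left r k t a).symm
  ext w
  obtain ⟨n, a, ha, rfl⟩ := HomogeneousLocalization.Away.mk_surjective (gr K N) (X_mem_gr N i) w
  have h1 := awl_mk k t _ (eval_X_unit k t i h) (X_mem_gr N i) n a ha
  have h2 := awl_mk (r.comp k) _ _ (eval_X_unit (r.comp k) (fun j => r (t j)) i h') (X_mem_gr N i) n a ha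
  rw [key a, ← h1, map_mul] at h2
  apply ((eval_X_unit (r.comp k) (fun j => r (t j)) i h').pow n).mul_left_injective
  simp only
  rw [h2, key, map_pow]; rfl

theorem tupleMap_indep {R : Type} [CommRing R] (k : K →+* R) {N : ℕ} (t : Fin (N+1) → R) (i i' : Fin (N+1)) (h : IsUnit (t i))
    (h' : IsUnit (t i')) : tupleMap k t i h = tupleMap k t i' h' := by
  have hz : IsUnit (MvPolynomial.eval₂Hom k t (MvPolynomial.X i * MvPolynomial.X i')) := by
    simpa using ⟨h, h'⟩
  have e1 : tupleMap k t i h = Spec.map (CommRingCat.ofHom (awl k t (MvPolynomial.X i * MvPolynomial.X i') hz)) ≫ 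
      Proj.awayι (gr K N) _ (SetLike.mul_mem_graded (X_mem_gr N i) (X_mem_gr N i')) (Nat.add_pos_left one_pos 1) := by
    unfold tupleMap
    rw [← Proj.SpecMap_awayMap_awayι (gr K N) (X_mem_gr N i) one_pos (X_mem_gr N i') rfl, ← Spec.map_comp_assoc, ← CommRingCat.ofHom_comp,
     awl_map k t _ _ _ (eval_X_unit k t i h) hz (X_mem_gr N i) (X_mem_gr N i') rfl]
  have e2 : tupleMap k t i' h' = Spec.map (CommRingCat.ofHom (awl k t (MvPolynomial.X i * MvPolynomial.X i') hz)) ≫ 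
      Proj.awayι (gr K N) _ (SetLike.mul_mem_graded (X_mem_gr N i) (X_mem_gr N i')) (Nat.add_pos_left one_pos 1) := by
    unfold tupleMap
    rw [← Proj.SpecMap_awayMap_awayι (gr K N) (X_mem_gr N i') one_pos (X_mem_gr N i) (mul_comm _ _), ← Spec.map_comp_assoc, ← CommRingCat.ofHom_comp,
     awl_map k t _ _ _ (eval_X_unit k t i' h') hz (X_mem_gr N i') (X_mem_gr N i) (mul_comm _ _)]
  rw [e1, e2]

theorem tupleMap_smul {R : Type} [CommRing R] (k : K →+* R) {N : ℕ} (t t' : Fin (N+1) → R) (u : R) (hu : IsUnit u)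
    (h : ∀ j, t j = u * t' j) (i i') (hi : IsUnit (t i)) (hi' : IsUnit (t' i')) :
    tupleMap k t i hi = tupleMap k t' i' hi' := by
  have hi2 : IsUnit (t' i) := by rw [h] at hi; exact isUnit_of_mul_isUnit_right hi
  rw [tupleMap_indep k t' i' i hi' hi2]
  unfold tupleMap
  rw [awl_smul k t t' u hu h _ (eval_X_unit k t i hi) (eval_X_unit k t' i hi2) (X_mem_gr N i)]

theorem tupleMap_mem {R : Type} [CommRing R] (k : K →+* R) {N : ℕ} (t : Fin (N+1) → R) (i j : Fin (N+1)) (h : IsUnit (t i))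
    (p : PrimeSpectrum R) : tupleMap k t i h p ∈ Us K N j ↔ t j ∉ p.asIdeal := by
  have h1 := awl_mk k t (MvPolynomial.X i) (eval_X_unit k t i h) (X_mem_gr N i) 1 (MvPolynomial.X j ^ 1) (by simpa using X_mem_gr N j)
  have h2 := Proj.awayι_preimage_basicOpen (gr K N) (X_mem_gr N i) one_pos (X_mem_gr N j) one_pos
  have h3 : tupleMap k t i h p ∈ Us K N j ↔ 
      Spec.map (CommRingCat.ofHom (awl k t (MvPolynomial.X i) (eval_X_unit k t i h))) p ∈ Proj.awayι (gr K N) _ (X_mem_gr N i) one_pos ⁻¹ᵁ Us K N j := by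
    unfold tupleMap
    rfl
  rw [h3]
  unfold Us
  rw [h2]
  refine Iff.trans (b := awl k t (MvPolynomial.X i) (eval_X_unit k t i h) (HomogeneousLocalization.Away.isLocalizationElem (X_mem_gr N i) (X_mem_gr N j)) ∉ p.asIdeal) Iff.rfl ?_
  simp only [pow_one, MvPolynomial.coe_eval₂Hom, MvPolynomial.eval₂_X] at h1
  rw [← h1, Ideal.mul_unit_mem_iff_mem _ h]
  simp only [HomogeneousLocalization.Away.isLocalizationElem, pow_one]

end

section

instance projProper (n : ℕ) : IsProper (ProjSpace.structMap K n) := by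
  haveI : IsScalarTower K (gr K n 0) (MvPolynomial (Fin (n+1)) K) := 
    IsScalarTower.of_algebraMap_eq (R := K) (S := ↥(gr K n 0)) (A := MvPolynomial (Fin (n+1)) K) (fun _ => rfl)
  haveI : Algebra.FiniteType (gr K n 0) (MvPolynomial (Fin (n+1)) K) :=
    Algebra.FiniteType.of_restrictScalars_finiteType K _ _
  haveI : IsProper (Proj.toSpecZero (gr K n)) := inferInstance
  haveI : IsClosedImmersion (Spec.map (CommRingCat.ofHom (algebraMap K ↥(gr K n 0)))) := by
    apply IsClosedImmersion.spec_of_surjective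
    rintro ⟨p, hp⟩
    have := (MvPolynomial.totalDegree_zero_iff_isHomogeneous (p := p)).2 hp
    rw [MvPolynomial.totalDegree_eq_zero_iff_eq_C] at this
    exact ⟨p.coeff 0, Subtype.ext this.symm⟩
  unfold ProjSpace.structMap
  infer_instance

theorem toSpec_over {X : Scheme.{0}} (s : X ⟶ SpecOf K) {U : X.Opens} (hU : IsAffineOpen U) :
    U.toSpecΓ ≫ Spec.map (CommRingCat.ofHom (kmap s U)) = U.ι ≫ s := by
  rw [← hU.toSpecΓ_fromSpec, Category.assoc]
  congr 1
  have := IsAffineOpen.SpecMap_appLE_fromSpec s (isAffineOpen_top (SpecOf K)) hU le_top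
  rw [← this]
  unfold kmap
  rw [CommRingCat.ofHom_hom, Spec.map_comp]
  congr 1
  rw [← cancel_epi (Spec.map (Scheme.ΓSpecIso (CommRingCat.of K)).hom)]
  rw [← Spec.map_comp, Iso.inv_hom_id, Spec.map_id]
  simp [IsAffineOpen.fromSpec_top, Scheme.isoSpec_Spec_inv]

theorem exists_glue {X Y : Scheme.{0}} {I : Type} (U : I → X.Opens) (hU : ∀ x, ∃ i, x ∈ U i)
    (f : ∀ i, (U i).toScheme ⟶ Y)
    (hf : ∀ i k, X.homOfLE (inf_le_left : U i ⊓ U k ≤ U i) ≫ f i = X.homOfLE (inf_le_right : U i ⊓ U k ≤ U k) ≫ f k) :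
    ∃ F : X ⟶ Y, ∀ i, (U i).ι ≫ F = f i := by
  let 𝒰 := X.openCoverOfIsOpenCover U (by
    rw [IsOpenCover]; ext x; simpa using hU x)
  have h : ∀ x y : I, pullback.fst (U x).ι (U y).ι ≫ f x = pullback.snd (U x).ι (U y).ι ≫ f y := by
    intro i k
    rw [← cancel_epi (isPullback_opens_inf (U i) (U k)).isoPullback.hom]
    simpa using hf i k
  exact ⟨𝒰.glueMorphisms f h, fun i => 𝒰.ι_glueMorphisms f h i⟩

theorem toSpec_mem {X : Scheme.{0}} {U : X.Opens} (hU : IsAffineOpen U) (x : U.toScheme) (a : Γ(X, U)) :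
    a ∉ (U.toSpecΓ x : PrimeSpectrum Γ(X, U)).asIdeal ↔ U.ι x ∈ X.basicOpen a := by
  have h0 : hU.fromSpec (U.toSpecΓ x) = U.ι x := by
    rw [← Scheme.Hom.comp_apply, hU.toSpecΓ_fromSpec]
  have h1 := ptIdeal_fromSpec hU (U.toSpecΓ x) (fromSpec_mem hU _)
  rw [← h1, mem_ptIdeal, not_not, h0]

theorem exists_tuple {X : Scheme.{0}} (s : X ⟶ SpecOf K) [IsProper s] {I : Type} (U : I → X.Opens)
    (hU : ∀ x, ∃ i, x ∈ U i) (haff : ∀ i, IsAffineOpen (U i)) (N : ℕ) (t : ∀ i, Fin (N+1) → Γ(X, U i))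
    (e : I → Fin (N+1)) (h1 : ∀ i, t i (e i) = 1)
    (hcoc : ∀ i k j, rs (inf_le_left : U i ⊓ U k ≤ U i) (t i j) = rs (inf_le_left : U i ⊓ U k ≤ U i) (t i (e k)) * rs (inf_le_right : U i ⊓ U k ≤ U k) (t k j))
    (hbas : ∀ i k, X.basicOpen (t i (e k)) = U i ⊓ U k)
    (hsurj : ∀ i, Function.Surjective (MvPolynomial.eval₂Hom (kmap s (U i)) (t i))) :
    ∃ F : X ⟶ ProjSpace K N, IsClosedImmersion F ∧ F ≫ ProjSpace.structMap K N = s := by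
  have hu : ∀ i, IsUnit (t i (e i)) := fun i => by rw [h1]; exact isUnit_one
  obtain ⟨F, hF⟩ := exists_glue U hU (fun i => (U i).toSpecΓ ≫ tupleMap (kmap s (U i)) (t i) (e i) (hu i)) (by
    intro i k
    have hi : IsUnit (rs (inf_le_left : U i ⊓ U k ≤ U i) (t i (e i))) := (hu i).map _
    have hk : IsUnit (rs (inf_le_right : U i ⊓ U k ≤ U k) (t k (e k))) := (hu k).map _
    rw [← Scheme.Opens.toSpecΓ_SpecMap_presheaf_map_assoc, ← Scheme.Opens.toSpecΓ_SpecMap_presheaf_map_assoc]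
    congr 1
    have e1 := tupleMap_comp (kmap s (U i)) (t i) (e i) (hu i) (rs (inf_le_left : U i ⊓ U k ≤ U i)) (kmap s (U i ⊓ U k))
      (kmap_res s _) (fun j => rs (inf_le_left : U i ⊓ U k ≤ U i) (t i j)) (fun j => rfl) hi
    have e2 := tupleMap_comp (kmap s (U k)) (t k) (e k) (hu k) (rs (inf_le_right : U i ⊓ U k ≤ U k)) (kmap s (U i ⊓ U k))
      (kmap_res s _) (fun j => rs (inf_le_right : U i ⊓ U k ≤ U k) (t k j)) (fun j => rfl) hk
    have e3 := tupleMap_smul (kmap s (U i ⊓ U k)) (fun j => rs (inf_le_left : U i ⊓ U k ≤ U i) (t i j))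
      (fun j => rs (inf_le_right : U i ⊓ U k ≤ U k) (t k j)) (rs (inf_le_left : U i ⊓ U k ≤ U i) (t i (e k))) (by
        have := hcoc i k (e i)
        rw [h1, map_one] at this
        exact IsUnit.of_mul_eq_one _ this.symm) (fun j => hcoc i k j) (e i) (e k) hi hk
    exact e1.trans (e3.trans e2.symm))
  have hover : F ≫ ProjSpace.structMap K N = s := by
    refine Scheme.Cover.hom_ext (X.openCoverOfIsOpenCover U (by
      rw [IsOpenCover]; ext x; simpa using hU x)) _ _ fun i => ?_
    change (U i).ι ≫ F ≫ _ = (U i).ι ≫ s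
    rw [reassoc_of% hF i, tupleMap_over, toSpec_over s (haff i)]
  have hmem : ∀ x i, F x ∈ Us K N (e i) ↔ x ∈ U i := by
    intro x i
    obtain ⟨k, hk⟩ := hU x
    obtain ⟨x', rfl⟩ : ∃ x' : (U k).toScheme, (U k).ι x' = x := ⟨⟨x, hk⟩, rfl⟩
    have hx : F ((U k).ι x') = tupleMap (kmap s (U k)) (t k) (e k) (hu k) ((U k).toSpecΓ x') := by
      rw [← Scheme.Hom.comp_apply, ← Scheme.Hom.comp_apply, ← hF k]
    rw [hx]
    refine (tupleMap_mem _ _ _ _ _ _).trans ((toSpec_mem (haff k) _ _).trans ?_)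
    rw [hbas]
    exact ⟨fun h => h.2, fun h => ⟨hk, h⟩⟩
  have hci : ∀ i, ∃ (Z : Scheme.{0}) (a : (U i).toScheme ⟶ Z) (b : Z ⟶ ProjSpace K N), IsClosedImmersion a ∧ IsOpenImmersion b ∧ (U i).ι ≫ F = a ≫ b := by
    intro i
    refine ⟨_, (U i).toSpecΓ ≫ Spec.map (CommRingCat.ofHom (awl (kmap s (U i)) (t i) (MvPolynomial.X (e i)) (eval_X_unit _ _ _ (hu i)))), 
      Proj.awayι (gr K N) _ (X_mem_gr N (e i)) one_pos, ?_, inferInstance, ?_⟩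
    · haveI : IsIso (U i).toSpecΓ := by
        rw [← (haff i).isoSpec_hom]; infer_instance
      haveI : IsClosedImmersion (Spec.map (CommRingCat.ofHom (awl (kmap s (U i)) (t i) (MvPolynomial.X (e i)) (eval_X_unit _ _ _ (hu i))))) := by
        apply IsClosedImmersion.spec_of_surjective
        exact awl_surj _ _ _ (hu i) (h1 i) (hsurj i)
      infer_instance
    · rw [hF]; rfl
  refine ⟨F, ?_, hover⟩
  haveI : IsProper (F ≫ ProjSpace.structMap K N) := by rw [hover]; infer_instance
  haveI : IsProper F := IsProper.of_comp F (ProjSpace.structMap K N)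
  haveI : SurjectiveOnStalks F := by
    rw [IsZariskiLocalAtSource.iff_of_openCover (P := @SurjectiveOnStalks) (X.openCoverOfIsOpenCover U (by
      rw [IsOpenCover]; ext x; simpa using hU x))]
    intro i
    change SurjectiveOnStalks ((U i).ι ≫ F)
    obtain ⟨Z, a, b, _, _, h⟩ := hci i
    rw [h]; infer_instance
  have hinj : Function.Injective F := by
    intro x y hxy
    obtain ⟨i, hi⟩ := hU x
    have hy : y ∈ U i := by rw [← hmem, ← hxy, hmem]; exact hi
    obtain ⟨Z, a, b, _, _, h⟩ := hci i
    have hin : Function.Injective ((U i).ι ≫ F) := by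
      rw [h]; exact (a ≫ b).injective
    obtain ⟨x', rfl⟩ : ∃ x' : (U i).toScheme, (U i).ι x' = x := ⟨⟨x, hi⟩, rfl⟩
    obtain ⟨y', rfl⟩ : ∃ y' : (U i).toScheme, (U i).ι y' = y := ⟨⟨y, hy⟩, rfl⟩
    have := @hin x' y' (by
      rw [Scheme.Hom.comp_apply, Scheme.Hom.comp_apply]; exact hxy)
    rw [this]
  have hce : Topology.IsClosedEmbedding F :=
    .of_continuous_injective_isClosedMap F.continuous hinj F.isClosedMap
  exact { toSurjectiveOnStalks := inferInstance, isClosedEmbedding := hce }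

end

section

theorem exists_gens {R : Type} [CommRing R] (k : K →+* R) (h : k.FiniteType) :
    ∃ (n : ℕ) (b : Fin n → R), Function.Surjective (MvPolynomial.eval₂Hom k b) := by
  letI := k.toAlgebra
  have h' : Algebra.FiniteType K R := h
  obtain ⟨n, f, hf⟩ := Algebra.FiniteType.iff_quotient_mvPolynomial''.1 h'
  refine ⟨n, fun a => f (MvPolynomial.X a), fun y => ?_⟩
  obtain ⟨p, rfl⟩ := hf y
  refine ⟨p, ?_⟩
  have : (MvPolynomial.eval₂Hom k fun a => f (MvPolynomial.X a)) = f.toRingHom := by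
    apply MvPolynomial.ringHom_ext
    · intro r
      simp [MvPolynomial.algHom_C]
      rfl
    · intro i; simp
  rw [this]; rfl

theorem AmpleData.embed {X : Scheme.{0}} (D : AmpleData X) (s : X ⟶ SpecOf K) [IsProper s] :
    ∃ (N : ℕ) (F : X ⟶ ProjSpace K N), IsClosedImmersion F ∧ F ≫ ProjSpace.structMap K N = s := by
  haveI := D.fin
  choose n b hb using fun i => exists_gens (kmap s (D.U i)) (kmap_finiteType s _ (D.aff i))
  choose m0 hm0 using fun (p : Σ i, Fin (n i)) => D.extend p.1 (b p.1 p.2)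
  obtain ⟨M, hM⟩ := Finite.exists_le m0
  choose g hg1 hg2 using fun p => hm0 p (M+1) ((hM p).trans (Nat.le_succ M))
  let J := Option (D.I ⊕ Σ i, Fin (n i))
  let N := Nat.card (D.I ⊕ Σ i, Fin (n i))
  let E : J ≃ Fin (N+1) := Finite.equivFinOfCardEq Finite.card_option
  let tt : ∀ i, J → Γ(X, D.U i) := fun i j => match j with
    | none => 0
    | some (Sum.inl k) => D.f i k ^ (M+1)
    | some (Sum.inr p) => g p i
  have hE : ∀ i j, tt i (E.symm (E j)) = tt i j := fun i j => by rw [Equiv.symm_apply_apply]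
  refine ⟨N, exists_tuple s D.U D.cov D.aff N (fun i j => tt i (E.symm j)) (fun i => E (some (Sum.inl i))) ?_ ?_ ?_ ?_⟩
  · intro i
    simp only [hE]
    change D.f i i ^ _ = 1
    rw [D.self, one_pow]
  · intro i k j
    simp only [hE]
    generalize E.symm j = j'
    change _ = rs _ (D.f i k ^ (M+1)) * _
    rcases j' with _ | l | p
    · change rs _ 0 = _ * rs _ 0
      simp
    · change rs _ (D.f i l ^ (M+1)) = _ * rs _ (D.f k l ^ (M+1))
      rw [map_pow, map_pow, map_pow, D.coc i k l, mul_pow]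
    · change rs _ (g p i) = _ * rs _ (g p k)
      rw [hg2, map_pow]
  · intro i k
    simp only [hE]
    change X.basicOpen (D.f i k ^ (M+1)) = _
    rw [Scheme.basicOpen_pow _ _ (Nat.succ_pos M), D.bas]
  · intro i y
    obtain ⟨p, rfl⟩ := hb i y
    refine ⟨p.rename (fun a => E (some (Sum.inr ⟨i, a⟩))), ?_⟩
    rw [MvPolynomial.eval₂Hom_rename]
    congr 2
    funext a
    simp only [Function.comp, hE]
    exact hg1 ⟨i, a⟩

end

section

/-- the affine coordinates as a projective tuple -/
def affTuple (r : ℕ) (R : Type) [CommRing R] : Fin (r+1) → MvPolynomial (Fin r) R := Fin.cons 1 MvPolynomial.X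

theorem affTuple_surj (r : ℕ) : Function.Surjective (MvPolynomial.eval₂Hom (MvPolynomial.C : K →+* MvPolynomial (Fin r) K) (affTuple r K)) := by
  intro p
  refine ⟨p.rename Fin.succ, ?_⟩
  rw [MvPolynomial.eval₂Hom_rename]
  have : affTuple r K ∘ Fin.succ = MvPolynomial.X := by funext a; simp [affTuple]
  rw [this]
  exact MvPolynomial.eval₂_eta p

theorem tupleMap_immersion {R : Type} [CommRing R] (k : K →+* R) {N : ℕ} (t : Fin (N+1) → R) (i : Fin (N+1)) (h : IsUnit (t i))
    (h1 : t i = 1) (hs : Function.Surjective (MvPolynomial.eval₂Hom k t)) : IsImmersion (tupleMap k t i h) := by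
  haveI : IsClosedImmersion (Spec.map (CommRingCat.ofHom (awl k t (MvPolynomial.X i) (eval_X_unit _ _ _ h)))) := by
    apply IsClosedImmersion.spec_of_surjective
    exact awl_surj _ _ _ h h1 hs
  haveI : IsOpenImmersion (Proj.awayι (gr K N) _ (X_mem_gr N i) one_pos) := inferInstance
  unfold tupleMap
  infer_instance

/-- rational point of projective space -/
def ratPt (K : Type) [Field K] (r : ℕ) : SpecOf K ⟶ ProjSpace K r :=
  tupleMap (RingHom.id K) (Fin.cons 1 (fun _ => 0) : Fin (r+1) → K) 0 (by simp)

theorem ratPt_over (r : ℕ) : ratPt K r ≫ ProjSpace.structMap K r = 𝟙 _ := by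
  unfold ratPt
  rw [tupleMap_over]
  exact Spec.map_id _

theorem affGen_dim (r : ℕ) (h) : dimPt (ProjSpace.structMap K r)
    (tupleMap (MvPolynomial.C : K →+* MvPolynomial (Fin r) K) (affTuple r K) 0 h (⊥ : PrimeSpectrum (MvPolynomial (Fin r) K))) = r := by
  haveI := tupleMap_immersion (MvPolynomial.C : K →+* MvPolynomial (Fin r) K) (affTuple r K) 0 h rfl (affTuple_surj r)
  have e : tupleMap (MvPolynomial.C : K →+* MvPolynomial (Fin r) K) (affTuple r K) 0 h ≫ ProjSpace.structMap K r = Spec.map (CommRingCat.ofHom MvPolynomial.C) :=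
    tupleMap_over _ _ _ _
  haveI : LocallyOfFiniteType (Spec.map (CommRingCat.ofHom (MvPolynomial.C : K →+* MvPolynomial (Fin r) K))) := by
    rw [HasRingHomProperty.Spec_iff (P := @LocallyOfFiniteType)]
    exact RingHom.finiteType_algebraMap.2 (inferInstance : Algebra.FiniteType K (MvPolynomial (Fin r) K))
  haveI : LocallyOfFiniteType (tupleMap (MvPolynomial.C : K →+* MvPolynomial (Fin r) K) (affTuple r K) 0 h ≫ ProjSpace.structMap K r) := by
    rw [e]; infer_instance
  have h1 := dimPt_eq (tupleMap (MvPolynomial.C : K →+* MvPolynomial (Fin r) K) (affTuple r K) 0 h) (ProjSpace.structMap K r) (⊥ : PrimeSpectrum (MvPolynomial (Fin r) K))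
  have h2 := topdim_closure (tupleMap (MvPolynomial.C : K →+* MvPolynomial (Fin r) K) (affTuple r K) 0 h ≫ ProjSpace.structMap K r) (⊥ : PrimeSpectrum (MvPolynomial (Fin r) K))
  have h3 : closure {(⊥ : PrimeSpectrum (MvPolynomial (Fin r) K))} = Set.univ := by
    rw [PrimeSpectrum.closure_singleton, PrimeSpectrum.asIdeal_bot]
    ext p
    simp [PrimeSpectrum.mem_zeroLocus]
  have h4 : topologicalKrullDim (closure {(⊥ : PrimeSpectrum (MvPolynomial (Fin r) K))} : Set _) = r := by
    rw [h3, (Homeomorph.Set.univ _).isHomeomorph.topologicalKrullDim_eq, PrimeSpectrum.topologicalKrullDim_eq_ringKrullDim]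
    simp
  have h5 := h2.symm.trans h4
  rw [h1]
  exact_mod_cast h5

theorem chart_enlarge (r : ℕ) {Z : Scheme.{0}} (s : Z ⟶ SpecOf K) [LocallyOfFiniteType s] (z : Z) :
    ∃ η : (pullback (ProjSpace.structMap K r) s : Scheme), η ⤳ (pullback.lift (s ≫ ratPt K r) (𝟙 Z) (by rw [Category.assoc, ratPt_over]; simp) : Z ⟶ pullback (ProjSpace.structMap K r) s) z ∧
      pullback.snd (ProjSpace.structMap K r) s η = z ∧ r ≤ dimPt (pullback.snd (ProjSpace.structMap K r) s ≫ s) η := by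
  obtain ⟨κ, _, p, hp⟩ : ∃ (κ : Type) (_ : Field κ) (p : Spec (CommRingCat.of κ) ⟶ Z), ∀ b, p b = z :=
    ⟨Z.residueField z, inferInstance, Z.fromSpecResidueField z, fun b => Scheme.fromSpecResidueField_apply z b⟩
  obtain ⟨k, hk⟩ : ∃ k : K →+* κ, Spec.map (CommRingCat.ofHom k) = p ≫ s :=
    ⟨(Spec.preimage (p ≫ s)).hom, Spec.map_preimage _⟩
  have hu : IsUnit (affTuple r K 0) := by simp [affTuple]
  have hu' : IsUnit (affTuple r κ 0) := by simp [affTuple]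
  let m := MvPolynomial.map (σ := Fin r) k
  let T : Spec (CommRingCat.of (MvPolynomial (Fin r) κ)) ⟶ ProjSpace K r := tupleMap (MvPolynomial.C.comp k) (affTuple r κ) 0 hu'
  have hT : T = Spec.map (CommRingCat.ofHom m) ≫ tupleMap MvPolynomial.C (affTuple r K) 0 hu := by
    refine (tupleMap_comp _ _ _ _ _ _ ?_ _ ?_ _).symm
    · ext a; simp [m]
    · intro j
      refine Fin.cases ?_ (fun j => ?_) j <;> simp [affTuple, m]
  have hTo : T ≫ ProjSpace.structMap K r = (Spec.map (CommRingCat.ofHom MvPolynomial.C) ≫ p) ≫ s := by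
    rw [tupleMap_over, Category.assoc, ← hk, ← Spec.map_comp]
    rfl
  let e := pullback.lift T (Spec.map (CommRingCat.ofHom MvPolynomial.C) ≫ p) hTo
  let o : Spec (CommRingCat.of κ) ⟶ Spec (CommRingCat.of (MvPolynomial (Fin r) κ)) :=
    Spec.map (CommRingCat.ofHom (MvPolynomial.eval (fun _ => 0)))
  have ho : o ≫ e = p ≫ (pullback.lift (s ≫ ratPt K r) (𝟙 Z) (by rw [Category.assoc, ratPt_over]; simp) : Z ⟶ pullback (ProjSpace.structMap K r) s) := by
    apply pullback.hom_ext
    · simp only [e, Category.assoc, pullback.lift_fst]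
      rw [← Category.assoc, ← hk]
      unfold ratPt
      rw [tupleMap_comp _ _ _ _ k k (by simp) (Fin.cons 1 (fun _ => 0)) _ (by simp)]
      · refine tupleMap_comp _ _ _ _ _ _ ?_ _ ?_ _
        · ext a; simp
        · intro j
          refine Fin.cases ?_ (fun j => ?_) j <;> simp [affTuple]
      · intro j
        refine Fin.cases ?_ (fun j => ?_) j <;> simp
    · simp only [e, Category.assoc, pullback.lift_snd, Category.comp_id, o]
      rw [← Category.assoc, ← Spec.map_comp, ← CommRingCat.ofHom_comp]
      have : (MvPolynomial.eval (fun _ : Fin r => (0 : κ))).comp MvPolynomial.C = RingHom.id _ := by ext a; simp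
      rw [this]
      exact (congrArg (· ≫ _) (Spec.map_id _)).trans (Category.id_comp _)
  let β : Spec (CommRingCat.of (MvPolynomial (Fin r) κ)) := (⊥ : PrimeSpectrum (MvPolynomial (Fin r) κ))
  let b : Spec (CommRingCat.of κ) := (⊥ : PrimeSpectrum κ)
  have hz : p b = z := hp b
  have hsnd : pullback.snd (ProjSpace.structMap K r) s (e β) = z := by
    rw [← Scheme.Hom.comp_apply, pullback.lift_snd, Scheme.Hom.comp_apply]
    exact hp _
  refine ⟨e β, ?_, hsnd, ?_⟩
  · have h1 : (pullback.lift (s ≫ ratPt K r) (𝟙 Z) (by rw [Category.assoc, ratPt_over]; simp) : Z ⟶ pullback (ProjSpace.structMap K r) s) z = e (o b) := by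
      rw [← Scheme.Hom.comp_apply, ho, Scheme.Hom.comp_apply, hz]
    rw [h1]
    have h2 : β ⤳ o b := (PrimeSpectrum.le_iff_specializes (⊥ : PrimeSpectrum (MvPolynomial (Fin r) κ)) _).1 bot_le
    exact h2.map e.continuous
  · have h3 : pullback.fst (ProjSpace.structMap K r) s (e β) = tupleMap MvPolynomial.C (affTuple r K) 0 hu (⊥ : PrimeSpectrum (MvPolynomial (Fin r) K)) := by
      rw [← Scheme.Hom.comp_apply, pullback.lift_fst, hT, Scheme.Hom.comp_apply]
      congr 1
      apply PrimeSpectrum.ext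
      change Ideal.comap m ⊥ = ⊥
      rw [← RingHom.ker_eq_comap_bot, ← RingHom.injective_iff_ker_eq_bot]
      exact MvPolynomial.map_injective _ k.injective
    have h4 := affGen_dim (K := K) r hu
    rw [← h3] at h4
    haveI : LocallyOfFiniteType (pullback.fst (ProjSpace.structMap K r) s ≫ ProjSpace.structMap K r) := by infer_instance
    have h5 := dimPt_le (pullback.fst (ProjSpace.structMap K r) s) (ProjSpace.structMap K r) (e β)
    rw [h4] at h5
    rwa [← pullback.condition]

end

section

/-- the constant section of `P^r × Z → Z` -/
def sec0 (r : ℕ) {Z : Scheme.{0}} (s : Z ⟶ SpecOf K) : Z ⟶ pullback (ProjSpace.structMap K r) s :=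
  pullback.lift (s ≫ ratPt K r) (𝟙 Z) (by rw [Category.assoc, ratPt_over]; simp)

theorem sec0_snd (r : ℕ) {Z : Scheme.{0}} (s : Z ⟶ SpecOf K) : sec0 r s ≫ pullback.snd (ProjSpace.structMap K r) s = 𝟙 Z :=
  pullback.lift_snd _ _ _

theorem enlarge (r : ℕ) {Z : Scheme.{0}} (s : Z ⟶ SpecOf K) [LocallyOfFiniteType s] (z : Z) (h : dimPt s z ≤ r) :
    ∃ η : (pullback (ProjSpace.structMap K r) s : Scheme), η ⤳ sec0 r s z ∧
      pullback.snd (ProjSpace.structMap K r) s η = z ∧ dimPt (pullback.snd (ProjSpace.structMap K r) s ≫ s) η = r := by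
  obtain ⟨η, h1, h2, h3⟩ := chart_enlarge r s z
  change η ⤳ sec0 r s z at h1
  have e : sec0 r s ≫ pullback.snd (ProjSpace.structMap K r) s ≫ s = s := by
    rw [reassoc_of% sec0_snd r s]
  haveI : LocallyOfFiniteType (sec0 r s ≫ pullback.snd (ProjSpace.structMap K r) s ≫ s) := by rw [e]; infer_instance
  have h4 := dimPt_le (sec0 r s) (pullback.snd (ProjSpace.structMap K r) s ≫ s) z
  rw [e] at h4
  obtain ⟨ζ, h5, h6, h7⟩ := exists_dimPt (pullback.snd (ProjSpace.structMap K r) s ≫ s) h1 r (h4.trans h) h3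
  refine ⟨ζ, h6, ?_, h7⟩
  have h8 := h5.map (pullback.snd (ProjSpace.structMap K r) s).continuous
  have h9 := h6.map (pullback.snd (ProjSpace.structMap K r) s).continuous
  rw [h2] at h8
  have h10 : pullback.snd (ProjSpace.structMap K r) s (sec0 r s z) = z := by
    rw [← Scheme.Hom.comp_apply, sec0_snd]; rfl
  rw [h10] at h9
  exact (h9.antisymm h8).eq

/-- proper over `K` with an ample line bundle -/
def PA {Y : Scheme.{0}} (s : Y ⟶ SpecOf K) : Prop := IsProper s ∧ Nonempty (AmpleData Y)

theorem PA.proj (n : ℕ) : PA (ProjSpace.structMap K n) := ⟨inferInstance, ⟨ampleProj K n⟩⟩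

theorem PA.closed {X Y : Scheme.{0}} (s : Y ⟶ SpecOf K) (h : PA s) (j : X ⟶ Y) [IsFinite j] : PA (j ≫ s) := by
  haveI := h.1
  exact ⟨inferInstance, ⟨h.2.some.pullback j⟩⟩

theorem PA.prod {X Y : Scheme.{0}} (s : X ⟶ SpecOf K) (t : Y ⟶ SpecOf K) (h : PA s) (h' : PA t) :
    PA (pullback.snd s t ≫ t) := by
  haveI := h.1
  haveI := h'.1
  exact ⟨inferInstance, ⟨h.2.some.prod s t h'.2.some⟩⟩

theorem PA.id : PA (𝟙 (SpecOf K)) := by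
  refine ⟨inferInstance, ⟨⟨Unit, inferInstance, fun _ => ⊤, fun _ => isAffineOpen_top _, fun _ => ⟨(), trivial⟩, fun _ _ => 1, fun _ => rfl, ?_, ?_⟩⟩⟩
  · intros; simp
  · intros; simp

theorem PA.isProjective (V : Variety K) (h : PA V.structMap) : V.IsProjective := by
  haveI := h.1
  exact h.2.some.embed V.structMap

theorem exists_power {P : Scheme.{0}} (p : P ⟶ SpecOf K) (hp : PA p) (ι : Type) [Finite ι] :
    ∃ (Q : Scheme.{0}) (s : Q ⟶ SpecOf K) (π : ι → (Q ⟶ P)), (∀ i, π i ≫ p = s) ∧ PA s ∧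
      ∀ (T : Scheme.{0}) (t : T ⟶ SpecOf K) (f : ι → (T ⟶ P)), (∀ i, f i ≫ p = t) →
        ∃! h : T ⟶ Q, h ≫ s = t ∧ ∀ i, h ≫ π i = f i := by
  induction ι using Finite.induction_empty_option with
  | @of_equiv α β e ih =>
    obtain ⟨Q, s, π, h1, h2, h3⟩ := ih
    refine ⟨Q, s, fun b => π (e.symm b), fun b => h1 _, h2, fun T t f hf => ?_⟩
    obtain ⟨h, ⟨h4, h5⟩, h6⟩ := h3 T t (fun a => f (e a)) (fun a => hf _)
    refine ⟨h, ⟨h4, fun b => by simp [h5]⟩, ?_⟩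
    rintro g ⟨g1, g2⟩
    exact h6 g ⟨g1, fun a => by simpa using g2 (e a)⟩
  | h_empty =>
    refine ⟨SpecOf K, 𝟙 _, fun i => i.elim, fun i => i.elim, PA.id, fun T t f hf => ⟨t, ⟨by simp, fun i => i.elim⟩, ?_⟩⟩
    rintro g ⟨g1, -⟩
    simpa using g1
  | @h_option α _ ih =>
    obtain ⟨Q, s, π, h1, h2, h3⟩ := ih
    refine ⟨pullback p s, pullback.snd p s ≫ s, fun o => match o with
      | none => pullback.fst p s
      | some a => pullback.snd p s ≫ π a, ?_, PA.prod p s hp h2, fun T t f hf => ?_⟩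
    · rintro (_ | a)
      · exact pullback.condition
      · simp [h1]
    · obtain ⟨h, ⟨h4, h5⟩, h6⟩ := h3 T t (fun a => f (some a)) (fun a => hf _)
      refine ⟨pullback.lift (f none) h (by rw [hf, h4]), ⟨by rw [pullback.lift_snd_assoc, h4], ?_⟩, ?_⟩
      · rintro (_ | a)
        · exact pullback.lift_fst _ _ _
        · exact (pullback.lift_snd_assoc _ _ _ _).trans (h5 a)
      · rintro g ⟨g1, g2⟩
        apply pullback.hom_ext
        · exact (g2 none).trans (pullback.lift_fst _ _ _).symm
        · rw [pullback.lift_snd]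
          refine h6 _ ⟨by simpa using g1, fun a => by simpa using g2 (some a)⟩

theorem exists_aut {G : Type} [Group G] {Y : Scheme.{0}} (a : G → (Y ⟶ Y)) (h1 : a 1 = 𝟙 Y)
    (hm : ∀ g h, a (g * h) = a h ≫ a g) : ∃ ρ : G →* Aut Y, ∀ g, (ρ g).hom = a g := by
  refine ⟨MonoidHom.mk' (fun g => ⟨a g, a g⁻¹, by rw [← hm, inv_mul_cancel, h1], by rw [← hm, mul_inv_cancel, h1]⟩) ?_, fun g => rfl⟩
  intro g h
  apply Iso.ext
  exact hm g h

/-- finitely many generic points -/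
theorem exists_generics {X : Scheme.{0}} (s : X ⟶ SpecOf K) [LocallyOfFiniteType s] [QuasiCompact s] :
    ∃ S : Set X, S.Finite ∧ (∀ x, ∃ y ∈ S, y ⤳ x) ∧ ∀ y ∈ S, closure {y} ∈ irreducibleComponents X := by
  haveI := noetherianSpace_of_ft s
  refine ⟨{y | closure {y} ∈ irreducibleComponents X}, ?_, ?_, fun y hy => hy⟩
  · refine Set.Finite.of_finite_image (f := fun y => closure {y}) (TopologicalSpace.NoetherianSpace.finite_irreducibleComponents.subset ?_) ?_
    · rintro _ ⟨y, hy, rfl⟩; exact hy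
    · intro x _ y _ h
      exact (inseparable_iff_closure_eq.2 h).eq
  · intro x
    obtain ⟨y, hy, -⟩ := dimPt_of_component s (irreducibleComponent x) (irreducibleComponent_mem_irreducibleComponents x)
    refine ⟨y, ?_, ?_⟩
    · change closure {y} ∈ irreducibleComponents X
      rw [hy]; exact irreducibleComponent_mem_irreducibleComponents x
    · rw [specializes_iff_mem_closure, hy]
      exact mem_irreducibleComponent

theorem exists_union {Y : Scheme.{0}} (S : Set Y) (hS : S.Finite) :
    ∃ (W : Scheme.{0}) (j : W ⟶ Y), IsReduced W ∧ IsClosedImmersion j ∧ Set.range j = ⋃ z ∈ S, closure {z} :=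
  exists_redSub _ (hS.isClosed_biUnion (fun _ _ => isClosed_closure))

end

section

theorem sec0_over (r : ℕ) {Z : Scheme.{0}} (s : Z ⟶ SpecOf K) :
    sec0 r s ≫ pullback.snd (ProjSpace.structMap K r) s ≫ s = s := by
  rw [reassoc_of% sec0_snd r s]

/-- the variety attached to a reduced scheme with ample data -/
def mkVar {W : Scheme.{0}} (s : W ⟶ SpecOf K) (h : IsReduced W) (hs : PA s) : Variety K :=
  haveI := hs.1
  ⟨W, s, h, inferInstance, inferInstance, inferInstance⟩

theorem compactify_base (V : Variety K) (hV : V.IsQuasiProjective) (d : ℕ) (hd : ∀ x, dimPt V.structMap x ≤ d) :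
    ∃ (W : Variety K) (i : V.X ⟶ W.X), PA W.structMap ∧ IsImmersion i ∧ i ≫ W.structMap = V.structMap ∧
      IsPureOfDim W.X d ∧ (IsEmpty V.X → IsEmpty W.X) := by
  obtain ⟨n, i0, hi0, hover⟩ := hV
  haveI := V.reduced
  haveI := V.locallyOfFiniteType
  haveI := V.quasiCompact
  obtain ⟨S, hSf, hS, -⟩ := exists_generics V.structMap
  let p := ProjSpace.structMap K n
  let sY := pullback.snd (ProjSpace.structMap K d) p ≫ p
  have hPA : PA sY := PA.prod _ _ (PA.proj d) (PA.proj n)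
  haveI := hPA.1
  haveI : LocallyOfFiniteType (i0 ≫ p) := by rw [hover]; infer_instance
  have hdim : ∀ x, dimPt p (i0 x) ≤ d := fun x => by
    have := dimPt_le i0 p x
    rw [hover] at this
    exact this.trans (hd x)
  choose η h1 h2 h3 using fun x => enlarge d p (i0 x) (hdim x)
  obtain ⟨W, j, hW, hj, hr⟩ := exists_union (η '' S) (hSf.image η)
  have hrange : Set.range (i0 ≫ sec0 d p) ⊆ Set.range j := by
    rintro _ ⟨v, rfl⟩
    obtain ⟨x, hx, hxv⟩ := hS v
    rw [hr]
    simp only [Set.mem_iUnion]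
    refine ⟨η x, ⟨x, hx, rfl⟩, ?_⟩
    rw [← specializes_iff_mem_closure]
    refine (h1 x).trans ?_
    rw [← Scheme.Hom.comp_apply]
    exact hxv.map (i0 ≫ sec0 d p).continuous
  obtain ⟨i, hi⟩ := exists_lift_closed j (i0 ≫ sec0 d p) hrange
  refine ⟨mkVar (j ≫ sY) hW (PA.closed sY hPA j), i, PA.closed sY hPA j, ?_, ?_, ?_, ?_⟩
  · haveI : IsImmersion (i ≫ j ≫ pullback.snd (ProjSpace.structMap K d) p) := by
      rw [reassoc_of% hi, sec0_snd, Category.comp_id]; exact hi0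
    exact IsImmersion.of_comp i (j ≫ pullback.snd (ProjSpace.structMap K d) p)
  · change i ≫ j ≫ sY = _
    rw [reassoc_of% hi, sec0_over, hover]
  · refine pure_of_points j sY (η '' S) d ?_ hr
    rintro _ ⟨x, -, rfl⟩
    exact h3 x
  · intro hE
    have : S = ∅ := Set.eq_empty_of_isEmpty S
    rw [this] at hr
    simp at hr
    exact hr

theorem compactify_total (V' W : Variety K) (hV' : V'.IsQuasiProjective) (hW : PA W.structMap) (d d' : ℕ) (hdd : d ≤ d')
    (hWd : IsPureOfDim W.X d) (hd' : ∀ x, dimPt V'.structMap x ≤ d')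
    (ψ : V'.X ⟶ W.X) (hψ : ψ ≫ W.structMap = V'.structMap) (G : Type) [Group G] [Finite G] (σ : ActionOn G V')
    (hinv : σ.Invariant ψ) :
    ∃ (W' : Variety K) (φbar : W'.X ⟶ W.X) (i' : V'.X ⟶ W'.X), PA W'.structMap ∧
      φbar ≫ W.structMap = W'.structMap ∧ Function.Surjective φbar.base ∧ IsImmersion i' ∧
      i' ≫ W'.structMap = V'.structMap ∧ IsPureOfDim W'.X d' ∧ i' ≫ φbar = ψ ∧
      (∃ U : W.X.Opens, Dense (U : Set W.X) ∧ ∀ y : W.X, y ∈ U → IsPure (fiber φbar y)) ∧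
      (∃ σbar : ActionOn G W', (∀ g : G, i' ≫ (σbar.ρ g).hom = (σ.ρ g).hom ≫ i') ∧ σbar.Invariant φbar) := by
  obtain ⟨m, j0, hj0, hover⟩ := hV'
  haveI := V'.reduced
  haveI := V'.locallyOfFiniteType
  haveI := V'.quasiCompact
  haveI := W.reduced
  haveI := hW.1
  obtain ⟨S1, hS1f, hS1, -⟩ := exists_generics V'.structMap
  obtain ⟨S2, hS2f, hS2, hS2c⟩ := exists_generics W.structMap
  obtain ⟨Q, sQ, π, hπ, hQ, huniv⟩ := exists_power (ProjSpace.structMap K m) (PA.proj m) G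
  haveI := hQ.1
  have hext : ∀ {T : Scheme.{0}} (f g : T ⟶ Q), (∀ h, f ≫ π h = g ≫ π h) → f = g := by
    intro T f g hfg
    have e : f ≫ sQ = g ≫ sQ := by rw [← hπ 1, reassoc_of% hfg 1]
    obtain ⟨h, -, hu⟩ := huniv T (g ≫ sQ) (fun i => g ≫ π i) (fun i => by rw [Category.assoc, hπ])
    rw [hu f ⟨e, hfg⟩, hu g ⟨rfl, fun _ => rfl⟩]
  choose ρ hρ1 hρ2 using fun g : G => (huniv Q sQ (fun h => π (h * g)) (fun h => hπ _)).exists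
  have hρone : ρ 1 = 𝟙 _ := hext _ _ fun h => by simp [hρ2]
  have hρmul : ∀ g h, ρ (g * h) = ρ h ≫ ρ g := fun g h => hext _ _ fun k => by simp [hρ2, mul_assoc]
  obtain ⟨q, hq1, hq2⟩ := (huniv V'.X V'.structMap (fun h => (σ.ρ h).hom ≫ j0) (fun h => by
    rw [Category.assoc, hover, σ.over'])).exists
  have hqρ : ∀ g, q ≫ ρ g = (σ.ρ g).hom ≫ q := fun g => hext _ _ fun h => by
    rw [Category.assoc, Category.assoc, hρ2, hq2, hq2, map_mul]
    exact Category.assoc _ _ _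
  obtain ⟨q0, hq01, hq02⟩ := (huniv (SpecOf K) (𝟙 _) (fun h => ratPt K m) (fun h => ratPt_over m)).exists
  let sZ := pullback.snd sQ W.structMap ≫ W.structMap
  have hZ : PA sZ := PA.prod _ _ hQ hW
  haveI := hZ.1
  let P := ProjSpace.structMap K d'
  let sY := pullback.snd P sZ ≫ sZ
  have hY : PA sY := PA.prod _ _ (PA.proj d') hZ
  haveI := hY.1
  let aZ : G → (pullback sQ W.structMap ⟶ pullback sQ W.structMap) := fun g =>
    pullback.lift (pullback.fst sQ W.structMap ≫ ρ g) (pullback.snd sQ W.structMap) (by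
      rw [Category.assoc, hρ1, pullback.condition])
  have aZf : ∀ g, aZ g ≫ pullback.fst sQ W.structMap = pullback.fst sQ W.structMap ≫ ρ g := fun g => pullback.lift_fst _ _ _
  have aZs : ∀ g, aZ g ≫ pullback.snd sQ W.structMap = pullback.snd sQ W.structMap := fun g => pullback.lift_snd _ _ _
  have aZo : ∀ g, aZ g ≫ sZ = sZ := fun g => by rw [reassoc_of% aZs g]
  let aY : G → (pullback P sZ ⟶ pullback P sZ) := fun g =>
    pullback.lift (pullback.fst P sZ) (pullback.snd P sZ ≫ aZ g) (by
      rw [Category.assoc, aZo, pullback.condition])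
  have aYf : ∀ g, aY g ≫ pullback.fst P sZ = pullback.fst P sZ := fun g => pullback.lift_fst _ _ _
  have aYs : ∀ g, aY g ≫ pullback.snd P sZ = pullback.snd P sZ ≫ aZ g := fun g => pullback.lift_snd _ _ _
  have aYo : ∀ g, aY g ≫ sY = sY := fun g => by rw [reassoc_of% aYs g, aZo]
  have aZ1 : aZ 1 = 𝟙 _ := pullback.hom_ext (by rw [aZf, hρone]; simp) (by rw [aZs]; simp)
  have aY1 : aY 1 = 𝟙 _ := pullback.hom_ext (by rw [aYf]; simp) (by rw [aYs, aZ1]; simp)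
  have aZm : ∀ g h, aZ (g * h) = aZ h ≫ aZ g := fun g h => pullback.hom_ext
    (by rw [aZf, Category.assoc, aZf, reassoc_of% aZf h, hρmul]) (by rw [aZs, Category.assoc, aZs, aZs])
  have aYm : ∀ g h, aY (g * h) = aY h ≫ aY g := fun g h => pullback.hom_ext
    (by rw [aYf, Category.assoc, aYf, aYf]) (by rw [aYs, Category.assoc, aYs, reassoc_of% aYs h, aZm])
  have aYiso : ∀ g, IsIso (aY g) := fun g => ⟨aY g⁻¹, by rw [← aYm, inv_mul_cancel, aY1], by rw [← aYm, mul_inv_cancel, aY1]⟩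
  have aYdim : ∀ g y, dimPt sY (aY g y) = dimPt sY y := fun g y => by
    haveI := aYiso g
    have := dimPt_eq (aY g) sY y
    rwa [aYo] at this
  let pr := pullback.snd P sZ ≫ pullback.snd sQ W.structMap
  have hpro : pr ≫ W.structMap = sY := Category.assoc _ _ _
  have aYpr : ∀ g, aY g ≫ pr = pr := fun g => by rw [reassoc_of% aYs g, aZs]
  -- the embedding of V'
  let qZ : V'.X ⟶ pullback sQ W.structMap := pullback.lift q ψ (by rw [hq1, hψ])
  have qZf : qZ ≫ pullback.fst sQ W.structMap = q := pullback.lift_fst _ _ _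
  have qZs : qZ ≫ pullback.snd sQ W.structMap = ψ := pullback.lift_snd _ _ _
  have qZo : qZ ≫ sZ = V'.structMap := by rw [reassoc_of% qZs, hψ]
  have qZa : ∀ g, qZ ≫ aZ g = (σ.ρ g).hom ≫ qZ := fun g => pullback.hom_ext
    (by rw [Category.assoc, Category.assoc, aZf, reassoc_of% qZf, hqρ, qZf])
    (by rw [Category.assoc, Category.assoc, aZs, qZs, hinv g])
  let iY : V'.X ⟶ pullback P sZ := qZ ≫ sec0 d' sZ
  have iYs : iY ≫ pullback.snd P sZ = qZ := by
    rw [Category.assoc]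
    exact (congrArg (qZ ≫ ·) (sec0_snd d' sZ)).trans (Category.comp_id _)
  have hseca : ∀ g, sec0 d' sZ ≫ aY g = aZ g ≫ sec0 d' sZ := fun g => pullback.hom_ext
    (by
      rw [Category.assoc, Category.assoc, aYf]
      unfold sec0
      rw [pullback.lift_fst, reassoc_of% aZo g])
    (by
      rw [Category.assoc, Category.assoc, aYs]
      have := sec0_snd d' sZ
      rw [reassoc_of% this, this]; simp)
  have iYa : ∀ g, iY ≫ aY g = (σ.ρ g).hom ≫ iY := fun g => by
    change (qZ ≫ _) ≫ _ = _ ≫ qZ ≫ _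
    rw [Category.assoc, hseca, reassoc_of% qZa g]
  have iYimm : IsImmersion iY := by
    have e : iY ≫ (pullback.snd P sZ ≫ pullback.fst sQ W.structMap ≫ π 1) = j0 := by
      rw [reassoc_of% iYs, reassoc_of% qZf, hq2, map_one]
      exact Category.id_comp _
    haveI : IsImmersion (iY ≫ (pullback.snd P sZ ≫ pullback.fst sQ W.structMap ≫ π 1)) := by rw [e]; exact hj0
    exact IsImmersion.of_comp iY (pullback.snd P sZ ≫ pullback.fst sQ W.structMap ≫ π 1)
  -- the points
  haveI : LocallyOfFiniteType (qZ ≫ sZ) := by rw [qZo]; infer_instance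
  have hdim1 : ∀ x, dimPt sZ (qZ x) ≤ d' := fun x => by
    have := dimPt_le qZ sZ x
    rw [qZo] at this
    exact this.trans (hd' x)
  choose η1 h11 h12 h13 using fun x => enlarge d' sZ (qZ x) (hdim1 x)
  let c : W.X ⟶ pullback sQ W.structMap := pullback.lift (W.structMap ≫ q0) (𝟙 _) (by
    rw [Category.assoc, hq01, Category.comp_id, Category.id_comp])
  have cs : c ≫ pullback.snd sQ W.structMap = 𝟙 _ := pullback.lift_snd _ _ _
  have co : c ≫ sZ = W.structMap := by rw [reassoc_of% cs]
  have hdimW : ∀ w, dimPt W.structMap w ≤ d := fun w => by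
    obtain ⟨y, hy, hyw⟩ := hS2 w
    refine (dimPt_mono W.structMap hyw).trans ?_
    have h1 := topdim_closure W.structMap y
    rw [hWd _ (hS2c y hy)] at h1
    exact_mod_cast h1.ge
  haveI : LocallyOfFiniteType (c ≫ sZ) := by rw [co]; infer_instance
  have hdim2 : ∀ w, dimPt sZ (c w) ≤ d' := fun x => by
    have := dimPt_le c sZ x
    rw [co] at this
    exact this.trans ((hdimW x).trans hdd)
  choose η2 h21 h22 h23 using fun x => enlarge d' sZ (c x) (hdim2 x)
  let S0 : Set (pullback P sZ : Scheme) := η1 '' S1 ∪ η2 '' S2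
  have hS0f : S0.Finite := (hS1f.image _).union (hS2f.image _)
  have hS0d : ∀ y ∈ S0, dimPt sY y = d' := by
    rintro _ (⟨x, -, rfl⟩ | ⟨x, -, rfl⟩)
    · exact h13 x
    · exact h23 x
  let S : Set (pullback P sZ : Scheme) := ⋃ g, aY g '' S0
  have hSf : S.Finite := Set.finite_iUnion fun g => hS0f.image _
  have hSd : ∀ y ∈ S, dimPt sY y = d' := by
    intro y hy
    obtain ⟨g, x, hx, rfl⟩ := Set.mem_iUnion.1 hy
    rw [aYdim, hS0d x hx]
  have hS0S : S0 ⊆ S := fun y hy => Set.mem_iUnion.2 ⟨1, y, hy, by rw [aY1]; rfl⟩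
  have hSa : ∀ g, ∀ y ∈ S, aY g y ∈ S := by
    intro g y hy
    obtain ⟨h, x, hx, rfl⟩ := Set.mem_iUnion.1 hy
    exact Set.mem_iUnion.2 ⟨g * h, x, hx, by rw [aYm]; rfl⟩
  obtain ⟨W', j, hW', hj, hr⟩ := exists_union S hSf
  have hmem : ∀ y, y ∈ Set.range j ↔ ∃ z ∈ S, z ⤳ y := by
    intro y
    rw [hr]
    simp only [Set.mem_iUnion, specializes_iff_mem_closure, exists_prop]
  obtain ⟨i', hi'⟩ := exists_lift_closed j iY (by
    rintro _ ⟨v, rfl⟩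
    obtain ⟨x, hx, hxv⟩ := hS1 v
    rw [hmem]
    refine ⟨η1 x, hS0S (Or.inl ⟨x, hx, rfl⟩), (h11 x).trans ?_⟩
    exact hxv.map iY.continuous)
  choose b hb using fun g => exists_lift_closed j (j ≫ aY g) (by
    rintro _ ⟨w, rfl⟩
    obtain ⟨z, hz, hzw⟩ := (hmem (j w)).1 ⟨w, rfl⟩
    rw [hmem]
    exact ⟨aY g z, hSa g z hz, hzw.map (aY g).continuous⟩)
  obtain ⟨ρ', hρ'⟩ := exists_aut b (by rw [← cancel_mono j, hb, aY1]; simp) (fun g h => by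
    rw [← cancel_mono j, hb, Category.assoc, hb, reassoc_of% hb h, aYm])
  have hPA := PA.closed sY hY j
  haveI := hPA.1
  have hφo : (j ≫ pr) ≫ W.structMap = j ≫ sY := by rw [Category.assoc, hpro]
  haveI : IsProper ((j ≫ pr) ≫ W.structMap) := by rw [hφo]; infer_instance
  haveI : IsProper (j ≫ pr) := IsProper.of_comp (j ≫ pr) W.structMap
  have hpure : IsPureOfDim W' d' := pure_of_points j sY S d' hSd hr
  have f1 : i' ≫ j ≫ pr = ψ := by rw [reassoc_of% hi', reassoc_of% iYs, qZs]
  have f2 : ∀ g, i' ≫ (ρ' g).hom = (σ.ρ g).hom ≫ i' := fun g => by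
    rw [hρ', ← cancel_mono j, Category.assoc, hb, reassoc_of% hi', iYa, Category.assoc, hi']
  have f3 : ∀ g, (ρ' g).hom ≫ j ≫ pr = j ≫ pr := fun g => by
    rw [hρ', reassoc_of% hb g, aYpr]
  refine ⟨mkVar (j ≫ sY) hW' hPA, j ≫ pr, i', hPA, hφo, ?_, ?_, ?_, hpure, ?_, ?_, ?_⟩
  · intro w
    obtain ⟨y, hy, hyw⟩ := hS2 w
    have hcl : IsClosed (Set.range (j ≫ pr)) := by
      rw [← Set.image_univ]; exact (j ≫ pr).isClosedMap _ isClosed_univ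
    have hyr : y ∈ Set.range (j ≫ pr) := by
      obtain ⟨u, hu⟩ := (hmem (η2 y)).2 ⟨η2 y, hS0S (Or.inr ⟨y, hy, rfl⟩), specializes_rfl⟩
      refine ⟨u, ?_⟩
      rw [Scheme.Hom.comp_apply, hu]
      change (pullback.snd P sZ ≫ pullback.snd sQ W.structMap) (η2 y) = y
      rw [Scheme.Hom.comp_apply]
      have := h22 y
      refine (congrArg (pullback.snd sQ W.structMap) this).trans ?_
      rw [← Scheme.Hom.comp_apply, cs]
      rfl
    exact hyw.mem_closed hcl hyr
  · haveI : IsImmersion (i' ≫ j) := by rw [hi']; exact iYimm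
    exact IsImmersion.of_comp i' j
  · change i' ≫ j ≫ sY = _
    rw [reassoc_of% hi', reassoc_of% iYs, qZo]
  · exact f1
  · exact generic_purity (j ≫ pr) W.structMap d d' hpure hWd
  · refine ⟨⟨ρ', fun g => ?_⟩, fun g => ?_, fun g => ?_⟩
    · change (ρ' g).hom ≫ j ≫ sY = j ≫ sY
      rw [hρ', reassoc_of% hb g, aYo]
    · exact f2 g
    · change (ρ' g).hom ≫ j ≫ pr = _
      exact f3 g

end

section

theorem intCl_equiv {A C L : Type} [CommRing A] [CommRing C] [Field L] [Algebra A C] [Algebra C L] [Algebra A L]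
    [IsScalarTower A C L] (hinj : Function.Injective (algebraMap C L))
    (hC : ∀ x : L, IsIntegral A x → ∃ c, algebraMap C L c = x) :
    Nonempty (integralClosure A C ≃ₐ[A] integralClosure A L) := by
  refine ⟨AlgEquiv.ofBijective ((IsScalarTower.toAlgHom A C L).mapIntegralClosure) ⟨?_, ?_⟩⟩
  · intro x y h
    apply Subtype.ext
    apply hinj
    exact congrArg Subtype.val h
  · rintro ⟨x, hx⟩
    obtain ⟨c, rfl⟩ := hC x hx
    exact ⟨⟨c, (isIntegral_algebraMap_iff hinj).1 hx⟩, rfl⟩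

theorem intCl_normal {A L : Type} [CommRing A] [IsDomain A] [Field L] [Algebra A L] [IsFractionRing A L] :
    IsIntegrallyClosed (integralClosure A L) := by
  haveI : FaithfulSMul A L := (faithfulSMul_iff_algebraMap_injective A L).2 (IsFractionRing.injective A L)
  haveI : Algebra.IsAlgebraic A L := IsLocalization.isAlgebraic L (nonZeroDivisors A)
  haveI : IsFractionRing (integralClosure A L) L := integralClosure.isFractionRing_of_algebraic (fun x h => by
    rw [← map_zero (algebraMap A L)] at h; exact IsFractionRing.injective A L h)
  rw [isIntegrallyClosed_iff L]
  intro x hx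
  have : IsIntegral A x := isIntegral_trans _ hx
  exact ⟨⟨x, this⟩, rfl⟩

theorem glue_ff {X : Scheme.{0}} [IsIntegral X] (U : X.Opens) [Nonempty U] (x : X.functionField)
    (h : ∀ p : X, p ∈ U → ∃ y : X.presheaf.stalk p, algebraMap (X.presheaf.stalk p) X.functionField y = x) :
    ∃ s : Γ(X, U), X.germToFunctionField U s = x := by
  have key : ∀ p : U, ∃ (V : X.Opens) (_ : V ≤ U) (_ : p.1 ∈ V) (_ : Nonempty V) (s : Γ(X, V)),
      X.germToFunctionField V s = x := by
    rintro ⟨p, hp⟩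
    obtain ⟨y, hy⟩ := h p hp
    obtain ⟨V, hV, s, rfl⟩ := X.presheaf.exists_germ_eq y
    haveI : Nonempty V := ⟨⟨p, hV⟩⟩
    haveI : Nonempty (V ⊓ U : X.Opens) := ⟨⟨p, hV, hp⟩⟩
    refine ⟨V ⊓ U, inf_le_right, ⟨hV, hp⟩, ⟨⟨p, hV, hp⟩⟩, X.presheaf.map (homOfLE inf_le_left).op s, ?_⟩
    rw [← hy, Scheme.algebraMap_germ_eq_germToFunctionField]
    exact X.presheaf.germ_res_apply _ _ _ s
  choose V hVU hpV hne s hs using key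
  obtain ⟨t, ht, -⟩ := X.sheaf.existsUnique_gluing' V U (fun p => homOfLE (hVU p))
    (fun p hp => Opens.mem_iSup.2 ⟨⟨p, hp⟩, hpV _⟩) s (by
      intro a b
      have hab : Nonempty (V a ⊓ V b : X.Opens) := by
        obtain ⟨z, hz⟩ := nonempty_preirreducible_inter (V a).isOpen (V b).isOpen
          ⟨_, hpV a⟩ ⟨_, hpV b⟩
        exact ⟨⟨z, hz⟩⟩
      apply X.germToFunctionField_injective (V a ⊓ V b)
      refine (X.presheaf.germ_res_apply _ _ _ (s a)).trans (Eq.trans ?_ (X.presheaf.germ_res_apply _ _ _ (s b)).symm)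
      exact (hs a).trans (hs b).symm)
  refine ⟨t, ?_⟩
  obtain ⟨p⟩ := id ‹Nonempty U›
  rw [← hs p, ← ht p]
  exact (X.presheaf.germ_res_apply _ _ _ t).symm

/-- algebra of a chart for the relative normalization -/
theorem chart_alg [IsAlgClosed K] {X Y : Scheme.{0}} [IsIntegral X] [IsIntegral Y] (hX : IsNormalScheme X)
    (f : X ⟶ Y) [IsOpenImmersion f] (sY : Y ⟶ SpecOf K) [LocallyOfFiniteType sY] (U : Y.Opens) (hU : IsAffineOpen U)
    [Nonempty U] :
    letI := (f.app U).hom.toAlgebra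
    Module.Finite Γ(Y, U) (integralClosure Γ(Y, U) Γ(X, f ⁻¹ᵁ U)) ∧
    IsIntegrallyClosed (integralClosure Γ(Y, U) Γ(X, f ⁻¹ᵁ U)) := by
  have hgen : f (genericPoint X) = genericPoint Y := genericPoint_eq_of_isOpenImmersion f
  have hgU : genericPoint Y ∈ U := ((genericPoint_spec Y).mem_open_set_iff U.isOpen).mpr
    (by obtain ⟨p⟩ := id ‹Nonempty U›; exact ⟨p.1, trivial, p.2⟩)
  have hgX : genericPoint X ∈ f ⁻¹ᵁ U := by change f _ ∈ U; rw [hgen]; exact hgU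
  haveI : Nonempty (f ⁻¹ᵁ U : X.Opens) := ⟨⟨_, hgX⟩⟩
  letI a1 : Algebra Γ(Y, U) Γ(X, f ⁻¹ᵁ U) := (f.app U).hom.toAlgebra
  letI a2 : Algebra Γ(Y, U) X.functionField := ((algebraMap Γ(X, f ⁻¹ᵁ U) X.functionField).comp (f.app U).hom).toAlgebra
  haveI : IsScalarTower Γ(Y, U) Γ(X, f ⁻¹ᵁ U) X.functionField := IsScalarTower.of_algebraMap_eq' rfl
  haveI : IsDomain Γ(Y, U) := inferInstance
  haveI : IsFractionRing Γ(Y, U) X.functionField := by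
    have h0 : ∀ (y : Y) (hy : y ∈ U), y = genericPoint Y →
        @IsFractionRing Γ(Y, U) _ (Y.presheaf.stalk y) _ (Y.presheaf.germ U y hy).hom.toAlgebra := by
      rintro y hy rfl
      exact functionField_isFractionRing_of_isAffineOpen Y U hU
    letI a4 : Algebra Γ(Y, U) (Y.presheaf.stalk (f (genericPoint X))) := (Y.presheaf.germ U _ hgX).hom.toAlgebra
    haveI := h0 _ hgX hgen
    let e : Y.presheaf.stalk (f (genericPoint X)) ≃+* X.functionField :=
      (asIso (f.stalkMap (genericPoint X))).commRingCatIsoToRingEquiv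
    refine IsFractionRing.of_algEquiv (AlgEquiv.ofRingEquiv (f := e) (R := Γ(Y, U)) fun r => ?_)
    exact f.germ_stalkMap_apply U _ hgX r
  letI a3 : Algebra K Γ(Y, U) := (kmap sY U).toAlgebra
  haveI : Algebra.FiniteType K Γ(Y, U) := kmap_finiteType sY U hU
  have hinj : Function.Injective (algebraMap Γ(X, f ⁻¹ᵁ U) X.functionField) := X.germToFunctionField_injective _
  obtain ⟨e⟩ := intCl_equiv (A := Γ(Y, U)) hinj (by
    intro x hx
    apply glue_ff
    intro p hp
    have h1 : IsIntegral Γ(X, f ⁻¹ᵁ U) x := hx.tower_top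
    letI : Algebra Γ(X, f ⁻¹ᵁ U) (X.presheaf.stalk p) := (X.presheaf.germ (f ⁻¹ᵁ U) p hp).hom.toAlgebra
    haveI : IsScalarTower Γ(X, f ⁻¹ᵁ U) (X.presheaf.stalk p) X.functionField :=
      IsScalarTower.of_algebraMap_eq fun r => (Scheme.algebraMap_germ_eq_germToFunctionField X hp r).symm
    have h2 : IsIntegral (X.presheaf.stalk p) x := h1.tower_top
    haveI := (hX p).2
    exact IsIntegrallyClosed.isIntegral_iff.1 h2)
  haveI := finite_integralClosure_fg K Γ(Y, U) X.functionField
  haveI : IsIntegrallyClosed (integralClosure Γ(Y, U) X.functionField) := intCl_normal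
  exact ⟨Module.Finite.equiv e.symm.toLinearEquiv, IsIntegrallyClosed.of_equiv e.symm.toRingEquiv⟩

theorem norm_finite [IsAlgClosed K] {X Y : Scheme.{0}} [IsIntegral X] [IsIntegral Y] (hX : IsNormalScheme X)
    (f : X ⟶ Y) [IsOpenImmersion f] [QuasiCompact f] (sY : Y ⟶ SpecOf K) [LocallyOfFiniteType sY] :
    IsFinite f.fromNormalization := by
  rw [isFinite_iff]
  refine ⟨inferInstance, fun U hU => ?_⟩
  by_cases hne : Nonempty U
  · obtain ⟨h1, -⟩ := chart_alg hX f sY U hU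
    letI := (f.app U).hom.toAlgebra
    rw [f.fromNormalization_app hU, CommRingCat.hom_comp]
    refine RingHom.Finite.comp (RingHom.Finite.of_surjective _ ?_) (RingHom.finite_algebraMap.2 h1)
    exact (f.normalizationObjIso hU).symm.commRingCatIsoToRingEquiv.surjective
  · have hb : U = ⊥ := by
      ext x
      exact ⟨fun hx => (hne ⟨⟨x, hx⟩⟩).elim, fun hx => hx.elim⟩
    subst hb
    have : Subsingleton Γ(f.normalization, f.fromNormalization ⁻¹ᵁ ⊥) :=
      inferInstanceAs (Subsingleton Γ(f.normalization, ⊥))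
    exact RingHom.Finite.of_surjective _ (fun x => ⟨0, Subsingleton.elim _ _⟩)

theorem norm_normal [IsAlgClosed K] {X Y : Scheme.{0}} [IsIntegral X] [IsIntegral Y] (hX : IsNormalScheme X)
    (f : X ⟶ Y) [IsOpenImmersion f] [QuasiCompact f] (sY : Y ⟶ SpecOf K) [LocallyOfFiniteType sY] :
    IsNormalScheme f.normalization := by
  intro w
  refine ⟨inferInstance, ?_⟩
  obtain ⟨_, ⟨U, hU, rfl⟩, hwU, -⟩ :=
      Y.isBasis_affineOpens.exists_subset_of_mem_open (Set.mem_univ (f.fromNormalization w)) isOpen_univ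
  haveI : Nonempty U := ⟨⟨_, hwU⟩⟩
  haveI : Nonempty (f.fromNormalization ⁻¹ᵁ U : f.normalization.Opens) := ⟨⟨w, hwU⟩⟩
  obtain ⟨-, h2⟩ := chart_alg hX f sY U hU
  letI := (f.app U).hom.toAlgebra
  haveI : IsIntegrallyClosed Γ(f.normalization, f.fromNormalization ⁻¹ᵁ U) :=
    IsIntegrallyClosed.of_equiv (f.normalizationObjIso hU).symm.commRingCatIsoToRingEquiv
  have hA := hU.preimage f.fromNormalization
  haveI := hA.isLocalization_stalk ⟨w, hwU⟩
  letI : Algebra Γ(f.normalization, f.fromNormalization ⁻¹ᵁ U) (f.normalization.presheaf.stalk w) :=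
    TopCat.Presheaf.algebra_section_stalk f.normalization.presheaf (⟨w, hwU⟩ : (f.fromNormalization ⁻¹ᵁ U : f.normalization.Opens))
  exact isIntegrallyClosed_of_isLocalization (f.normalization.presheaf.stalk w)
    (hA.primeIdealOf ⟨w, hwU⟩).asIdeal.primeCompl (Ideal.primeCompl_le_nonZeroDivisors _)

theorem compactify_normal [IsAlgClosed K] (V : Variety K) (hV : V.IsQuasiProjective) (hI : IsIntegral V.X)
    (hN : IsNormalScheme V.X) (d : ℕ) (hd : V.dim = d) :
    ∃ (W : Variety K) (i : V.X ⟶ W.X), PA W.structMap ∧ IsImmersion i ∧ i ≫ W.structMap = V.structMap ∧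
      IsPureOfDim W.X d ∧ IsIntegral W.X ∧ IsNormalScheme W.X ∧ IsOpen (Set.range i.base) ∧ Dense (Set.range i.base) := by
  obtain ⟨n, i0, hi0, hover⟩ := hV
  haveI := V.locallyOfFiniteType
  haveI := V.quasiCompact
  let p := ProjSpace.structMap K n
  have hPA : PA p := PA.proj n
  haveI := hPA.1
  haveI : QuasiCompact (i0 ≫ p) := by rw [hover]; infer_instance
  haveI : QuasiCompact i0 := QuasiCompact.of_comp i0 p
  obtain ⟨Y, g, k, hg, hk, hgk, hgd, hYI⟩ : ∃ (Y : Scheme.{0}) (g : V.X ⟶ Y) (k : Y ⟶ ProjSpace K n), IsOpenImmersion g ∧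
      IsClosedImmersion k ∧ g ≫ k = i0 ∧ IsDominant g ∧ IsIntegral Y :=
    ⟨i0.image, i0.toImage, i0.imageι, inferInstance, inferInstance, i0.toImage_imageι, inferInstance, by
      haveI : IsReduced i0.image := ⟨fun U => isReduced_of_injective (S := Γ(V.X, i0.toImage ⁻¹ᵁ U)) (i0.toImage.app U).hom
        ((TopCat.Presheaf.app_injective_iff_stalkFunctor_map_injective (F := i0.image.sheaf) i0.toImage.c).1
          i0.stalkFunctor_toImage_injective U)⟩
      have : IrreducibleSpace i0.image := by
        rw [irreducibleSpace_def]
        convert! ((IrreducibleSpace.isIrreducible_univ V.X).image _ i0.toImage.continuous.continuousOn).closure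
        simpa using i0.toImage.denseRange.closure_range.symm
      exact isIntegral_of_irreducibleSpace_of_isReduced _⟩
  haveI : QuasiCompact g := by
    haveI : QuasiCompact (g ≫ k) := by rw [hgk]; infer_instance
    exact QuasiCompact.of_comp g k
  haveI := norm_finite hN g (k ≫ p)
  have hNN := norm_normal hN g (k ≫ p)
  have hfac := g.toNormalization_fromNormalization
  obtain ⟨W, i, q, hW, hi, hid, hq, hWN, hiq⟩ : ∃ (W : Scheme.{0}) (i : V.X ⟶ W) (q : W ⟶ Y), IsIntegral W ∧ IsOpenImmersion i ∧
      IsDominant i ∧ IsFinite q ∧ IsNormalScheme W ∧ i ≫ q = g :=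
    ⟨g.normalization, g.toNormalization, g.fromNormalization, inferInstance, inferInstance, inferInstance, inferInstance, hNN, hfac⟩
  have hP : PA ((q ≫ k) ≫ p) := PA.closed p hPA (q ≫ k)
  have hov : i ≫ (q ≫ k) ≫ p = V.structMap := by
    rw [Category.assoc, reassoc_of% hiq, reassoc_of% hgk]; exact hover
  refine ⟨mkVar ((q ≫ k) ≫ p) inferInstance hP, i, hP, (inferInstance : IsImmersion i), hov, ?_, hW, hWN, i.isOpenEmbedding.isOpen_range, i.denseRange⟩
  have := hP.1
  refine pure_of_points (𝟙 W) ((q ≫ k) ≫ p) {genericPoint W} d ?_ ?_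
  · rintro _ rfl
    rw [← genericPoint_eq_of_isOpenImmersion i]
    haveI : LocallyOfFiniteType (i ≫ (q ≫ k) ≫ p) := by rw [hov]; infer_instance
    have h1 := dimPt_eq i ((q ≫ k) ≫ p) (genericPoint V.X)
    rw [h1]
    have h2 := topdim_closure (i ≫ (q ≫ k) ≫ p) (genericPoint V.X)
    have h3 : closure {genericPoint V.X} = (Set.univ : Set V.X) := (genericPoint_spec V.X).def
    rw [h3, (Homeomorph.Set.univ V.X).isHomeomorph.topologicalKrullDim_eq] at h2
    have h4 := hd.symm.trans h2
    exact_mod_cast h4.symm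
  · have h3 : closure {genericPoint W} = (Set.univ : Set W) := (genericPoint_spec W).def
    simp [h3]

end

theorem dim_le_of_dense {X Y : Scheme.{0}} (φ : X ⟶ Y) (s : Y ⟶ SpecOf K) (s' : X ⟶ SpecOf K) [LocallyOfFiniteType s]
    [LocallyOfFiniteType s'] [QuasiCompact s'] (hφ : φ ≫ s = s') (hdense : Dense (Set.range φ.base)) (d d' : ℕ)
    (hd : topologicalKrullDim Y = d) (hd' : ∀ x, dimPt s' x ≤ d') : d ≤ d' := by
  obtain ⟨S, hSf, hS, -⟩ := exists_generics s'
  have hcl : IsClosed (⋃ z ∈ φ '' S, closure {z}) := (hSf.image φ).isClosed_biUnion (fun _ _ => isClosed_closure)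
  have hsub : Set.range φ ⊆ ⋃ z ∈ φ '' S, closure {z} := by
    rintro _ ⟨x, rfl⟩
    obtain ⟨y, hy, hyx⟩ := hS x
    simp only [Set.mem_iUnion]
    exact ⟨φ y, ⟨y, hy, rfl⟩, specializes_iff_mem_closure.1 (hyx.map φ.continuous)⟩
  haveI : LocallyOfFiniteType (φ ≫ s) := by rw [hφ]; infer_instance
  have h1 : ∀ y : Y, dimPt s y ≤ d' := by
    intro y
    have h2 : y ∈ ⋃ z ∈ φ '' S, closure {z} := closure_minimal hsub hcl (hdense y)
    obtain ⟨_, ⟨x, hx, rfl⟩, h3⟩ := Set.mem_iUnion₂.1 h2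
    refine (dimPt_mono s (specializes_iff_mem_closure.2 h3)).trans ((dimPt_le φ s x).trans ?_)
    rw [hφ]; exact hd' x
  have h4 := topdim_le_of_dimPt s Set.univ isClosed_univ d' (fun x _ => h1 x)
  rw [(Homeomorph.Set.univ Y).isHomeomorph.topologicalKrullDim_eq, hd] at h4
  exact_mod_cast h4

/-- Compactification of a dominant morphism of quasi-projective varieties,
equivariantly for a finite group action along the fibres, with pure total spaces and
generically pure fibres. -/
theorem statement0 (K : Type) [Field K] [IsAlgClosed K]
    (V' V : Variety K) (hV' : V'.IsQuasiProjective) (hV : V.IsQuasiProjective)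
    (φ : V'.X ⟶ V.X) (hφ : φ ≫ V.structMap = V'.structMap)
    (hdense : Dense (Set.range φ.base))
    (G : Type) [Group G] [Finite G] (σ : ActionOn G V')
    (hinv : σ.Invariant φ) :
    ∃ (W' W : Variety K) (φbar : W'.X ⟶ W.X)
      (i : V.X ⟶ W.X) (i' : V'.X ⟶ W'.X),
      W'.IsProjective ∧ W.IsProjective ∧
      φbar ≫ W.structMap = W'.structMap ∧
      Function.Surjective φbar.base ∧
      IsImmersion i ∧ i ≫ W.structMap = V.structMap ∧
      IsImmersion i' ∧ i' ≫ W'.structMap = V'.structMap ∧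
      -- (1) purity of the compactifications
      IsPureOfDim W'.X V'.dim ∧ IsPureOfDim W.X V.dim ∧
      -- (2) if `V` is integral and normal, `W` can be taken integral and normal
      -- with `i (V)` open and dense
      (IsIntegral V.X ∧ IsNormalScheme V.X →
        IsIntegral W.X ∧ IsNormalScheme W.X ∧
        IsOpen (Set.range i.base) ∧ Dense (Set.range i.base)) ∧
      -- (3) `φbar` extends `φ`
      i' ≫ φbar = φ ≫ i ∧
      -- (4) the fibres of `φbar` are pure over a dense open subset of `W`
      (∃ U : W.X.Opens, Dense (U : Set W.X) ∧
        ∀ y : W.X, y ∈ U → IsPure (fiber φbar y)) ∧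
      -- (5) the `G`-action extends, and `φbar` is invariant for it
      (∃ σbar : ActionOn G W',
        (∀ g : G, i' ≫ (σbar.ρ g).hom = (σ.ρ g).hom ≫ i') ∧
        σbar.Invariant φbar) := by
  have hinv' : ∀ (W : Variety K) (i : V.X ⟶ W.X), σ.Invariant (φ ≫ i) := fun W i g => by
    rw [← Category.assoc, hinv g]
  haveI := V.locallyOfFiniteType
  haveI := V.quasiCompact
  haveI := V'.locallyOfFiniteType
  haveI := V'.quasiCompact
  by_cases hE : Nonempty V'.X
  · haveI : Nonempty V.X := hE.map φ
    obtain ⟨d, hd, hdx⟩ := exists_dim V.structMap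
    obtain ⟨d', hd', hdx'⟩ := exists_dim V'.structMap
    have hdd : d ≤ d' := dim_le_of_dense φ V.structMap V'.structMap hφ hdense d d' hd hdx'
    suffices main : ∃ (W : Variety K) (i : V.X ⟶ W.X), PA W.structMap ∧ IsImmersion i ∧ i ≫ W.structMap = V.structMap ∧
        IsPureOfDim W.X d ∧ (IsIntegral V.X ∧ IsNormalScheme V.X →
        IsIntegral W.X ∧ IsNormalScheme W.X ∧
        IsOpen (Set.range i.base) ∧ Dense (Set.range i.base)) by
      obtain ⟨W, i, hW, hi, hiW, hp, hn⟩ := main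
      obtain ⟨W', φbar, i', a1, a2, a3, a4, a5, a6, a7, a8, a9⟩ := compactify_total V' W hV' hW d d' hdd hp hdx'
        (φ ≫ i) (by rw [Category.assoc, hiW, hφ]) G σ (hinv' W i)
      refine ⟨W', W, φbar, i, i', PA.isProjective W' a1, PA.isProjective W hW, a2, a3, hi, hiW, a4, a5, ?_, ?_, hn, a7, a8, a9⟩
      · rw [show V'.dim = d' from hd']; exact a6
      · rw [show V.dim = d from hd]; exact hp
    by_cases hc : IsIntegral V.X ∧ IsNormalScheme V.X
    · obtain ⟨W, i, b1, b2, b3, b4, b5⟩ := compactify_normal V hV hc.1 hc.2 d hd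
      exact ⟨W, i, b1, b2, b3, b4, fun _ => b5⟩
    · obtain ⟨W, i, b1, b2, b3, b4, b5⟩ := compactify_base V hV d hdx
      exact ⟨W, i, b1, b2, b3, b4, fun h => (hc h).elim⟩
  · have hE' : IsEmpty V'.X := not_nonempty_iff.1 hE
    have hEV : IsEmpty V.X := by
      by_contra h
      rw [not_isEmpty_iff] at h
      obtain ⟨x, ⟨y, rfl⟩⟩ := hdense.nonempty
      exact hE ⟨y⟩
    obtain ⟨W, i, b1, b2, b3, b4, b5⟩ := compactify_base V hV 0 (fun x => (hEV.false x).elim)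
    have hW := b5 hEV
    obtain ⟨W', φbar, i', a1, a2, a3, a4, a5, a6, a7, a8, a9⟩ := compactify_total V' W hV' b1 0 0 le_rfl b4
        (fun x => (hE'.false x).elim) (φ ≫ i) (by rw [Category.assoc, b3, hφ]) G σ (hinv' W i)
    refine ⟨W', W, φbar, i, i', PA.isProjective W' a1, PA.isProjective W b1, a2, a3, b2, b3, a4, a5, ?_, ?_, ?_, a7, a8, a9⟩
    · intro T hT
      obtain ⟨x, -⟩ := hT.1.1
      exact (hW.false (φbar x)).elim
    · intro T hT
      obtain ⟨x, -⟩ := hT.1.1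
      exact (hW.false x).elim
    · rintro ⟨h, -⟩
      exact (hEV.false (genericPoint V.X)).elim

end HLpaper
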